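/- Let A be a Borel subset of ℝ² with Hausdorff dimension s. Then the set of points y ∈ ℝ² for which the pinned distance set Δ_y(A) has Hausdorff dimension strictly less than min((2/3)s, 1) has Hausdorff dimension at most max(1, 2−s). -/

import Mathlib

open MeasureTheory Set

noncomputable section

/-- The value at `z` of the linear functional `z ↦ z.1 + m * z.2`. -/
def lin (z : ℝ × ℝ) (m : ℝ) : ℝ := z.1 + m * z.2

/-- A Lipschitz cutoff which is `1` on `[-3, 3]` and vanishes outside `[-4, 4]`. -/
def cutoff (m : ℝ) : ℝ := max 0 (min 1 (4 - |m|))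

/-- Indicator function of `[0, δ)`. -/
def slab (δ u : ℝ) : ℝ := (Ico 0 δ).indicator 1 u

/-- The Haar function of `[0, δ)`. -/
def haar (δ u : ℝ) : ℝ := slab (δ / 2) u - slab (δ / 2) (u - δ / 2)

lemma lin_sub (z w : ℝ × ℝ) (m : ℝ) : lin (z - w) m = lin z m - lin w m := by
  simp [lin]; ring

lemma lin_continuous (z : ℝ × ℝ) : Continuous (lin z) := by unfold lin; fun_prop

lemma cutoff_nonneg (m : ℝ) : 0 ≤ cutoff m := le_max_left _ _

lemma cutoff_le_one (m : ℝ) : cutoff m ≤ 1 := by simp [cutoff]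

lemma cutoff_eq_one {m : ℝ} (h : |m| ≤ 3) : cutoff m = 1 := by
  unfold cutoff
  rw [min_eq_left (by linarith), max_eq_right zero_le_one]

lemma cutoff_eq_zero {m : ℝ} (h : 4 ≤ |m|) : cutoff m = 0 := by
  unfold cutoff
  rw [max_eq_left]; exact (min_le_right _ _).trans (by linarith)

lemma abs_lt_of_cutoff_ne_zero {m : ℝ} (h : cutoff m ≠ 0) : |m| < 4 := by
  by_contra! h'; exact h (cutoff_eq_zero h')

lemma cutoff_continuous : Continuous cutoff := by unfold cutoff; fun_prop

lemma cutoff_sub_le (m m' : ℝ) : |cutoff m - cutoff m'| ≤ |m - m'| := by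
  unfold cutoff
  have h1 := abs_max_sub_max_le_abs (min 1 (4 - |m|)) (min 1 (4 - |m'|)) 0
  rw [max_comm _ (0 : ℝ), max_comm _ (0 : ℝ)] at h1
  refine h1.trans ?_
  have h2 := abs_min_sub_min_le_max 1 (4 - |m|) 1 (4 - |m'|)
  refine h2.trans ?_
  rw [sub_self, abs_zero, max_eq_right (abs_nonneg _)]
  have h3 : 4 - |m| - (4 - |m'|) = |m'| - |m| := by ring
  rw [h3, abs_sub_comm m m']
  exact abs_abs_sub_abs_le_abs_sub _ _

lemma slab_nonneg (δ u : ℝ) : 0 ≤ slab δ u := indicator_nonneg (by simp) _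

lemma slab_le_one (δ u : ℝ) : slab δ u ≤ 1 := by
  unfold slab; exact indicator_le_self' (by simp) _

lemma slab_eq_one {δ u : ℝ} (h : 0 ≤ u) (h' : u < δ) : slab δ u = 1 := by
  simp [slab, h, h']

lemma slab_eq_zero {δ u : ℝ} (h : u < 0 ∨ δ ≤ u) : slab δ u = 0 := by
  unfold slab; rw [indicator_of_notMem]; simp only [mem_Ico, not_and_or, not_le, not_lt]; exact h

lemma slab_measurable (δ : ℝ) : Measurable (slab δ) := by
  unfold slab; exact measurable_one.indicator measurableSet_Ico

lemma slab_split (δ u : ℝ) (hδ : 0 ≤ δ) : slab δ u = slab (δ / 2) u + slab (δ / 2) (u - δ / 2) := by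
  rcases lt_or_ge u 0 with h | h
  · rw [slab_eq_zero (.inl h), slab_eq_zero (.inl h), slab_eq_zero (.inl (by linarith))]; simp
  rcases lt_or_ge u (δ / 2) with h1 | h1
  · rw [slab_eq_one h (by linarith), slab_eq_one h h1, slab_eq_zero (.inl (by linarith))]; simp
  rcases lt_or_ge u δ with h2 | h2
  · rw [slab_eq_one h h2, slab_eq_zero (.inr h1), slab_eq_one (by linarith) (by linarith)]; simp
  · rw [slab_eq_zero (.inr h2), slab_eq_zero (.inr h1), slab_eq_zero (.inr (by linarith))]; simp

lemma haar_measurable (δ : ℝ) : Measurable (haar δ) := by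
  unfold haar
  exact (slab_measurable _).sub ((slab_measurable _).comp (measurable_id.sub_const _))

lemma abs_haar_le (δ u : ℝ) : |haar δ u| ≤ 1 := by
  unfold haar
  rw [abs_le]
  constructor <;> linarith [slab_nonneg (δ / 2) u, slab_le_one (δ / 2) u,
    slab_nonneg (δ / 2) (u - δ / 2), slab_le_one (δ / 2) (u - δ / 2)]

lemma haar_eq_zero {δ u : ℝ} (hδ : 0 ≤ δ) (h : u < 0 ∨ δ ≤ u) : haar δ u = 0 := by
  unfold haar
  rcases h with h | h
  · rw [slab_eq_zero (.inl h), slab_eq_zero (.inl (by linarith)), sub_zero]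
  · rw [slab_eq_zero (.inr (by linarith)), slab_eq_zero (.inr (by linarith)), sub_zero]

/-- A bounded measurable function on the plane with bounded support is integrable. -/
lemma integrable_of_bounded_support {F : ℝ × ℝ → ℝ} (hF : Measurable F) (C R : ℝ)
    (hC : ∀ z, |F z| ≤ C) (hR : ∀ z, F z ≠ 0 → |z.1| ≤ R ∧ |z.2| ≤ R) : Integrable F := by
  have hs : Function.support F ⊆ Icc (-R) R ×ˢ Icc (-R) R := by
    intro z hz
    obtain ⟨h1, h2⟩ := hR z hz
    exact ⟨abs_le.mp h1, abs_le.mp h2⟩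
  rw [← integrableOn_iff_integrable_of_support_subset hs]
  refine Measure.integrableOn_of_bounded (M := C) ?_ hF.aestronglyMeasurable ?_
  · exact ((isCompact_Icc.prod isCompact_Icc).measure_lt_top).ne
  · exact Filter.Eventually.of_forall fun z => by simpa using hC z

section kernel

variable {h h' : ℝ → ℝ} {δ : ℝ}

lemma integrable_cutoff_mul (hh : Measurable h) (hb : ∀ u, |h u| ≤ 1)
    (hs : ∀ u, (u < 0 ∨ δ ≤ u) → h u = 0) (p : ℝ × ℝ) :
    Integrable (fun z : ℝ × ℝ => cutoff z.1 * h (lin p z.1 - z.2)) := by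
  refine integrable_of_bounded_support ?_ 1 (4 + |p.1| + 4 * |p.2| + |δ|) ?_ ?_
  · refine (cutoff_continuous.measurable.comp measurable_fst).mul (hh.comp ?_)
    exact ((lin_continuous p).measurable.comp measurable_fst).sub measurable_snd
  · intro z
    rw [abs_mul, abs_of_nonneg (cutoff_nonneg _)]
    exact mul_le_one₀ (cutoff_le_one _) (abs_nonneg _) (hb _)
  · intro z hz
    have h1 := abs_lt_of_cutoff_ne_zero (left_ne_zero_of_mul hz)
    have h2 : ¬ (lin p z.1 - z.2 < 0 ∨ δ ≤ lin p z.1 - z.2) := fun h => (right_ne_zero_of_mul hz) (hs _ h)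
    push Not at h2
    have h3 : |lin p z.1| ≤ |p.1| + 4 * |p.2| := by
      unfold lin
      refine (abs_add_le _ _).trans ?_
      rw [abs_mul]; gcongr
    rw [abs_le] at h3
    have := abs_nonneg p.1
    have := abs_nonneg p.2
    have := le_abs_self δ
    refine ⟨by linarith, ?_⟩
    rw [abs_le]
    constructor <;> linarith

lemma integrable_kernel (hh : Measurable h) (hb : ∀ u, |h u| ≤ 1)
    (hs : ∀ u, (u < 0 ∨ δ ≤ u) → h u = 0) (hh' : Measurable h') (hb' : ∀ u, |h' u| ≤ 1)
    (p p' : ℝ × ℝ) :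
    Integrable (fun z : ℝ × ℝ => cutoff z.1 * h (lin p z.1 - z.2) * h' (lin p' z.1 - z.2)) := by
  refine (integrable_cutoff_mul hh hb hs p).mul_bdd (c := 1) ?_ ?_
  · refine (hh'.comp ?_).aestronglyMeasurable
    exact ((lin_continuous p').measurable.comp measurable_fst).sub measurable_snd
  · exact Filter.Eventually.of_forall fun z => by simpa using hb' _

lemma kernel_eq (hh : Measurable h) (hb : ∀ u, |h u| ≤ 1)
    (hs : ∀ u, (u < 0 ∨ δ ≤ u) → h u = 0) (hh' : Measurable h') (hb' : ∀ u, |h' u| ≤ 1)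
    (p p' : ℝ × ℝ) :
    ∫ z : ℝ × ℝ, cutoff z.1 * h (lin p z.1 - z.2) * h' (lin p' z.1 - z.2) =
      ∫ u, h u * ∫ m, cutoff m * h' (u - lin (p - p') m) := by
  rw [Measure.volume_eq_prod, integral_prod _ (integrable_kernel hh hb hs hh' hb' p p')]
  have key : ∀ m : ℝ, ∫ r, cutoff m * h (lin p m - r) * h' (lin p' m - r) =
      ∫ u, cutoff m * h u * h' (u - lin (p - p') m) := by
    intro m
    rw [← integral_sub_left_eq_self (fun u => cutoff m * h u * h' (u - lin (p - p') m)) volume (lin p m)]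
    congr 1; ext r
    rw [lin_sub]
    congr 2; ring
  simp only [key]
  rw [integral_integral_swap]
  · congr 1; ext u
    rw [← integral_const_mul]
    congr 1; ext m; ring
  · refine integrable_of_bounded_support (F := Function.uncurry fun m u =>
      cutoff m * h u * h' (u - lin (p - p') m)) ?_ 1 (4 + |δ|) ?_ ?_
    · refine Measurable.mul (Measurable.mul ?_ ?_) ?_
      · exact cutoff_continuous.measurable.comp measurable_fst
      · exact hh.comp measurable_snd
      · exact hh'.comp (measurable_snd.sub ((lin_continuous _).measurable.comp measurable_fst))
    · rintro ⟨m, u⟩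
      simp only [Function.uncurry, abs_mul, abs_of_nonneg (cutoff_nonneg _)]
      exact mul_le_one₀ (mul_le_one₀ (cutoff_le_one _) (abs_nonneg _) (hb _)) (abs_nonneg _) (hb' _)
    · rintro ⟨m, u⟩ hz
      simp only [Function.uncurry] at hz
      have h1 := abs_lt_of_cutoff_ne_zero (left_ne_zero_of_mul (left_ne_zero_of_mul hz))
      have h2 : ¬ (u < 0 ∨ δ ≤ u) := fun h => (right_ne_zero_of_mul (left_ne_zero_of_mul hz)) (hs _ h)
      push Not at h2
      have := le_abs_self δ
      simp only
      refine ⟨by linarith [abs_nonneg δ], ?_⟩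
      rw [abs_le]; constructor <;> linarith

lemma abs_kernel_le (hδ : 0 ≤ δ) (hh : Measurable h) (hb : ∀ u, |h u| ≤ 1)
    (hs : ∀ u, (u < 0 ∨ δ ≤ u) → h u = 0) (hh' : Measurable h') (hb' : ∀ u, |h' u| ≤ 1)
    (p p' : ℝ × ℝ) {B : ℝ} (hB : ∀ u, 0 ≤ u → u < δ → |∫ m, cutoff m * h' (u - lin (p - p') m)| ≤ B) :
    |∫ z : ℝ × ℝ, cutoff z.1 * h (lin p z.1 - z.2) * h' (lin p' z.1 - z.2)| ≤ B * δ := by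
  rw [kernel_eq hh hb hs hh' hb']
  have h0 : ∀ u, u ∉ Ico 0 δ → h u * ∫ m, cutoff m * h' (u - lin (p - p') m) = 0 := by
    intro u hu
    rw [hs u, zero_mul]
    by_contra! hc
    exact hu ⟨hc.1, hc.2⟩
  rw [← setIntegral_eq_integral_of_forall_compl_eq_zero h0, ← Real.norm_eq_abs]
  refine (norm_setIntegral_le_of_norm_le_const (C := B) (by simp) ?_).trans ?_
  · intro u hu
    rw [norm_mul]
    simp only [Real.norm_eq_abs]
    calc _ ≤ 1 * |∫ m, cutoff m * h' (u - lin (p - p') m)| := by gcongr; exact hb u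
      _ ≤ B := by rw [one_mul]; exact hB u hu.1 hu.2
  · simp [measureReal_def, hδ]

end kernel
end

section innerBounds

lemma integral_slab {δ : ℝ} (hδ : 0 ≤ δ) : ∫ u, slab δ u = δ := by
  unfold slab
  rw [integral_indicator measurableSet_Ico]
  simp [measureReal_def, hδ]

lemma integral_slab_affine {δ : ℝ} (hδ : 0 ≤ δ) (c w : ℝ) :
    ∫ m, slab δ (c - m * w) = δ / |w| := by
  rw [Measure.integral_comp_mul_right (fun y => slab δ (c - y)),
    integral_sub_left_eq_self (slab δ) volume c, integral_slab hδ, abs_inv, smul_eq_mul]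
  ring

lemma integrable_slab_affine (δ c : ℝ) {w : ℝ} (hw : w ≠ 0) :
    Integrable fun m => slab δ (c - m * w) := by
  have h1 : Integrable (slab δ) := by
    unfold slab
    exact (integrable_indicator_iff measurableSet_Ico).2 (integrableOn_const (by simp))
  have h2 : Integrable fun y => slab δ (c - y) := h1.comp_sub_left c
  exact h2.comp_mul_right' hw

lemma integrable_cutoff : Integrable cutoff := by
  have hc : HasCompactSupport cutoff := by
    refine HasCompactSupport.of_support_subset_isCompact (isCompact_Icc (a := -4) (b := 4)) ?_
    intro m hm
    exact abs_le.mp (abs_lt_of_cutoff_ne_zero hm).le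
  exact cutoff_continuous.integrable_of_hasCompactSupport hc

lemma integral_cutoff_le : ∫ m, cutoff m ≤ 8 := by
  have h0 : ∀ u, u ∉ Icc (-4 : ℝ) 4 → cutoff u = 0 := by
    intro u hu
    by_contra h
    exact hu (abs_le.mp (abs_lt_of_cutoff_ne_zero h).le)
  rw [← setIntegral_eq_integral_of_forall_compl_eq_zero h0]
  have : ∫ m in Icc (-4 : ℝ) 4, cutoff m ≤ ∫ m in Icc (-4 : ℝ) 4, (1 : ℝ) := by
    refine setIntegral_mono integrable_cutoff.integrableOn (integrableOn_const (by simp)) ?_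
    exact cutoff_le_one
  refine this.trans ?_
  simp [measureReal_def]; norm_num

lemma abs_integral_cutoff_mul_le {h : ℝ → ℝ} (hb : ∀ u, |h u| ≤ 1) :
    |∫ m, cutoff m * h m| ≤ 8 := by
  refine le_trans ?_ integral_cutoff_le
  rw [← Real.norm_eq_abs]
  refine norm_integral_le_of_norm_le integrable_cutoff (Filter.Eventually.of_forall fun m => ?_)
  rw [norm_mul, Real.norm_eq_abs, Real.norm_eq_abs, abs_of_nonneg (cutoff_nonneg _)]
  exact mul_le_of_le_one_right (cutoff_nonneg _) (hb _)

/-- Either the strips around two points are disjoint in the range of the cutoff, or the second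
coordinate of their difference is comparable to its norm. -/
lemma norm_le_of_lin_lt {z : ℝ × ℝ} {δ m : ℝ} (hz : 10 * δ ≤ ‖z‖) (hm : |m| < 4)
    (hl : |lin z m| ≤ δ) : ‖z‖ ≤ 5 * |z.2| := by
  rw [Prod.norm_def] at hz ⊢
  simp only [Real.norm_eq_abs] at *
  have h1 : |z.1| ≤ δ + 4 * |z.2| := by
    have : z.1 = lin z m - m * z.2 := by simp [lin]
    rw [this]
    refine (abs_sub _ _).trans ?_
    rw [abs_mul]
    have := abs_nonneg z.2
    nlinarith
  rcases max_cases |z.1| |z.2| with ⟨h, h'⟩ | ⟨h, h'⟩ <;> rw [h] at hz ⊢ <;>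
    linarith [abs_nonneg z.2, abs_nonneg z.1]

lemma inner_eq_zero_or {h : ℝ → ℝ} {δ u : ℝ} (z : ℝ × ℝ)
    (hs : ∀ u, (u < 0 ∨ δ ≤ u) → h u = 0) (hz : 10 * δ ≤ ‖z‖) (hu : 0 ≤ u) (hu' : u < δ) :
    ∫ m, cutoff m * h (u - lin z m) = 0 ∨ ‖z‖ ≤ 5 * |z.2| := by
  by_cases hc : ∀ m, cutoff m * h (u - lin z m) = 0
  · left; simp [hc]
  · right
    push Not at hc
    obtain ⟨m, hm⟩ := hc
    have h1 := abs_lt_of_cutoff_ne_zero (left_ne_zero_of_mul hm)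
    have h2 : ¬ (u - lin z m < 0 ∨ δ ≤ u - lin z m) := fun h => (right_ne_zero_of_mul hm) (hs _ h)
    push Not at h2
    refine norm_le_of_lin_lt hz h1 ?_
    rw [abs_le]; constructor <;> linarith

lemma inner_slab_le {δ u : ℝ} (hδ : 0 < δ) (z : ℝ × ℝ) (hu : 0 ≤ u) (hu' : u < δ) :
    |∫ m, cutoff m * slab δ (u - lin z m)| ≤ 80 * (δ / max ‖z‖ δ) ^ 1 := by
  have hb : ∀ u, |slab δ u| ≤ 1 := fun u => by
    rw [abs_of_nonneg (slab_nonneg _ _)]; exact slab_le_one _ _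
  rw [pow_one]
  rcases lt_or_ge ‖z‖ (10 * δ) with hz | hz
  · refine (abs_integral_cutoff_mul_le fun m => hb _).trans ?_
    have : 1 / 10 ≤ δ / max ‖z‖ δ := by
      rw [le_div_iff₀ (lt_max_of_lt_right hδ)]
      rw [div_mul_eq_mul_div, one_mul, div_le_iff₀ (by norm_num)]
      refine max_le (by linarith) (by linarith)
    linarith
  rcases inner_eq_zero_or z (fun u => slab_eq_zero) hz hu hu' with h | h
  · rw [h, abs_zero]; positivity
  have hzpos : 0 < ‖z‖ := by linarith
  have hz2 : 0 < |z.2| := by linarith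
  have hz2' : z.2 ≠ 0 := abs_pos.mp hz2
  rw [max_eq_left (by linarith)]
  have hInt := integrable_slab_affine δ (u - z.1) hz2'
  have : |∫ m, cutoff m * slab δ (u - lin z m)| ≤ δ / |z.2| := by
    rw [← integral_slab_affine hδ.le (u - z.1) z.2, ← Real.norm_eq_abs]
    refine norm_integral_le_of_norm_le hInt (Filter.Eventually.of_forall fun m => ?_)
    have : u - lin z m = u - z.1 - m * z.2 := by simp [lin]; ring
    rw [this, norm_mul, Real.norm_eq_abs, Real.norm_eq_abs, abs_of_nonneg (cutoff_nonneg _),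
      abs_of_nonneg (slab_nonneg _ _)]
    exact mul_le_of_le_one_left (slab_nonneg _ _) (cutoff_le_one _)
  refine this.trans ?_
  rw [← mul_div_assoc, div_le_div_iff₀ hz2 hzpos]
  nlinarith

lemma inner_haar_le {δ u : ℝ} (hδ : 0 < δ) (z : ℝ × ℝ) (hu : 0 ≤ u) (hu' : u < δ) :
    |∫ m, cutoff m * haar δ (u - lin z m)| ≤ 800 * (δ / max ‖z‖ δ) ^ 2 := by
  rcases lt_or_ge ‖z‖ (10 * δ) with hz | hz
  · refine (abs_integral_cutoff_mul_le fun m => abs_haar_le _ _).trans ?_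
    have : 1 / 10 ≤ δ / max ‖z‖ δ := by
      rw [le_div_iff₀ (lt_max_of_lt_right hδ)]
      rw [div_mul_eq_mul_div, one_mul, div_le_iff₀ (by norm_num)]
      refine max_le (by linarith) (by linarith)
    nlinarith
  rcases inner_eq_zero_or z (fun u => haar_eq_zero hδ.le) hz hu hu' with h | h
  · rw [h, abs_zero]; positivity
  have hzpos : 0 < ‖z‖ := by linarith
  have hz2 : 0 < |z.2| := by linarith
  have hz2' : z.2 ≠ 0 := abs_pos.mp hz2
  rw [max_eq_left (by linarith)]
  set L := δ / 2 / z.2 with hL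
  set S : ℝ → ℝ := fun m => slab (δ / 2) (u - z.1 - m * z.2) with hS
  have hInt : Integrable S := integrable_slab_affine (δ / 2) (u - z.1) hz2'
  have hbd : ∀ f : ℝ → ℝ, Continuous f → (∀ m, |f m| ≤ 1) → Integrable fun m => f m * S m := by
    intro f hf hf1
    exact hInt.bdd_mul (c := 1) hf.aestronglyMeasurable (Filter.Eventually.of_forall hf1)
  have hc1 : ∀ m, |cutoff m| ≤ 1 := fun m => by
    rw [abs_of_nonneg (cutoff_nonneg _)]; exact cutoff_le_one _
  have i1 := hbd cutoff cutoff_continuous hc1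
  have i2 := hbd (fun m => cutoff (m - L)) (by have := cutoff_continuous; fun_prop) (fun m => hc1 _)
  have e1 : ∀ m, cutoff m * haar δ (u - lin z m) = cutoff m * S m - cutoff (m + L - L) * S (m + L) := by
    intro m
    have h1 : u - lin z m = u - z.1 - m * z.2 := by simp [lin]; ring
    have h2 : u - z.1 - (m + L) * z.2 = u - z.1 - m * z.2 - δ / 2 := by
      rw [hL]; field_simp; ring
    simp only [hS, haar, h1, h2]
    rw [add_sub_cancel_right]; ring
  have e2 : ∫ m, cutoff m * haar δ (u - lin z m) = ∫ m, (cutoff m - cutoff (m - L)) * S m := by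
    simp only [e1]
    rw [integral_sub i1 (i2.comp_add_right L),
      integral_add_right_eq_self (fun m => cutoff (m - L) * S m) L, ← integral_sub i1 i2]
    congr 1; ext m; ring
  rw [e2]
  have : |∫ m, (cutoff m - cutoff (m - L)) * S m| ≤ |L| * (δ / 2 / |z.2|) := by
    rw [← integral_slab_affine (by positivity) (u - z.1) z.2, ← Real.norm_eq_abs,
      ← integral_const_mul]
    refine norm_integral_le_of_norm_le (hInt.const_mul _) (Filter.Eventually.of_forall fun m => ?_)
    rw [norm_mul, Real.norm_eq_abs, Real.norm_eq_abs, abs_of_nonneg (slab_nonneg _ _)]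
    refine mul_le_mul_of_nonneg_right ?_ (slab_nonneg _ _)
    refine (cutoff_sub_le _ _).trans ?_
    rw [sub_sub_cancel]
  refine this.trans ?_
  have hL' : |L| = δ / 2 / |z.2| := by rw [hL, abs_div, abs_of_pos (by positivity)]
  rw [hL', ← sq]
  have h5 : δ / 2 / |z.2| ≤ 5 * (δ / ‖z‖) := by
    rw [← mul_div_assoc, div_div, div_le_div_iff₀ (by positivity) hzpos]
    nlinarith
  have h6 : 0 ≤ δ / 2 / |z.2| := by positivity
  have h7 : 0 ≤ δ / ‖z‖ := by positivity
  nlinarith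

end innerBounds

section potential

/-- The Frostman condition with exponent `t` at the scales `2 ^ (-k)`, `k ≤ T`. -/
def Frost {ι : Type*} [Fintype ι] (w : ι → ℝ) (p : ι → ℝ × ℝ) (C t : ℝ) (T : ℕ) : Prop :=
  ∀ k ≤ T, ∀ i, ∑ j, (if ‖p i - p j‖ ≤ (2 : ℝ) ^ (-(k : ℝ)) then w j else 0) ≤
    C * (2 : ℝ) ^ (-(t * k))

lemma potential_le_sum {a : ℝ} (ha1 : a ≤ 1) (k e : ℕ) :
    ((2 : ℝ) ^ (-(k : ℝ)) / max a ((2 : ℝ) ^ (-(k : ℝ)))) ^ e ≤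
      ∑ i ∈ Finset.range (k + 1), if a ≤ (2 : ℝ) ^ (-(i : ℝ)) then
        (2 : ℝ) ^ e * (2 : ℝ) ^ (-(e * (k - i) : ℝ)) else 0 := by
  classical
  have hpos : (0 : ℝ) < (2 : ℝ) ^ (-(k : ℝ)) := by positivity
  set S := (Finset.range (k + 1)).filter fun i : ℕ => a ≤ (2 : ℝ) ^ (-(i : ℝ)) with hS
  have hne : S.Nonempty := ⟨0, by simp [hS, ha1]⟩
  set i := S.max' hne with hi
  have hiS : i ∈ S := S.max'_mem hne
  have hiS' := hiS
  rw [hS, Finset.mem_filter, Finset.mem_range] at hiS'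
  rw [← Finset.sum_filter]
  have hterm : ((2 : ℝ) ^ (-(k : ℝ)) / max a ((2 : ℝ) ^ (-(k : ℝ)))) ^ e ≤
      (2 : ℝ) ^ e * (2 : ℝ) ^ (-(e * (k - i) : ℝ)) := by
    have h2 : (2 : ℝ) ^ (-(e * (k - i) : ℝ)) = ((2 : ℝ) ^ (-(k - i : ℝ))) ^ e := by
      rw [← Real.rpow_natCast, ← Real.rpow_mul (by norm_num)]; congr 1; ring
    rw [h2, ← mul_pow]
    refine pow_le_pow_left₀ (by positivity) ?_ e
    rcases eq_or_lt_of_le (Nat.lt_succ_iff.mp hiS'.1) with hk | hk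
    · rw [← hk, sub_self, neg_zero, Real.rpow_zero]
      refine (div_le_one_of_le₀ (le_max_right _ _) (by positivity)).trans (by norm_num)
    · have h3 : (2 : ℝ) ^ (-((i + 1 : ℕ) : ℝ)) < a := by
        by_contra! h
        have : i + 1 ∈ S := by
          rw [hS, Finset.mem_filter, Finset.mem_range]; exact ⟨by omega, h⟩
        have := S.le_max' _ this
        omega
      rw [div_le_iff₀ (lt_max_of_lt_right hpos)]
      calc (2 : ℝ) ^ (-(k : ℝ)) = 2 * (2 : ℝ) ^ (-(k - i : ℝ)) * (2 : ℝ) ^ (-((i + 1 : ℕ) : ℝ)) := by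
            nth_rw 2 [← Real.rpow_one 2]
            rw [← Real.rpow_add (by norm_num), ← Real.rpow_add (by norm_num)]
            congr 1; push_cast; ring
        _ ≤ _ := by
            refine mul_le_mul_of_nonneg_left ?_ (by positivity)
            exact h3.le.trans (le_max_left _ _)
  refine hterm.trans ?_
  exact Finset.single_le_sum (f := fun i : ℕ => (2 : ℝ) ^ e * (2 : ℝ) ^ (-(e * (k - i) : ℝ)))
    (fun i _ => by positivity) hiS

variable {ι : Type*} [Fintype ι] {w : ι → ℝ} {p : ι → ℝ × ℝ} {C t : ℝ} {T : ℕ}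

lemma Frost.sum_potential_le (hF : Frost w p C t T) (hw : ∀ i, 0 ≤ w i) (hC : 0 ≤ C)
    (hd : ∀ i j, ‖p i - p j‖ ≤ 1) {e k : ℕ} (hk : k ≤ T) (ht : t ≤ e) (i : ι) :
    ∑ j, w j * ((2 : ℝ) ^ (-(k : ℝ)) / max ‖p i - p j‖ ((2 : ℝ) ^ (-(k : ℝ)))) ^ e ≤
      2 ^ e * C * (k + 1) * (2 : ℝ) ^ (-(t * k)) := by
  calc _ ≤ ∑ j, w j * ∑ n ∈ Finset.range (k + 1), (if ‖p i - p j‖ ≤ (2 : ℝ) ^ (-(n : ℝ)) then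
        (2 : ℝ) ^ e * (2 : ℝ) ^ (-(e * (k - n) : ℝ)) else 0) := by
        gcongr with j _
        · exact hw j
        · exact potential_le_sum (hd i j) k e
    _ = ∑ n ∈ Finset.range (k + 1), (2 : ℝ) ^ e * (2 : ℝ) ^ (-(e * (k - n) : ℝ)) *
          ∑ j, (if ‖p i - p j‖ ≤ (2 : ℝ) ^ (-(n : ℝ)) then w j else 0) := by
        simp only [Finset.mul_sum]
        rw [Finset.sum_comm]
        refine Finset.sum_congr rfl fun n _ => Finset.sum_congr rfl fun j _ => ?_
        split_ifs <;> ring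
    _ ≤ ∑ n ∈ Finset.range (k + 1), 2 ^ e * C * (2 : ℝ) ^ (-(t * k)) := by
        refine Finset.sum_le_sum fun n hn => ?_
        have hnk : n ≤ k := Nat.lt_succ_iff.mp (Finset.mem_range.mp hn)
        calc _ ≤ (2 : ℝ) ^ e * (2 : ℝ) ^ (-(e * (k - n) : ℝ)) * (C * (2 : ℝ) ^ (-(t * n))) := by
              gcongr; exact hF n (hnk.trans hk) i
          _ = 2 ^ e * C * ((2 : ℝ) ^ (-(e * (k - n) : ℝ)) * (2 : ℝ) ^ (-(t * n))) := by ring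
          _ ≤ _ := by
              rw [← Real.rpow_add (by norm_num)]
              gcongr
              · norm_num
              · have : (n : ℝ) ≤ k := by exact_mod_cast hnk
                nlinarith
    _ = _ := by rw [Finset.sum_const, Finset.card_range]; simp only [nsmul_eq_mul]; push_cast; ring

lemma Frost.sum_sum_potential_le (hF : Frost w p C t T) (hw : ∀ i, 0 ≤ w i) (hw1 : ∑ i, w i ≤ 1)
    (hC : 0 ≤ C) (hd : ∀ i j, ‖p i - p j‖ ≤ 1) {e k : ℕ} (hk : k ≤ T) (ht : t ≤ e) :
    ∑ i, w i * ∑ j, w j * ((2 : ℝ) ^ (-(k : ℝ)) / max ‖p i - p j‖ ((2 : ℝ) ^ (-(k : ℝ)))) ^ e ≤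
      2 ^ e * C * (k + 1) * (2 : ℝ) ^ (-(t * k)) := by
  calc _ ≤ ∑ i, w i * (2 ^ e * C * (k + 1) * (2 : ℝ) ^ (-(t * k))) := by
        gcongr with i _
        · exact hw i
        · exact hF.sum_potential_le hw hC hd hk ht i
    _ = (∑ i, w i) * (2 ^ e * C * (k + 1) * (2 : ℝ) ^ (-(t * k))) := by rw [Finset.sum_mul]
    _ ≤ _ := mul_le_of_le_one_left (by positivity) hw1

/-- The weighted sum of a profile over the strips dual to the points `p i`. -/
def stripSum (h : ℝ → ℝ) (w : ι → ℝ) (p : ι → ℝ × ℝ) (z : ℝ × ℝ) : ℝ :=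
  ∑ i, w i * h (lin (p i) z.1 - z.2)

lemma stripSum_measurable {h : ℝ → ℝ} (hh : Measurable h) : Measurable (stripSum h w p) := by
  unfold stripSum
  refine Finset.measurable_sum _ fun i _ => (hh.comp ?_).const_mul _
  exact ((lin_continuous (p i)).measurable.comp measurable_fst).sub measurable_snd

lemma abs_stripSum_le {h : ℝ → ℝ} (hb : ∀ u, |h u| ≤ 1) (hw : ∀ i, 0 ≤ w i) (z : ℝ × ℝ) :
    |stripSum h w p z| ≤ ∑ i, w i := by
  unfold stripSum
  refine (Finset.abs_sum_le_sum_abs _ _).trans (Finset.sum_le_sum fun i _ => ?_)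
  rw [abs_mul, abs_of_nonneg (hw i)]
  exact mul_le_of_le_one_right (hw i) (hb _)

lemma stripSum_nonneg {h : ℝ → ℝ} (hb : ∀ u, 0 ≤ h u) (hw : ∀ i, 0 ≤ w i) (z : ℝ × ℝ) :
    0 ≤ stripSum h w p z :=
  Finset.sum_nonneg fun i _ => mul_nonneg (hw i) (hb _)

lemma integrable_cutoff_stripSum_mul {h : ℝ → ℝ} {δ : ℝ} (hh : Measurable h)
    (hb : ∀ u, |h u| ≤ 1) (hs : ∀ u, (u < 0 ∨ δ ≤ u) → h u = 0) {g : ℝ × ℝ → ℝ}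
    (hg : Measurable g) {B : ℝ} (hB : ∀ z, |g z| ≤ B) :
    Integrable fun z => cutoff z.1 * stripSum h w p z * g z := by
  refine Integrable.mul_bdd (c := B) ?_ hg.aestronglyMeasurable (Filter.Eventually.of_forall hB)
  have : (fun z : ℝ × ℝ => cutoff z.1 * stripSum h w p z) =
      fun z => ∑ i, w i * (cutoff z.1 * h (lin (p i) z.1 - z.2)) := by
    ext z; simp only [stripSum, Finset.mul_sum]
    exact Finset.sum_congr rfl fun i _ => by ring
  rw [this]
  exact integrable_finsetSum _ fun i _ => (integrable_cutoff_mul hh hb hs (p i)).const_mul _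

lemma integral_cutoff_stripSum_sq_le {h : ℝ → ℝ} {k e : ℕ} {B : ℝ}
    (hF : Frost w p C t T) (hw : ∀ i, 0 ≤ w i)
    (hw1 : ∑ i, w i ≤ 1) (hC : 0 ≤ C) (hd : ∀ i j, ‖p i - p j‖ ≤ 1) (hk : k ≤ T) (ht : t ≤ e)
    (hh : Measurable h) (hb : ∀ u, |h u| ≤ 1)
    (hs : ∀ u, (u < 0 ∨ (2 : ℝ) ^ (-(k : ℝ)) ≤ u) → h u = 0) (hB0 : 0 ≤ B)
    (hB : ∀ z : ℝ × ℝ, ∀ u, 0 ≤ u → u < (2 : ℝ) ^ (-(k : ℝ)) →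
      |∫ m, cutoff m * h (u - lin z m)| ≤
        B * ((2 : ℝ) ^ (-(k : ℝ)) / max ‖z‖ ((2 : ℝ) ^ (-(k : ℝ)))) ^ e) :
    ∫ z : ℝ × ℝ, cutoff z.1 * stripSum h w p z * stripSum h w p z ≤
      B * (2 : ℝ) ^ (-(k : ℝ)) * (2 ^ e * C * (k + 1) * (2 : ℝ) ^ (-(t * k))) := by
  set δ := (2 : ℝ) ^ (-(k : ℝ)) with hδ
  have hδpos : 0 < δ := by positivity
  have e1 : (fun z : ℝ × ℝ => cutoff z.1 * stripSum h w p z * stripSum h w p z) = fun z =>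
      ∑ i, ∑ j, w i * w j * (cutoff z.1 * h (lin (p i) z.1 - z.2) * h (lin (p j) z.1 - z.2)) := by
    ext z
    simp only [stripSum]
    rw [mul_assoc, Finset.sum_mul_sum, Finset.mul_sum]
    refine Finset.sum_congr rfl fun i _ => ?_
    rw [Finset.mul_sum]
    exact Finset.sum_congr rfl fun j _ => by ring
  have hInt : ∀ i j, Integrable fun z : ℝ × ℝ =>
      w i * w j * (cutoff z.1 * h (lin (p i) z.1 - z.2) * h (lin (p j) z.1 - z.2)) := fun i j =>
    (integrable_kernel hh hb hs hh hb (p i) (p j)).const_mul _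
  rw [e1, integral_finsetSum _ fun i _ => integrable_finsetSum _ fun j _ => hInt i j]
  simp_rw [integral_finsetSum Finset.univ fun j _ => hInt _ j, integral_const_mul]
  calc _ ≤ ∑ i, ∑ j, w i * w j * (B * (δ / max ‖p i - p j‖ δ) ^ e * δ) := by
        refine Finset.sum_le_sum fun i _ => Finset.sum_le_sum fun j _ => ?_
        refine mul_le_mul_of_nonneg_left ?_ (mul_nonneg (hw i) (hw j))
        exact (le_abs_self _).trans
          (abs_kernel_le hδpos.le hh hb hs hh hb (p i) (p j) (hB (p i - p j)))
    _ = B * δ * ∑ i, w i * ∑ j, w j * (δ / max ‖p i - p j‖ δ) ^ e := by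
        rw [Finset.mul_sum]
        refine Finset.sum_congr rfl fun i _ => ?_
        rw [Finset.mul_sum, Finset.mul_sum]
        exact Finset.sum_congr rfl fun j _ => by ring
    _ ≤ _ := by
        gcongr
        exact hF.sum_sum_potential_le hw hw1 hC hd hk ht

end potential

noncomputable section

section excess

variable {ι κ : Type*} [Fintype ι] [Fintype κ] {μ : ι → ℝ} {p : ι → ℝ × ℝ} {ν : κ → ℝ}
  {q : κ → ℝ × ℝ} {C s t : ℝ} {T : ℕ}

/-- The mass, at scale `2 ^ (-k)`, of the strips around the `p i` carrying more than `lam` times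
the expected `ν`-mass. -/
def excess (lam : ℝ) (μ : ι → ℝ) (p : ι → ℝ × ℝ) (ν : κ → ℝ) (q : κ → ℝ × ℝ) (δ : ℝ) : ℝ :=
  ∫ z : ℝ × ℝ, cutoff z.1 * stripSum (slab δ) μ p z * max 0 (stripSum (slab δ) ν q z - lam * δ)

lemma abs_slab_le (δ u : ℝ) : |slab δ u| ≤ 1 := by
  rw [abs_of_nonneg (slab_nonneg _ _)]; exact slab_le_one _ _

lemma stripSum_slab_split {δ : ℝ} (hδ : 0 ≤ δ) (z : ℝ × ℝ) :
    stripSum (slab δ) ν q z =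
      stripSum (slab (δ / 2)) ν q z + stripSum (slab (δ / 2)) ν q (z + (0, δ / 2)) := by
  simp only [stripSum, ← Finset.sum_add_distrib, ← mul_add]
  refine Finset.sum_congr rfl fun i _ => ?_
  rw [slab_split δ _ hδ]
  simp only [Prod.fst_add, Prod.snd_add, add_zero, sub_sub]

lemma stripSum_haar {δ : ℝ} (z : ℝ × ℝ) :
    stripSum (haar δ) ν q z =
      stripSum (slab (δ / 2)) ν q z - stripSum (slab (δ / 2)) ν q (z + (0, δ / 2)) := by
  simp only [stripSum, ← Finset.sum_sub_distrib, ← mul_sub]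
  refine Finset.sum_congr rfl fun i _ => ?_
  simp only [haar, Prod.fst_add, Prod.snd_add, add_zero, sub_sub]

lemma excess_integrable (lam δ : ℝ) (hν : ∀ i, 0 ≤ ν i) :
    Integrable fun z : ℝ × ℝ =>
      cutoff z.1 * stripSum (slab δ) μ p z * max 0 (stripSum (slab δ) ν q z - lam * δ) := by
  refine integrable_cutoff_stripSum_mul (slab_measurable δ) (abs_slab_le δ)
    (fun u => slab_eq_zero) (B := ∑ i, ν i + |lam * δ|) ?_ ?_
  · exact measurable_const.max ((stripSum_measurable (slab_measurable δ)).sub_const _)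
  · intro z
    have h1 := abs_stripSum_le (p := q) (abs_slab_le δ) hν z
    rw [abs_le] at h1
    rw [abs_of_nonneg (le_max_left _ _)]
    refine max_le ?_ ?_
    · exact add_nonneg (Finset.sum_nonneg fun i _ => hν i) (abs_nonneg _)
    · linarith [neg_abs_le (lam * δ)]

lemma integrable_cutoff_stripSum_mul_stripSum {h h' : ℝ → ℝ} {δ : ℝ} (hh : Measurable h)
    (hb : ∀ u, |h u| ≤ 1) (hs : ∀ u, (u < 0 ∨ δ ≤ u) → h u = 0)
    (hh' : Measurable h') (hb' : ∀ u, |h' u| ≤ 1) (hν : ∀ i, 0 ≤ ν i) :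
    Integrable fun z : ℝ × ℝ => cutoff z.1 * stripSum h μ p z * stripSum h' ν q z :=
  integrable_cutoff_stripSum_mul hh hb hs (stripSum_measurable hh')
    (fun z => abs_stripSum_le hb' hν z)

lemma excess_half_le (lam : ℝ) {δ : ℝ} (hδ : 0 ≤ δ) (hμ : ∀ i, 0 ≤ μ i) (hν : ∀ i, 0 ≤ ν i) :
    4 * excess lam μ p ν q (δ / 2) ≤ excess lam μ p ν q δ +
      ∫ z : ℝ × ℝ, cutoff z.1 * stripSum (slab δ) μ p z * |stripSum (haar δ) ν q z| := by
  set F : ℝ × ℝ → ℝ := fun z => cutoff z.1 * stripSum (slab (δ / 2)) μ p z *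
    max 0 (stripSum (slab (δ / 2)) ν q z - lam * (δ / 2)) with hF
  have iF : Integrable F := excess_integrable lam (δ / 2) hν
  have iF' : Integrable fun z => F (z + (0, δ / 2)) := iF.comp_add_right _
  have iE := excess_integrable (μ := μ) (p := p) (q := q) lam δ hν
  have iH : Integrable fun z : ℝ × ℝ =>
      cutoff z.1 * stripSum (slab δ) μ p z * |stripSum (haar δ) ν q z| := by
    refine integrable_cutoff_stripSum_mul (slab_measurable δ) (abs_slab_le δ)
      (fun u => slab_eq_zero) (B := ∑ i, ν i) ?_ ?_
    · exact (stripSum_measurable (haar_measurable δ)).abs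
    · intro z; rw [abs_abs]; exact abs_stripSum_le (abs_haar_le δ) hν z
  have e1 : 4 * excess lam μ p ν q (δ / 2) = ∫ z, (2 * F z + 2 * F (z + (0, δ / 2))) := by
    rw [integral_add (iF.const_mul 2) (iF'.const_mul 2), integral_const_mul, integral_const_mul,
      integral_add_right_eq_self F]
    change 4 * ∫ z, F z = _
    ring
  rw [e1, excess, ← integral_add iE iH]
  refine integral_mono ((iF.const_mul 2).add (iF'.const_mul 2)) (iE.add iH) fun z => ?_
  simp only [hF, Prod.fst_add, add_zero]
  rw [stripSum_slab_split hδ (ν := μ), stripSum_slab_split hδ (ν := ν), stripSum_haar]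
  set U := stripSum (slab (δ / 2)) μ p z
  set U' := stripSum (slab (δ / 2)) μ p (z + (0, δ / 2))
  set N := stripSum (slab (δ / 2)) ν q z
  set N' := stripSum (slab (δ / 2)) ν q (z + (0, δ / 2))
  have hU : 0 ≤ cutoff z.1 * U := mul_nonneg (cutoff_nonneg _) (stripSum_nonneg (slab_nonneg _) hμ _)
  have hU' : 0 ≤ cutoff z.1 * U' := mul_nonneg (cutoff_nonneg _) (stripSum_nonneg (slab_nonneg _) hμ _)
  set E := max 0 (N + N' - lam * δ)
  have hE : N + N' - lam * δ ≤ E := le_max_right _ _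
  have hE0 : 0 ≤ E := le_max_left _ _
  have h1 : 2 * max 0 (N - lam * (δ / 2)) ≤ E + |N - N'| := by
    rcases max_cases 0 (N - lam * (δ / 2)) with ⟨h, _⟩ | ⟨h, _⟩ <;> rw [h]
    · linarith [abs_nonneg (N - N')]
    · linarith [le_abs_self (N - N')]
  have h2 : 2 * max 0 (N' - lam * (δ / 2)) ≤ E + |N - N'| := by
    rcases max_cases 0 (N' - lam * (δ / 2)) with ⟨h, _⟩ | ⟨h, _⟩ <;> rw [h]
    · linarith [abs_nonneg (N - N')]
    · linarith [neg_abs_le (N - N')]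
  nlinarith [mul_le_mul_of_nonneg_left h1 hU, mul_le_mul_of_nonneg_left h2 hU']

lemma integral_cutoff_slab_haar_le {k : ℕ}
    (hFμ : Frost μ p C s T) (hFν : Frost ν q C t T) (hμ : ∀ i, 0 ≤ μ i) (hν : ∀ i, 0 ≤ ν i)
    (hμ1 : ∑ i, μ i ≤ 1) (hν1 : ∑ i, ν i ≤ 1) (hC : 0 ≤ C)
    (hdp : ∀ i j, ‖p i - p j‖ ≤ 1) (hdq : ∀ i j, ‖q i - q j‖ ≤ 1) (hk : k ≤ T)
    (hs : s ≤ 1) (ht : t ≤ 2) :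
    ∫ z : ℝ × ℝ, cutoff z.1 * stripSum (slab ((2 : ℝ) ^ (-(k : ℝ)))) μ p z *
        |stripSum (haar ((2 : ℝ) ^ (-(k : ℝ)))) ν q z| ≤
      1680 * C * (k + 1) * (2 : ℝ) ^ (-(k * (1 + (s + t) / 2))) := by
  set δ := (2 : ℝ) ^ (-(k : ℝ)) with hδ
  have hδpos : 0 < δ := by positivity
  set α := (2 : ℝ) ^ (k * (t - s) / 2) with hα
  have hαpos : 0 < α := by positivity
  have iD := integrable_cutoff_stripSum_mul_stripSum (μ := ν) (p := q) (ν := ν) (q := q)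
    (haar_measurable δ) (abs_haar_le δ) (fun u => haar_eq_zero hδpos.le) (haar_measurable δ) (abs_haar_le δ) hν
  have iU := integrable_cutoff_stripSum_mul_stripSum (μ := μ) (p := p) (ν := μ) (q := p)
    (slab_measurable δ) (abs_slab_le δ) (fun u => slab_eq_zero) (slab_measurable δ) (abs_slab_le δ) hμ
  have bD := integral_cutoff_stripSum_sq_le (e := 2) (B := 800) hFν hν hν1 hC hdq hk
    (by exact_mod_cast ht)
    (haar_measurable δ) (abs_haar_le δ) (fun u => haar_eq_zero hδpos.le) (by norm_num)
    (fun z u hu hu' => inner_haar_le hδpos z hu hu')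
  have bU := integral_cutoff_stripSum_sq_le (e := 1) (B := 80) hFμ hμ hμ1 hC hdp hk
    (by exact_mod_cast hs)
    (slab_measurable δ) (abs_slab_le δ) (fun u => slab_eq_zero) (by norm_num)
    (fun z u hu hu' => inner_slab_le hδpos z hu hu')
  have iH : Integrable fun z : ℝ × ℝ =>
      cutoff z.1 * stripSum (slab δ) μ p z * |stripSum (haar δ) ν q z| := by
    refine integrable_cutoff_stripSum_mul (slab_measurable δ) (abs_slab_le δ)
      (fun u => slab_eq_zero) (B := ∑ i, ν i) ?_ ?_
    · exact (stripSum_measurable (haar_measurable δ)).abs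
    · intro z; rw [abs_abs]; exact abs_stripSum_le (abs_haar_le δ) hν z
  calc _ ≤ ∫ z : ℝ × ℝ, (α / 2 * (cutoff z.1 * stripSum (haar δ) ν q z * stripSum (haar δ) ν q z) +
        α⁻¹ / 2 * (cutoff z.1 * stripSum (slab δ) μ p z * stripSum (slab δ) μ p z)) := by
        refine integral_mono iH ((iD.const_mul _).add (iU.const_mul _)) fun z => ?_
        simp only
        set D := stripSum (haar δ) ν q z
        set U := stripSum (slab δ) μ p z
        have h1 : U * |D| ≤ α / 2 * (D * D) + α⁻¹ / 2 * (U * U) := by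
          have h2 : 0 ≤ α⁻¹ / 2 * (U - α * |D|) ^ 2 := by positivity
          have h3 : α⁻¹ / 2 * (U - α * |D|) ^ 2 = α / 2 * (|D| * |D|) + α⁻¹ / 2 * (U * U) - U * |D| := by
            field_simp; ring
          rw [h3, abs_mul_abs_self] at h2
          linarith
        have := mul_le_mul_of_nonneg_left h1 (cutoff_nonneg z.1)
        nlinarith
    _ = α / 2 * (∫ z : ℝ × ℝ, cutoff z.1 * stripSum (haar δ) ν q z * stripSum (haar δ) ν q z) +
        α⁻¹ / 2 * (∫ z : ℝ × ℝ, cutoff z.1 * stripSum (slab δ) μ p z * stripSum (slab δ) μ p z) := by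
        rw [integral_add (iD.const_mul _) (iU.const_mul _), integral_const_mul, integral_const_mul]
    _ ≤ α / 2 * (800 * δ * (2 ^ 2 * C * (k + 1) * (2 : ℝ) ^ (-(t * k)))) +
        α⁻¹ / 2 * (80 * δ * (2 ^ 1 * C * (k + 1) * (2 : ℝ) ^ (-(s * k)))) := by gcongr
    _ = 1600 * C * (k + 1) * (α * δ * (2 : ℝ) ^ (-(t * k))) +
        80 * C * (k + 1) * (α⁻¹ * δ * (2 : ℝ) ^ (-(s * k))) := by ring
    _ = _ := by
        have h1 : α * δ * (2 : ℝ) ^ (-(t * k)) = (2 : ℝ) ^ (-(k * (1 + (s + t) / 2))) := by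
          rw [hα, hδ, ← Real.rpow_add (by norm_num), ← Real.rpow_add (by norm_num)]
          congr 1; ring
        have h2 : α⁻¹ * δ * (2 : ℝ) ^ (-(s * k)) = (2 : ℝ) ^ (-(k * (1 + (s + t) / 2))) := by
          rw [hα, hδ, ← Real.rpow_neg (by norm_num), ← Real.rpow_add (by norm_num),
            ← Real.rpow_add (by norm_num)]
          congr 1; ring
        rw [h1, h2]; ring

lemma excess_eq_zero {lam δ : ℝ} (hν : ∀ i, 0 ≤ ν i) (hν1 : ∑ i, ν i ≤ 1) (h : 1 ≤ lam * δ) :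
    excess lam μ p ν q δ = 0 := by
  unfold excess
  refine integral_eq_zero_of_ae (Filter.Eventually.of_forall fun z => ?_)
  have h1 := abs_stripSum_le (p := q) (abs_slab_le δ) hν z
  simp only [Pi.zero_apply]
  rw [max_eq_left, mul_zero]
  linarith [le_abs_self (stripSum (slab δ) ν q z)]

lemma excess_le (hFμ : Frost μ p C s T) (hFν : Frost ν q C t T) (hμ : ∀ i, 0 ≤ μ i)
    (hν : ∀ i, 0 ≤ ν i) (hμ1 : ∑ i, μ i ≤ 1) (hν1 : ∑ i, ν i ≤ 1) (hC : 0 ≤ C)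
    (hdp : ∀ i j, ‖p i - p j‖ ≤ 1) (hdq : ∀ i j, ‖q i - q j‖ ≤ 1)
    (hs : s ≤ 1) (ht : t ≤ 2) (hst : 2 ≤ s + t) (k₀ : ℕ) {k : ℕ} (hk : k ≤ T) :
    4 ^ k * excess (2 ^ k₀) μ p ν q ((2 : ℝ) ^ (-(k : ℝ))) ≤
      1680 * C * (T + 1) * k * (2 : ℝ) ^ (-(((s + t) / 2 - 1) * k₀)) := by
  induction k with
  | zero =>
    rw [excess_eq_zero hν hν1]
    · simp
    · simp only [Nat.cast_zero, neg_zero, Real.rpow_zero, mul_one]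
      exact one_le_pow₀ (by norm_num)
  | succ k ih =>
    have ih := ih (by omega)
    rcases lt_or_ge k k₀ with hkk | hkk
    · rw [excess_eq_zero hν hν1]
      · rw [mul_zero]; positivity
      · rw [← Real.rpow_natCast, ← Real.rpow_add (by norm_num)]
        refine Real.one_le_rpow (by norm_num) ?_
        have : ((k + 1 : ℕ) : ℝ) ≤ k₀ := by exact_mod_cast hkk
        linarith
    have hδ : (2 : ℝ) ^ (-((k + 1 : ℕ) : ℝ)) = (2 : ℝ) ^ (-(k : ℝ)) / 2 := by
      rw [div_eq_mul_inv, ← Real.rpow_neg_one 2, ← Real.rpow_add (by norm_num)]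
      congr 1; push_cast; ring
    have h1 := excess_half_le (μ := μ) (p := p) (ν := ν) (q := q) (2 ^ k₀) (δ := (2 : ℝ) ^ (-(k : ℝ))) (by positivity) hμ hν
    have h2 := integral_cutoff_slab_haar_le hFμ hFν hμ hν hμ1 hν1 hC hdp hdq (k := k) (by omega) hs ht
    rw [hδ, pow_succ, mul_assoc]
    have h3 : (4 : ℝ) ^ k * (2 : ℝ) ^ (-(k * (1 + (s + t) / 2))) ≤
        (2 : ℝ) ^ (-(((s + t) / 2 - 1) * k₀)) := by
      have : (4 : ℝ) ^ k = (2 : ℝ) ^ (2 * k : ℝ) := by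
        rw [Real.rpow_mul (by norm_num), Real.rpow_natCast]; norm_num
      rw [this, ← Real.rpow_add (by norm_num)]
      refine Real.rpow_le_rpow_of_exponent_le (by norm_num) ?_
      have : (k₀ : ℝ) ≤ k := by exact_mod_cast hkk
      nlinarith
    have hk1 : (k : ℝ) + 1 ≤ T + 1 := by
      have : ((k + 1 : ℕ) : ℝ) ≤ T := by exact_mod_cast hk
      push_cast at this; linarith
    calc _ ≤ (4 : ℝ) ^ k * (excess (2 ^ k₀) μ p ν q ((2 : ℝ) ^ (-(k : ℝ))) +
          1680 * C * (k + 1) * (2 : ℝ) ^ (-(k * (1 + (s + t) / 2)))) := by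
          gcongr; linarith
      _ = 4 ^ k * excess (2 ^ k₀) μ p ν q ((2 : ℝ) ^ (-(k : ℝ))) +
          1680 * C * (k + 1) * (4 ^ k * (2 : ℝ) ^ (-(k * (1 + (s + t) / 2)))) := by ring
      _ ≤ 1680 * C * (T + 1) * k * (2 : ℝ) ^ (-(((s + t) / 2 - 1) * k₀)) +
          1680 * C * (T + 1) * (2 : ℝ) ^ (-(((s + t) / 2 - 1) * k₀)) := by gcongr
      _ = _ := by push_cast; ring

end excess
end

noncomputable section

section radial

variable {ι κ : Type*} [Fintype ι] [Fintype κ] {μ : ι → ℝ} {p : ι → ℝ × ℝ} {ν : κ → ℝ}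
  {q : κ → ℝ × ℝ} {C s t : ℝ} {T : ℕ}

/-- The parameter `m` at which `lin x` and `lin y` agree. -/
def lineSlope (x y : ℝ × ℝ) : ℝ := -(y.1 - x.1) / (y.2 - x.2)

lemma lin_sub_lin {x y : ℝ × ℝ} (h : y.2 - x.2 ≠ 0) (m : ℝ) :
    lin y m - lin x m = (m - lineSlope x y) * (y.2 - x.2) := by
  unfold lin lineSlope
  field_simp; ring

lemma integral_window (a c d : ℝ) (hc : 0 ≤ c) (hd : 0 ≤ d) (x : ℝ × ℝ) :
    Integrable (fun z : ℝ × ℝ => slab c (z.1 - a) * slab d (lin x z.1 - z.2 - d)) ∧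
    ∫ z : ℝ × ℝ, slab c (z.1 - a) * slab d (lin x z.1 - z.2 - d) = c * d := by
  have hi : Integrable (fun z : ℝ × ℝ => slab c (z.1 - a) * slab d (lin x z.1 - z.2 - d)) := by
    refine integrable_of_bounded_support ?_ 1 (|a| + c + |x.1| + (|a| + c) * |x.2| + 2 * d) ?_ ?_
    · refine ((slab_measurable c).comp (measurable_fst.sub_const a)).mul ((slab_measurable d).comp ?_)
      exact (((lin_continuous x).measurable.comp measurable_fst).sub measurable_snd).sub_const d
    · intro z
      rw [abs_mul]
      exact mul_le_one₀ (abs_slab_le _ _) (abs_nonneg _) (abs_slab_le _ _)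
    · intro z hz
      have h1 : ¬ (z.1 - a < 0 ∨ c ≤ z.1 - a) := fun h => left_ne_zero_of_mul hz (slab_eq_zero h)
      have h2 : ¬ (lin x z.1 - z.2 - d < 0 ∨ d ≤ lin x z.1 - z.2 - d) :=
        fun h => right_ne_zero_of_mul hz (slab_eq_zero h)
      push Not at h1 h2
      have hz1 : |z.1| ≤ |a| + c := by
        rw [abs_le]; constructor <;> linarith [le_abs_self a, neg_abs_le a]
      have h3 : |lin x z.1| ≤ |x.1| + (|a| + c) * |x.2| := by
        unfold lin
        refine (abs_add_le _ _).trans ?_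
        rw [abs_mul]; gcongr
      have h0 : 0 ≤ (|a| + c) * |x.2| := by positivity
      have := abs_nonneg x.1
      rw [abs_le] at h3
      refine ⟨by linarith, ?_⟩
      rw [abs_le]; constructor <;> linarith [abs_nonneg a]
  refine ⟨hi, ?_⟩
  rw [Measure.volume_eq_prod, integral_prod _ hi]
  have h1 : ∀ m : ℝ, ∫ r, slab c (m - a) * slab d (lin x m - r - d) = slab c (m - a) * d := by
    intro m
    rw [integral_const_mul]
    congr 1
    have : ∀ r, lin x m - r - d = (lin x m - d) - r := fun r => by ring
    simp only [this]
    rw [integral_sub_left_eq_self (slab d), integral_slab hd]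
  simp only [h1]
  rw [integral_mul_const, integral_sub_right_eq_self (slab c), integral_slab hc]

open Classical in
/-- The index pairs `(i, j)` such that the `ν`-mass of the `2 ^ (-n)`-tube through `p i` and `q j`
with vertex `p i` exceeds `D * 2 ^ (-n)`. -/
def badPairs (p : ι → ℝ × ℝ) (ν : κ → ℝ) (q : κ → ℝ × ℝ) (D : ℝ) (n : ℕ) : Finset (ι × κ) :=
  Finset.univ.filter fun z => D * (2 : ℝ) ^ (-(n : ℝ)) <
    ∑ j, if |lineSlope (p z.1) (q z.2) - lineSlope (p z.1) (q j)| ≤ (2 : ℝ) ^ (-(n : ℝ))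
      then ν j else 0

lemma mass_badPairs_le_excess (hμ : ∀ i, 0 ≤ μ i) (hν : ∀ i, 0 ≤ ν i) (k₀ ρ k : ℕ)
    (hsep : ∀ i j, (q j).2 - (p i).2 ≠ 0) (hR : ∀ i j, |(q j).2 - (p i).2| ≤ 2 ^ ρ)
    (hslope : ∀ i j, |lineSlope (p i) (q j)| ≤ 2) :
    ∑ z ∈ badPairs p ν q (2 ^ (k₀ + ρ + 4)) (k + ρ + 3), μ z.1 * ν z.2 ≤
      32 * 2 ^ ρ * (4 ^ k * excess (2 ^ k₀) μ p ν q ((2 : ℝ) ^ (-(k : ℝ)))) := by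
  classical
  set δ := (2 : ℝ) ^ (-(k : ℝ)) with hδ
  have hδpos : 0 < δ := by positivity
  set n := k + ρ + 3 with hn
  set ε := (2 : ℝ) ^ (-(n : ℝ)) with hε
  have hεpos : 0 < ε := by positivity
  have hεδ : δ = 8 * 2 ^ ρ * ε := by
    have : (8 : ℝ) = 2 ^ 3 := by norm_num
    rw [hδ, hε, this, ← pow_add, ← Real.rpow_natCast, ← Real.rpow_add (by norm_num)]
    congr 1; rw [hn]; push_cast; ring
  set B := badPairs p ν q (2 ^ (k₀ + ρ + 4)) n with hB
  set W : ι × κ → ℝ × ℝ → ℝ := fun w z => slab (2 * ε) (z.1 - (lineSlope (p w.1) (q w.2) - ε)) *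
    slab (δ / 4) (lin (p w.1) z.1 - z.2 - δ / 4) with hW
  have hWi := fun w : ι × κ => integral_window (lineSlope (p w.1) (q w.2) - ε) (2 * ε) (δ / 4)
    (by positivity) (by positivity) (p w.1)
  have hW0 : ∀ w z, 0 ≤ W w z := fun w z => mul_nonneg (slab_nonneg _ _) (slab_nonneg _ _)
  have hW1 : ∀ w z, W w z ≠ 0 → |z.1 - lineSlope (p w.1) (q w.2)| ≤ ε ∧
      δ / 4 ≤ lin (p w.1) z.1 - z.2 ∧ lin (p w.1) z.1 - z.2 ≤ δ / 2 := by
    intro w z hz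
    have h1 := mt slab_eq_zero (left_ne_zero_of_mul hz)
    have h2 := mt slab_eq_zero (right_ne_zero_of_mul hz)
    push Not at h1 h2
    refine ⟨?_, by linarith, by linarith⟩
    rw [abs_le]; constructor <;> linarith
  have hW1' : ∀ w z, W w z ≤ 1 := fun w z =>
    mul_le_one₀ (slab_le_one _ _) (slab_nonneg _ _) (slab_le_one _ _)
  have tube : ∀ (i : ι) (z : ℝ × ℝ), δ / 4 ≤ lin (p i) z.1 - z.2 → lin (p i) z.1 - z.2 ≤ δ / 2 →
      ∀ j, |z.1 - lineSlope (p i) (q j)| ≤ 2 * ε → slab δ (lin (q j) z.1 - z.2) = 1 := by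
    intro i z h1 h2 j hj
    have h3 := lin_sub_lin (hsep i j) z.1
    have h4 : |(z.1 - lineSlope (p i) (q j)) * ((q j).2 - (p i).2)| ≤ 2 * ε * 2 ^ ρ := by
      rw [abs_mul]; gcongr; exact hR i j
    rw [← h3, abs_le] at h4
    have h5 : 2 * ε * 2 ^ ρ = δ / 4 := by rw [hεδ]; ring
    apply slab_eq_one <;> linarith
  -- the pointwise bound
  have key : ∀ i z, ∑ j, (if (i, j) ∈ B then ν j * W (i, j) z else 0) ≤
      2 * (cutoff z.1 * slab δ (lin (p i) z.1 - z.2) *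
        max 0 (stripSum (slab δ) ν q z - 2 ^ k₀ * δ)) := by
    intro i z
    by_cases hall : ∀ j, (i, j) ∈ B → W (i, j) z = 0
    · rw [Finset.sum_eq_zero]
      · exact mul_nonneg zero_le_two (mul_nonneg (mul_nonneg (cutoff_nonneg _) (slab_nonneg _ _))
          (le_max_left _ _))
      · intro j _
        split_ifs with h
        · rw [hall j h, mul_zero]
        · rfl
    push Not at hall
    obtain ⟨j₀, hj₀, hne⟩ := hall
    obtain ⟨h1, h2, h3⟩ := hW1 _ _ hne
    simp only at h1 h2 h3
    have hε1 : ε ≤ 1 := by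
      rw [hε]; exact Real.rpow_le_one_of_one_le_of_nonpos (by norm_num) (by simp)
    rw [cutoff_eq_one, slab_eq_one (by linarith) (by linarith), one_mul, one_mul]
    swap
    · have := abs_add_le (z.1 - lineSlope (p i) (q j₀)) (lineSlope (p i) (q j₀))
      rw [sub_add_cancel] at this
      linarith [hslope i j₀]
    have hlow : 2 ^ (k₀ + ρ + 4) * ε < stripSum (slab δ) ν q z := by
      rw [hB, badPairs, Finset.mem_filter] at hj₀
      refine hj₀.2.trans_le (Finset.sum_le_sum fun j _ => ?_)
      split_ifs with h
      · rw [tube i z h2 h3 j, mul_one]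
        have := abs_add_le (z.1 - lineSlope (p i) (q j₀)) (lineSlope (p i) (q j₀) - lineSlope (p i) (q j))
        rw [sub_add_sub_cancel] at this
        simp only at h
        linarith
      · exact mul_nonneg (hν j) (slab_nonneg _ _)
    have hlow' : 2 * (2 ^ k₀ * δ) < stripSum (slab δ) ν q z := by
      refine lt_of_eq_of_lt ?_ hlow
      rw [hεδ]; ring
    have hup : ∑ j, (if (i, j) ∈ B then ν j * W (i, j) z else 0) ≤ stripSum (slab δ) ν q z := by
      refine Finset.sum_le_sum fun j _ => ?_
      by_cases hw : W (i, j) z = 0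
      · rw [hw, mul_zero, ite_self]; exact mul_nonneg (hν j) (slab_nonneg _ _)
      · obtain ⟨g1, -, -⟩ := hW1 _ _ hw
        rw [tube i z h2 h3 j (by simp only at g1; linarith), mul_one]
        split_ifs
        · exact mul_le_of_le_one_right (hν j) (hW1' _ _)
        · exact hν j
    refine hup.trans ?_
    have := le_max_right 0 (stripSum (slab δ) ν q z - 2 ^ k₀ * δ)
    linarith
  have hsum : ∑ w ∈ B, μ w.1 * ν w.2 * (2 * ε * (δ / 4)) ≤ 2 * excess (2 ^ k₀) μ p ν q δ := by
    have e1 : ∑ w ∈ B, μ w.1 * ν w.2 * (2 * ε * (δ / 4)) =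
        ∫ z, ∑ w ∈ B, μ w.1 * ν w.2 * W w z := by
      rw [integral_finsetSum _ fun w _ => (hWi w).1.const_mul _]
      refine Finset.sum_congr rfl fun w _ => ?_
      rw [integral_const_mul, (hWi w).2]
    rw [e1, excess, ← integral_const_mul]
    refine integral_mono (integrable_finsetSum _ fun w _ => (hWi w).1.const_mul _)
      ((excess_integrable _ _ hν).const_mul 2) fun z => ?_
    simp only
    calc ∑ w ∈ B, μ w.1 * ν w.2 * W w z
        = ∑ i, μ i * ∑ j, (if (i, j) ∈ B then ν j * W (i, j) z else 0) := by
          have : B = Finset.univ.filter (· ∈ B) := by ext; simp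
          rw [this, Finset.sum_filter, Fintype.sum_prod_type]
          refine Finset.sum_congr rfl fun i _ => ?_
          rw [Finset.mul_sum]
          refine Finset.sum_congr rfl fun j _ => ?_
          simp only [Finset.mem_filter_univ]
          split_ifs <;> ring
      _ ≤ ∑ i, μ i * (2 * (cutoff z.1 * slab δ (lin (p i) z.1 - z.2) *
        max 0 (stripSum (slab δ) ν q z - 2 ^ k₀ * δ))) := by
          gcongr with i _
          · exact hμ i
          · exact key i z
      _ = _ := by
          rw [show stripSum (slab δ) μ p z = ∑ i, μ i * slab δ (lin (p i) z.1 - z.2) from rfl, Finset.mul_sum, Finset.sum_mul, Finset.mul_sum]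
          exact Finset.sum_congr rfl fun i _ => by ring
  rw [← Finset.sum_mul] at hsum
  have h4k : (4 : ℝ) ^ k * (δ * δ) = 1 := by
    have : (4 : ℝ) ^ k = (2 : ℝ) ^ (2 * k : ℝ) := by
      rw [Real.rpow_mul (by norm_num), Real.rpow_natCast]; norm_num
    rw [this, hδ, ← Real.rpow_add (by norm_num), ← Real.rpow_add (by norm_num)]
    rw [show (2 * k + (-k + -k) : ℝ) = 0 by ring, Real.rpow_zero]
  set M := ∑ w ∈ B, μ w.1 * ν w.2
  calc M = M * ((4 : ℝ) ^ k * (δ * δ)) := by rw [h4k, mul_one]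
    _ = 16 * 2 ^ ρ * 4 ^ k * (M * (2 * ε * (δ / 4))) := by nth_rw 1 [hεδ]; ring
    _ ≤ 16 * 2 ^ ρ * 4 ^ k * (2 * excess (2 ^ k₀) μ p ν q δ) := by gcongr
    _ = _ := by ring

lemma badPairs_eq_empty (hν : ∀ i, 0 ≤ ν i) (hν1 : ∑ i, ν i ≤ 1) {m n : ℕ} (h : n ≤ m) :
    badPairs p ν q (2 ^ m) n = ∅ := by
  rw [badPairs, Finset.filter_eq_empty_iff]
  intro z _
  rw [not_lt]
  calc _ ≤ ∑ j, ν j := Finset.sum_le_sum fun j _ => by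
        split_ifs
        · exact le_rfl
        · exact hν j
    _ ≤ 1 := hν1
    _ ≤ _ := by
      rw [← Real.rpow_natCast, ← Real.rpow_add (by norm_num)]
      refine Real.one_le_rpow (by norm_num) ?_
      have : (n : ℝ) ≤ m := by exact_mod_cast h
      linarith

lemma mass_badPairs_le (hFμ : Frost μ p C s T) (hFν : Frost ν q C t T) (hμ : ∀ i, 0 ≤ μ i)
    (hν : ∀ i, 0 ≤ ν i) (hμ1 : ∑ i, μ i ≤ 1) (hν1 : ∑ i, ν i ≤ 1) (hC : 0 ≤ C)
    (hdp : ∀ i j, ‖p i - p j‖ ≤ 1) (hdq : ∀ i j, ‖q i - q j‖ ≤ 1)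
    (hs : s ≤ 1) (ht : t ≤ 2) (hst : 2 ≤ s + t) (k₀ ρ : ℕ)
    (hsep : ∀ i j, (q j).2 - (p i).2 ≠ 0) (hR : ∀ i j, |(q j).2 - (p i).2| ≤ 2 ^ ρ)
    (hslope : ∀ i j, |lineSlope (p i) (q j)| ≤ 2) {n : ℕ} (hn : n ≤ T) :
    ∑ z ∈ badPairs p ν q (2 ^ (k₀ + ρ + 4)) n, μ z.1 * ν z.2 ≤
      32 * 2 ^ ρ * (1680 * C * (T + 1) * T * (2 : ℝ) ^ (-(((s + t) / 2 - 1) * k₀))) := by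
  rcases le_or_gt n (ρ + 3) with h | h
  · rw [badPairs_eq_empty hν hν1 (by omega)]
    simp only [Finset.sum_empty]; positivity
  · obtain ⟨k, rfl⟩ : ∃ k, n = k + ρ + 3 := ⟨n - (ρ + 3), by omega⟩
    refine (mass_badPairs_le_excess hμ hν k₀ ρ k hsep hR hslope).trans ?_
    refine mul_le_mul_of_nonneg_left ?_ (by positivity)
    refine (excess_le hFμ hFν hμ hν hμ1 hν1 hC hdp hdq hs ht hst k₀ (k := k) (by omega)).trans ?_
    gcongr
    omega

end radial
end

noncomputable section

/-- The Euclidean distance between two points of `ℝ × ℝ`. -/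
def edst (x y : ℝ × ℝ) : ℝ := ‖(⟨x.1 - y.1, x.2 - y.2⟩ : ℂ)‖

lemma edst_nonneg (x y : ℝ × ℝ) : 0 ≤ edst x y := norm_nonneg _

lemma edst_sq (x y : ℝ × ℝ) : edst x y ^ 2 = (x.1 - y.1) ^ 2 + (x.2 - y.2) ^ 2 := by
  rw [edst, Complex.sq_norm, Complex.normSq_mk]; ring

lemma abs_edst_sub_edst_le (x x' y : ℝ × ℝ) : |edst x y - edst x' y| ≤ edst x x' := by
  unfold edst
  refine (abs_norm_sub_norm_le _ _).trans_eq ?_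
  congr 1
  apply Complex.ext <;> simp

lemma edst_le_of_abs_le {x y : ℝ × ℝ} {ε : ℝ} (h1 : |x.1 - y.1| ≤ ε) (h2 : |x.2 - y.2| ≤ ε) :
    edst x y ≤ 3 / 2 * ε := by
  have hε : 0 ≤ ε := (abs_nonneg _).trans h1
  refine abs_le_of_sq_le_sq' ?_ (by positivity) |>.2
  rw [edst_sq]
  nlinarith [sq_le_sq' (abs_le.mp h1).1 (abs_le.mp h1).2,
    sq_le_sq' (abs_le.mp h2).1 (abs_le.mp h2).2]

/-- The dyadic cell of generation `k` containing `x`. -/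
def cell (k : ℕ) (x : ℝ × ℝ) : ℤ × ℤ := (⌊(2 : ℝ) ^ k * x.1⌋, ⌊(2 : ℝ) ^ k * x.2⌋)

/-- Two cells are near if they are equal or adjacent. -/
def Near (c d : ℤ × ℤ) : Prop := |c.1 - d.1| ≤ 1 ∧ |c.2 - d.2| ≤ 1

lemma abs_floor_sub_le_one {a b : ℝ} (h : |a - b| ≤ 1) : |⌊a⌋ - ⌊b⌋| ≤ 1 := by
  rw [abs_le] at *
  have h1 := Int.floor_le a
  have h2 := Int.lt_floor_add_one a
  have h3 := Int.floor_le b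
  have h4 := Int.lt_floor_add_one b
  constructor
  · have : (⌊b⌋ : ℝ) < ⌊a⌋ + 2 := by linarith
    have : ⌊b⌋ < ⌊a⌋ + 2 := by exact_mod_cast this
    linarith
  · have : (⌊a⌋ : ℝ) < ⌊b⌋ + 2 := by linarith
    have : ⌊a⌋ < ⌊b⌋ + 2 := by exact_mod_cast this
    linarith

lemma lt_norm_of_not_near {k : ℕ} {x y : ℝ × ℝ} (h : ¬ Near (cell k x) (cell k y)) :
    ((2 : ℝ) ^ k)⁻¹ < ‖x - y‖ := by
  contrapose! h
  have h2 : (0 : ℝ) < 2 ^ k := by positivity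
  rw [Prod.norm_def] at h
  simp only [Prod.fst_sub, Prod.snd_sub, Real.norm_eq_abs] at h
  have aux : ∀ u v : ℝ, |u - v| ≤ ((2 : ℝ) ^ k)⁻¹ → |2 ^ k * u - 2 ^ k * v| ≤ 1 := by
    intro u v huv
    rw [← mul_sub, abs_mul, abs_of_pos h2]
    calc _ ≤ (2 : ℝ) ^ k * ((2 : ℝ) ^ k)⁻¹ := by gcongr
      _ = 1 := mul_inv_cancel₀ h2.ne'
  exact ⟨abs_floor_sub_le_one (aux _ _ ((le_max_left _ _).trans h)),
    abs_floor_sub_le_one (aux _ _ ((le_max_right _ _).trans h))⟩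

lemma abs_sub_le_of_floor_eq {k : ℕ} {u v : ℝ} (h : ⌊(2 : ℝ) ^ k * u⌋ = ⌊(2 : ℝ) ^ k * v⌋) :
    |u - v| ≤ ((2 : ℝ) ^ k)⁻¹ := by
  have h2 : (0 : ℝ) < 2 ^ k := by positivity
  have := Int.abs_sub_lt_one_of_floor_eq_floor h
  rw [← mul_sub, abs_mul, abs_of_pos h2] at this
  rw [← one_div, le_div_iff₀ h2, mul_comm]
  exact this.le

lemma edst_le_of_cell_eq {k : ℕ} {x y : ℝ × ℝ} (h : cell k x = cell k y) :
    edst x y ≤ 3 / 2 * ((2 : ℝ) ^ k)⁻¹ := by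
  rw [cell, cell, Prod.mk.injEq] at h
  exact edst_le_of_abs_le (abs_sub_le_of_floor_eq h.1) (abs_sub_le_of_floor_eq h.2)

/-- If `x`, `x'` are in the same cell of generation `a` and at distance from `y` equal up to
`2 ^ (-b)`, `b ≤ 2 * a`, then `x' - x` is almost orthogonal to `y - x`. -/
lemma abs_orthogonal_le {x x' y : ℝ × ℝ} {a b ρ : ℕ} (hab : b ≤ 2 * a)
    (hc : cell a x = cell a x') (hd : |edst x y - edst x' y| ≤ ((2 : ℝ) ^ b)⁻¹)
    (hsep : ((2 : ℝ) ^ ρ)⁻¹ ≤ |y.2 - x.2|) (hslope : |lineSlope x y| ≤ 2) :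
    |(x'.2 - x.2) - lineSlope x y * (x'.1 - x.1)| ≤ ((2 : ℝ) ^ b)⁻¹ * 2 ^ (ρ + 3) := by
  set m := lineSlope x y with hm
  have hypos : 0 < |y.2 - x.2| := lt_of_lt_of_le (by positivity) hsep
  have hyne : y.2 - x.2 ≠ 0 := abs_pos.mp hypos
  have hm1 : y.1 - x.1 = - (m * (y.2 - x.2)) := by
    rw [hm, lineSlope]; field_simp
  set β := ((2 : ℝ) ^ b)⁻¹ with hβ
  have hβpos : 0 < β := by positivity
  have hβ1 : β ≤ 1 := inv_le_one_of_one_le₀ (one_le_pow₀ (by norm_num))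
  have hw : edst x x' ^ 2 ≤ 9 / 4 * β := by
    have h1 := edst_le_of_cell_eq hc
    have h2 : (((2 : ℝ) ^ a)⁻¹) ^ 2 ≤ β := by
      rw [inv_pow, ← pow_mul, hβ]
      gcongr
      · norm_num
      · omega
    have h3 := pow_le_pow_left₀ (edst_nonneg x x') h1 2
    nlinarith
  have hdle : edst x y ≤ 9 / 4 * |y.2 - x.2| := by
    refine abs_le_of_sq_le_sq' ?_ (by positivity) |>.2
    rw [edst_sq, mul_pow, sq_abs]
    have h1 : x.1 - y.1 = m * (y.2 - x.2) := by linarith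
    have h2 : m ^ 2 ≤ 4 := by nlinarith [abs_le.mp hslope]
    rw [h1]
    nlinarith [sq_nonneg (y.2 - x.2)]
  have hid : 2 * (y.2 - x.2) * ((x'.2 - x.2) - m * (x'.1 - x.1)) =
      edst x x' ^ 2 - (edst x' y - edst x y) * (edst x' y + edst x y) := by
    have h1 : (edst x' y - edst x y) * (edst x' y + edst x y) = edst x' y ^ 2 - edst x y ^ 2 := by ring
    rw [h1, edst_sq, edst_sq, edst_sq]
    have h2 : y.1 = x.1 - m * (y.2 - x.2) := by linarith
    rw [h2]; ring
  have hd2 : |edst x' y - edst x y| ≤ β := by rw [abs_sub_comm]; exact hd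
  have hsum : |edst x' y + edst x y| ≤ 2 * edst x y + 1 := by
    rw [abs_of_nonneg (add_nonneg (edst_nonneg _ _) (edst_nonneg _ _))]
    linarith [(abs_le.mp hd2).2]
  have h5 : 2 * |y.2 - x.2| * |(x'.2 - x.2) - m * (x'.1 - x.1)| ≤
      9 / 4 * β + β * (2 * (9 / 4 * |y.2 - x.2|) + 1) := by
    have : |2 * (y.2 - x.2) * ((x'.2 - x.2) - m * (x'.1 - x.1))| ≤
        9 / 4 * β + β * (2 * (9 / 4 * |y.2 - x.2|) + 1) := by
      rw [hid]
      refine (abs_sub _ _).trans ?_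
      rw [abs_of_nonneg (sq_nonneg _), abs_mul]
      gcongr
      exact hsum.trans (by linarith)
    rwa [abs_mul, abs_mul, abs_two] at this
  set V := |(x'.2 - x.2) - m * (x'.1 - x.1)|
  have h6 : 1 ≤ |y.2 - x.2| * 2 ^ ρ := by
    rw [inv_le_iff_one_le_mul₀ (by positivity)] at hsep; linarith
  have h2ρ : (1 : ℝ) ≤ 2 ^ ρ := one_le_pow₀ (by norm_num)
  have h7 : |y.2 - x.2| * V ≤ |y.2 - x.2| * (β * 2 ^ (ρ + 3)) := by
    rw [pow_add]
    nlinarith [mul_le_mul_of_nonneg_left h6 hβpos.le, mul_le_mul_of_nonneg_left h2ρ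
      (mul_nonneg hβpos.le hypos.le)]
  exact le_of_mul_le_mul_left h7 hypos

/-- Two directions almost orthogonal to a vector which is not too short are close. -/
lemma abs_sub_le_of_orthogonal {w : ℝ × ℝ} {m m' ε η : ℝ} (hη : 4 * ε ≤ η)
    (hw : 2 * η ≤ ‖w‖) (hm : |m| ≤ 2) (h : |w.2 - m * w.1| ≤ ε) (h' : |w.2 - m' * w.1| ≤ ε) :
    |m - m'| * η ≤ 4 * ε := by
  have hε : 0 ≤ ε := (abs_nonneg _).trans h
  have h1 : |(m - m') * w.1| ≤ 2 * ε := by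
    have : (m - m') * w.1 = (w.2 - m' * w.1) - (w.2 - m * w.1) := by ring
    rw [this]; refine (abs_sub _ _).trans (by linarith)
  rw [abs_mul] at h1
  have h2 : |w.2| ≤ ε + 2 * |w.1| := by
    have : w.2 = (w.2 - m * w.1) + m * w.1 := by ring
    rw [this]; refine (abs_add_le _ _).trans ?_
    rw [abs_mul]; gcongr
  rw [Prod.norm_def] at hw
  simp only [Real.norm_eq_abs] at hw
  have h3 : η / 2 ≤ |w.1| := by
    rcases max_cases |w.1| |w.2| with ⟨h, h'⟩ | ⟨h, h'⟩ <;> rw [h] at hw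
    · linarith
    · linarith
  have := mul_le_mul_of_nonneg_left h3 (abs_nonneg (m - m'))
  linarith

end

noncomputable section

section energy

open Classical

variable {ι κ : Type*} [Fintype ι] [Fintype κ] {μ : ι → ℝ} {p : ι → ℝ × ℝ} {ν : κ → ℝ}
  {q : κ → ℝ × ℝ} {D : ℝ} {T : ℕ} {G : Finset (ι × κ)}

/-- The mass of the cells of generation `k` near `c`. -/
def nearMass (μ : ι → ℝ) (p : ι → ℝ × ℝ) (k : ℕ) (c : ℤ × ℤ) : ℝ :=
  ∑ i, if Near c (cell k (p i)) then μ i else 0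

/-- The number of dyadic intervals of length `2 ^ (-k)` meeting the distances from `q j` to the
points `p i` with `(i, j) ∈ G`. -/
def distCount (p : ι → ℝ × ℝ) (q : κ → ℝ × ℝ) (k : ℕ) (G : Finset (ι × κ)) (j : κ) : ℕ :=
  ((Finset.univ.filter fun i => (i, j) ∈ G).image fun i => ⌊(2 : ℝ) ^ k * edst (p i) (q j)⌋).card

/-- The mass of the points in the same cell of generation `a` as `p i` whose distance to `q j` is
within `2 ^ (-b)` of that of `p i`. -/
def arcMass (μ : ι → ℝ) (p : ι → ℝ × ℝ) (q : κ → ℝ × ℝ) (G : Finset (ι × κ)) (a b : ℕ) (i : ι)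
    (j : κ) : ℝ :=
  ∑ i', if cell a (p i) = cell a (p i') ∧ (i', j) ∈ G ∧
    |edst (p i) (q j) - edst (p i') (q j)| ≤ ((2 : ℝ) ^ b)⁻¹ then μ i' else 0

lemma two_pow_div_le_one_of_le {k b c : ℕ} (h : b ≤ k + c) : (1 : ℝ) ≤ 2 ^ c * (2 ^ k / 2 ^ b) := by
  rw [← mul_div_assoc, one_le_div (by positivity), ← pow_add]
  exact pow_le_pow_right₀ (by norm_num) (by omega)

lemma mass_equidistant_le_of_not_near (hν : ∀ i, 0 ≤ ν i) (hν1 : ∑ i, ν i ≤ 1) (hD : 1 ≤ D)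
    (hgood : ∀ n ≤ T, ∀ z ∈ G, z ∉ badPairs p ν q D n) {ρ a b k : ℕ}
    (hsep : ∀ i j, ((2 : ℝ) ^ ρ)⁻¹ ≤ |(q j).2 - (p i).2|)
    (hslope : ∀ i j, |lineSlope (p i) (q j)| ≤ 2)
    (hab : b ≤ 2 * a) (hbT : b ≤ T) {i i' : ι} (hc : cell a (p i) = cell a (p i'))
    (hk : ¬ Near (cell (k + 1) (p i)) (cell (k + 1) (p i'))) :
    ∑ j, (if (i, j) ∈ G ∧ |edst (p i) (q j) - edst (p i') (q j)| ≤ ((2 : ℝ) ^ b)⁻¹ then ν j else 0) ≤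
      D * 2 ^ (ρ + 8) * (2 ^ k / 2 ^ b) := by
  have htriv : ∑ j, (if (i, j) ∈ G ∧ |edst (p i) (q j) - edst (p i') (q j)| ≤ ((2 : ℝ) ^ b)⁻¹
      then ν j else 0) ≤ 1 := by
    refine le_trans (Finset.sum_le_sum fun j _ => ?_) hν1
    split_ifs
    · exact le_rfl
    · exact hν j
  rcases le_or_gt b (k + (ρ + 8)) with hb | hb
  · refine htriv.trans ?_
    have := two_pow_div_le_one_of_le hb
    rw [mul_assoc]
    nlinarith
  by_cases hex : ∃ j₀, (i, j₀) ∈ G ∧ |edst (p i) (q j₀) - edst (p i') (q j₀)| ≤ ((2 : ℝ) ^ b)⁻¹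
  swap
  · push Not at hex
    rw [Finset.sum_eq_zero]
    · positivity
    · intro j _
      rw [if_neg]
      rintro ⟨h1, h2⟩
      exact absurd h2 (not_le.mpr (hex j h1))
  obtain ⟨j₀, hj₀, hd₀⟩ := hex
  obtain ⟨n, rfl⟩ : ∃ n, b = n + k + (ρ + 8) := ⟨b - k - (ρ + 8), by omega⟩
  have hg := hgood n (by omega) _ hj₀
  rw [badPairs, Finset.mem_filter, not_and, not_lt] at hg
  have hg := hg (Finset.mem_univ _)
  have hD' : D * (2 : ℝ) ^ (-(n : ℝ)) = D * 2 ^ (ρ + 8) * (2 ^ k / 2 ^ (n + k + (ρ + 8))) := by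
    rw [Real.rpow_neg (by norm_num), Real.rpow_natCast]; simp only [pow_add]
    field_simp
  rw [← hD']
  refine le_trans (Finset.sum_le_sum fun j _ => ?_) hg
  by_cases hj : (i, j) ∈ G ∧ |edst (p i) (q j) - edst (p i') (q j)| ≤ ((2 : ℝ) ^ (n + k + (ρ + 8)))⁻¹
  swap
  · rw [if_neg hj]; split_ifs
    · exact hν j
    · exact le_rfl
  rw [if_pos hj, if_pos]
  simp only
  have h1 := abs_orthogonal_le hab hc hd₀ (hsep i j₀) (hslope i j₀)
  have h2 := abs_orthogonal_le hab hc hj.2 (hsep i j) (hslope i j)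
  have h3 := lt_norm_of_not_near hk
  rw [norm_sub_rev] at h3
  set ε := ((2 : ℝ) ^ (n + k + (ρ + 8)))⁻¹ * 2 ^ (ρ + 3) with hε
  have hε' : 32 * ε = ((2 : ℝ) ^ (n + k))⁻¹ := by
    rw [hε]; simp only [pow_add]; field_simp; norm_num
  have hpk : ((2 : ℝ) ^ (n + k))⁻¹ = ((2 : ℝ) ^ n)⁻¹ * ((2 : ℝ) ^ k)⁻¹ := by
    rw [pow_add, mul_inv]
  have hn1 : ((2 : ℝ) ^ n)⁻¹ ≤ 1 := inv_le_one_of_one_le₀ (one_le_pow₀ (by norm_num))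
  have hkpos : 0 < ((2 : ℝ) ^ k)⁻¹ := by positivity
  have h4 := abs_sub_le_of_orthogonal (w := p i' - p i) (η := ((2 : ℝ) ^ k)⁻¹ / 4) ?_ ?_
    (hslope i j₀) h1 h2
  · rw [Real.rpow_neg (by norm_num), Real.rpow_natCast]
    refine le_of_mul_le_mul_right ?_ hkpos
    rw [← hpk]
    have : 0 ≤ ε := by positivity
    linarith
  · have : ((2 : ℝ) ^ n)⁻¹ * ((2 : ℝ) ^ k)⁻¹ ≤ ((2 : ℝ) ^ k)⁻¹ := mul_le_of_le_one_left hkpos.le hn1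
    linarith
  · rw [pow_succ, mul_inv] at h3; linarith

lemma mass_equidistant_le (hν : ∀ i, 0 ≤ ν i) (hν1 : ∑ i, ν i ≤ 1) (hD : 1 ≤ D)
    (hgood : ∀ n ≤ T, ∀ z ∈ G, z ∉ badPairs p ν q D n) {ρ a b : ℕ}
    (hsep : ∀ i j, ((2 : ℝ) ^ ρ)⁻¹ ≤ |(q j).2 - (p i).2|)
    (hslope : ∀ i j, |lineSlope (p i) (q j)| ≤ 2)
    (hle : a ≤ b) (hab : b ≤ 2 * a) (hbT : b ≤ T) {i i' : ι} (hc : cell a (p i) = cell a (p i')) :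
    ∑ j, (if (i, j) ∈ G ∧ |edst (p i) (q j) - edst (p i') (q j)| ≤ ((2 : ℝ) ^ b)⁻¹ then ν j else 0) ≤
      ∑ k ∈ Finset.Icc a b, if Near (cell k (p i)) (cell k (p i')) then
        D * 2 ^ (ρ + 8) * (2 ^ k / 2 ^ b) else 0 := by
  set S := (Finset.Icc a b).filter fun k => Near (cell k (p i)) (cell k (p i')) with hS
  have hne : S.Nonempty := ⟨a, by rw [hS, Finset.mem_filter, Finset.mem_Icc, hc]; exact
    ⟨⟨le_rfl, hle⟩, by simp [Near]⟩⟩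
  set k := S.max' hne with hkdef
  have hkS : k ∈ S := S.max'_mem hne
  have hkS' := hkS
  rw [hS, Finset.mem_filter, Finset.mem_Icc] at hkS'
  have hsingle := Finset.single_le_sum (s := S)
    (f := fun k : ℕ => D * 2 ^ (ρ + 8) * ((2 : ℝ) ^ k / 2 ^ b)) (fun i _ => by positivity) hkS
  refine le_trans ?_ (hsingle.trans_eq (Finset.sum_filter _ _))
  rcases eq_or_lt_of_le hkS'.1.2 with hk | hk
  · refine le_trans (Finset.sum_le_sum fun j _ => ?_) (hν1.trans ?_)
    · split_ifs
      · exact le_rfl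
      · exact hν j
    · have := two_pow_div_le_one_of_le (k := k) (b := b) (c := ρ + 8) (by omega)
      rw [mul_assoc]; nlinarith
  · refine mass_equidistant_le_of_not_near hν hν1 hD hgood hsep hslope hab hbT hc fun hn => ?_
    have : k + 1 ∈ S := by
      rw [hS, Finset.mem_filter, Finset.mem_Icc]; exact ⟨⟨by omega, by omega⟩, hn⟩
    have := S.le_max' _ this
    omega

lemma sum_arcMass_le (hμ : ∀ i, 0 ≤ μ i) (hν : ∀ i, 0 ≤ ν i) (hν1 : ∑ i, ν i ≤ 1) (hD : 1 ≤ D)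
    (hgood : ∀ n ≤ T, ∀ z ∈ G, z ∉ badPairs p ν q D n) {ρ a b : ℕ}
    (hsep : ∀ i j, ((2 : ℝ) ^ ρ)⁻¹ ≤ |(q j).2 - (p i).2|)
    (hslope : ∀ i j, |lineSlope (p i) (q j)| ≤ 2)
    (hle : a ≤ b) (hab : b ≤ 2 * a) (hbT : b ≤ T) {H : ℝ} (i : ι)
    (hH : ∀ k, a ≤ k → k ≤ b → nearMass μ p k (cell k (p i)) * 2 ^ k ≤
      H * 2 ^ a * nearMass μ p a (cell a (p i))) :
    ∑ j, (if (i, j) ∈ G then ν j * arcMass μ p q G a b i j else 0) ≤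
      D * 2 ^ (ρ + 8) * (T + 1) * H * (2 ^ a / 2 ^ b) * nearMass μ p a (cell a (p i)) := by
  set F : ι → κ → Prop := fun i' j =>
    |edst (p i) (q j) - edst (p i') (q j)| ≤ ((2 : ℝ) ^ b)⁻¹ with hF
  set K := D * 2 ^ (ρ + 8) with hK
  have hKpos : 0 < K := by positivity
  have hnm : ∀ k c, 0 ≤ nearMass μ p k c := fun k c => Finset.sum_nonneg fun i _ => by
    split_ifs
    · exact hμ i
    · exact le_rfl
  calc _ ≤ ∑ j, ∑ i', (if cell a (p i) = cell a (p i') then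
        μ i' * (if (i, j) ∈ G ∧ F i' j then ν j else 0) else 0) := by
        refine Finset.sum_le_sum fun j _ => ?_
        split_ifs with h
        · rw [arcMass, Finset.mul_sum]
          refine Finset.sum_le_sum fun i' _ => ?_
          by_cases h1 : cell a (p i) = cell a (p i')
          · by_cases h2 : F i' j
            · rw [if_pos h1, if_pos (show (i, j) ∈ G ∧ F i' j from ⟨h, h2⟩), mul_comm]
              refine mul_le_mul_of_nonneg_right ?_ (hν _)
              split_ifs
              · exact le_rfl
              · exact hμ _
            · rw [if_neg (fun h => h2 h.2.2), if_pos h1, if_neg (fun h => h2 h.2), mul_zero, mul_zero]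
          · rw [if_neg (fun h => h1 h.1), if_neg h1, mul_zero]
        · refine Finset.sum_nonneg fun i' _ => ?_
          split_ifs
          · exact mul_nonneg (hμ _) (hν _)
          · rw [mul_zero]
          · exact le_rfl
    _ = ∑ i', (if cell a (p i) = cell a (p i') then
        μ i' * ∑ j, (if (i, j) ∈ G ∧ F i' j then ν j else 0) else 0) := by
        rw [Finset.sum_comm]
        refine Finset.sum_congr rfl fun i' _ => ?_
        split_ifs
        · rw [Finset.mul_sum]
        · simp
    _ ≤ ∑ i', μ i' * ∑ k ∈ Finset.Icc a b, (if Near (cell k (p i)) (cell k (p i')) then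
        K * (2 ^ k / 2 ^ b) else 0) := by
        refine Finset.sum_le_sum fun i' _ => ?_
        split_ifs with h
        · refine mul_le_mul_of_nonneg_left ?_ (hμ _)
          exact mass_equidistant_le hν hν1 hD hgood hsep hslope hle hab hbT h
        · refine mul_nonneg (hμ _) (Finset.sum_nonneg fun k _ => ?_)
          split_ifs
          · positivity
          · exact le_rfl
    _ = ∑ k ∈ Finset.Icc a b, K / 2 ^ b * (nearMass μ p k (cell k (p i)) * 2 ^ k) := by
        simp only [Finset.mul_sum]
        rw [Finset.sum_comm]
        refine Finset.sum_congr rfl fun k _ => ?_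
        rw [nearMass, Finset.sum_mul, Finset.mul_sum]
        refine Finset.sum_congr rfl fun i' _ => ?_
        split_ifs
        · ring
        · simp
    _ ≤ ∑ k ∈ Finset.Icc a b, K / 2 ^ b * (H * 2 ^ a * nearMass μ p a (cell a (p i))) := by
        refine Finset.sum_le_sum fun k hk => ?_
        rw [Finset.mem_Icc] at hk
        refine mul_le_mul_of_nonneg_left (hH k hk.1 hk.2) (by positivity)
    _ ≤ (T + 1) * (K / 2 ^ b * (H * 2 ^ a * nearMass μ p a (cell a (p i)))) := by
        rw [Finset.sum_const, nsmul_eq_mul]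
        refine mul_le_mul_of_nonneg_right ?_ ?_
        · rw [Nat.card_Icc]
          have : b + 1 - a ≤ T + 1 := by omega
          exact_mod_cast this
        · refine mul_nonneg (by positivity) ?_
          refine le_trans ?_ (hH a le_rfl hle)
          exact mul_nonneg (hnm _ _) (by positivity)
    _ = _ := by ring

end energy
end

noncomputable section

section refinement

open Classical

variable {ι κ : Type*} [Fintype ι] [Fintype κ] {μ : ι → ℝ} {p : ι → ℝ × ℝ} {ν : κ → ℝ}
  {q : κ → ℝ × ℝ} {D : ℝ} {T : ℕ} {G : Finset (ι × κ)}

/-- The mass of a set of pairs. -/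
def pairMass (μ : ι → ℝ) (ν : κ → ℝ) (G : Finset (ι × κ)) : ℝ := ∑ z ∈ G, μ z.1 * ν z.2

lemma pairMass_eq (G : Finset (ι × κ)) :
    pairMass μ ν G = ∑ i, μ i * ∑ j, if (i, j) ∈ G then ν j else 0 := by
  have : G = Finset.univ.filter (· ∈ G) := by ext; simp
  rw [pairMass, this, Finset.sum_filter, Fintype.sum_prod_type]
  refine Finset.sum_congr rfl fun i _ => ?_
  rw [Finset.mul_sum]
  refine Finset.sum_congr rfl fun j _ => ?_
  simp only [Finset.mem_filter_univ]
  split_ifs <;> ring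

lemma pairMass_eq' (G : Finset (ι × κ)) :
    pairMass μ ν G = ∑ j, ν j * ∑ i, if (i, j) ∈ G then μ i else 0 := by
  rw [pairMass_eq]
  simp only [Finset.mul_sum]
  rw [Finset.sum_comm]
  refine Finset.sum_congr rfl fun i _ => Finset.sum_congr rfl fun j _ => ?_
  split_ifs <;> ring

lemma pairMass_filter_add (P : ι × κ → Prop) :
    pairMass μ ν (G.filter P) + pairMass μ ν (G.filter fun z => ¬ P z) = pairMass μ ν G :=
  Finset.sum_filter_add_sum_filter_not _ _ _

lemma pairMass_le_of_forall_left (hμ : ∀ i, 0 ≤ μ i) (hμ1 : ∑ i, μ i ≤ 1) {c : ℝ} (hc : 0 ≤ c)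
    (h : ∀ i, (∑ j, if (i, j) ∈ G then ν j else 0) ≤ c) : pairMass μ ν G ≤ c := by
  rw [pairMass_eq]
  calc _ ≤ ∑ i, μ i * c := by gcongr with i _; exacts [hμ i, h i]
    _ ≤ c := by rw [← Finset.sum_mul]; exact mul_le_of_le_one_left hc hμ1

lemma pairMass_le_of_forall_right (hν : ∀ i, 0 ≤ ν i) (hν1 : ∑ i, ν i ≤ 1) {c : ℝ} (hc : 0 ≤ c)
    (h : ∀ j, (∑ i, if (i, j) ∈ G then μ i else 0) ≤ c) : pairMass μ ν G ≤ c := by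
  rw [pairMass_eq']
  calc _ ≤ ∑ i, ν i * c := by gcongr with i _; exacts [hν i, h i]
    _ ≤ c := by rw [← Finset.sum_mul]; exact mul_le_of_le_one_left hc hν1

lemma near_self (c : ℤ × ℤ) : Near c c := by simp [Near]

lemma nearMass_pos (hμ : ∀ i, 0 < μ i) (k : ℕ) (i : ι) : 0 < nearMass μ p k (cell k (p i)) := by
  refine (hμ i).trans_le ?_
  have := Finset.single_le_sum (s := Finset.univ)
    (f := fun i' => if Near (cell k (p i)) (cell k (p i')) then μ i' else 0)
    (fun i _ => by split_ifs; exacts [(hμ i).le, le_rfl]) (Finset.mem_univ i)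
  simp only [near_self, if_true] at this
  exact this

lemma card_near_le (S : Finset (ℤ × ℤ)) (d : ℤ × ℤ) : (S.filter fun c => Near c d).card ≤ 9 := by
  have : S.filter (fun c => Near c d) ⊆
      Finset.Icc (d.1 - 1) (d.1 + 1) ×ˢ Finset.Icc (d.2 - 1) (d.2 + 1) := by
    intro c hc
    rw [Finset.mem_filter, Near, abs_le, abs_le] at hc
    rw [Finset.mem_product, Finset.mem_Icc, Finset.mem_Icc]
    omega
  refine (Finset.card_le_card this).trans ?_
  rw [Finset.card_product, Int.card_Icc, Int.card_Icc]
  have h1 : (d.1 + 1 + 1 - (d.1 - 1)).toNat = 3 := by omega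
  have h2 : (d.2 + 1 + 1 - (d.2 - 1)).toNat = 3 := by omega
  rw [h1, h2]

lemma sum_nearMass_le (hμ : ∀ i, 0 ≤ μ i) (hμ1 : ∑ i, μ i ≤ 1) (k : ℕ) (S : Finset (ℤ × ℤ)) :
    ∑ c ∈ S, nearMass μ p k c ≤ 9 := by
  unfold nearMass
  rw [Finset.sum_comm]
  calc _ ≤ ∑ i, μ i * 9 := by
        refine Finset.sum_le_sum fun i _ => ?_
        rw [← Finset.sum_filter, Finset.sum_const, nsmul_eq_mul, mul_comm]
        refine mul_le_mul_of_nonneg_left ?_ (hμ i)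
        exact_mod_cast card_near_le S _
    _ ≤ 9 := by rw [← Finset.sum_mul]; linarith

/-- Discarding the cells which carry a small proportion of the mass of their neighbourhood costs
little mass. -/
lemma sum_sparse_le (hμ : ∀ i, 0 ≤ μ i) (hμ1 : ∑ i, μ i ≤ 1) (k : ℕ) {c : ℝ} (hc : 0 ≤ c)
    (S : Finset ι) :
    ∑ i ∈ S with (∑ i' ∈ S with cell k (p i) = cell k (p i'), μ i') < c * nearMass μ p k (cell k (p i)),
      μ i ≤ 9 * c := by
  set R := S.filter fun i => (∑ i' ∈ S with cell k (p i) = cell k (p i'), μ i') <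
    c * nearMass μ p k (cell k (p i)) with hR
  calc ∑ i ∈ R, μ i = ∑ d ∈ R.image fun i => cell k (p i), ∑ i ∈ R with cell k (p i) = d, μ i :=
        (Finset.sum_fiberwise_of_maps_to (fun i hi => Finset.mem_image_of_mem _ hi) _).symm
    _ ≤ ∑ d ∈ R.image fun i => cell k (p i), c * nearMass μ p k d := by
        refine Finset.sum_le_sum fun d hd => ?_
        obtain ⟨i, hi, rfl⟩ := Finset.mem_image.mp hd
        have hi' := hi
        rw [hR, Finset.mem_filter] at hi'
        refine le_trans ?_ hi'.2.le
        refine Finset.sum_le_sum_of_subset_of_nonneg ?_ (fun i _ _ => hμ i)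
        intro i' h'
        rw [Finset.mem_filter, hR, Finset.mem_filter] at h'
        rw [Finset.mem_filter]
        exact ⟨h'.1.1, h'.2.symm⟩
    _ ≤ _ := by
        rw [← Finset.mul_sum, mul_comm]
        exact mul_le_mul_of_nonneg_right (sum_nearMass_le hμ hμ1 k _) hc

lemma card_floor_le (x : ℝ) (A : Finset ℤ)
    (hA : ∀ v ∈ A, ∃ u : ℝ, ⌊u⌋ = v ∧ x - 3 / 2 ≤ u ∧ u ≤ x + 5 / 2) : A.card ≤ 5 := by
  have : A ⊆ Finset.Icc ⌊x - 3 / 2⌋ (⌊x - 3 / 2⌋ + 4) := by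
    intro v hv
    obtain ⟨u, rfl, h1, h2⟩ := hA v hv
    rw [Finset.mem_Icc]
    refine ⟨Int.floor_mono h1, ?_⟩
    have : ⌊x - 3 / 2⌋ + 4 = ⌊x + 5 / 2⌋ := by
      rw [show x + 5 / 2 = (x - 3 / 2) + (4 : ℤ) by push_cast; ring, Int.floor_add_intCast]
    rw [this]
    exact Int.floor_mono h2
  refine (Finset.card_le_card this).trans ?_
  rw [Int.card_Icc]
  omega

/-- Passing from scale `b` to scale `a` in the distance count. -/
lemma distCount_mul_le {G' : Finset (ι × κ)} {a b : ℕ} (hab : a ≤ b) (j : κ) {m : ℝ}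
    (hm : ∀ i, (i, j) ∈ G' → m ≤ ((Finset.univ.filter fun i' => (i', j) ∈ G ∧
      cell a (p i) = cell a (p i')).image fun i' => ⌊(2 : ℝ) ^ b * edst (p i') (q j)⌋).card) :
    distCount p q a G' j * m ≤ 5 * distCount p q b G j := by
  rcases isEmpty_or_nonempty ι with hemp | hne
  · have : distCount p q a G' j = 0 := by simp [distCount]
    rw [this]
    simp only [Nat.cast_zero, zero_mul]
    positivity
  set A := (Finset.univ.filter fun i => (i, j) ∈ G').image
    fun i => ⌊(2 : ℝ) ^ a * edst (p i) (q j)⌋ with hA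
  set B := (Finset.univ.filter fun i => (i, j) ∈ G).image
    fun i => ⌊(2 : ℝ) ^ b * edst (p i) (q j)⌋ with hB
  have hrep : ∀ v ∈ A, ∃ i, (i, j) ∈ G' ∧ ⌊(2 : ℝ) ^ a * edst (p i) (q j)⌋ = v := by
    intro v hv
    obtain ⟨i, hi, h⟩ := Finset.mem_image.mp hv
    exact ⟨i, (Finset.mem_filter.mp hi).2, h⟩
  have hempty : ∀ v : ℤ, ∃ i, v ∈ A → (i, j) ∈ G' ∧ ⌊(2 : ℝ) ^ a * edst (p i) (q j)⌋ = v := by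
    intro v
    by_cases hv : v ∈ A
    · obtain ⟨i, hi⟩ := hrep v hv
      exact ⟨i, fun _ => hi⟩
    · exact ⟨hne.some, fun h => absurd h hv⟩
  choose r hr using hempty
  have hr1 := fun v hv => (hr v hv).1
  have hr2 := fun v hv => (hr v hv).2
  set I : ℤ → Finset ι := fun v => Finset.univ.filter fun i' => (i', j) ∈ G ∧
    cell a (p (r v)) = cell a (p i') with hI
  have := Finset.card_nsmul_le_card_nsmul (s := A) (t := B) (m := m) (n := 5)
    (fun v β => β ∈ (I v).image fun i' => ⌊(2 : ℝ) ^ b * edst (p i') (q j)⌋) ?_ ?_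
  · rw [nsmul_eq_mul, nsmul_eq_mul, mul_comm _ (5 : ℝ)] at this
    exact this
  · intro v hv
    refine (hm (r v) (hr1 v hv)).trans ?_
    have : (I v).image (fun i' => ⌊(2 : ℝ) ^ b * edst (p i') (q j)⌋) ⊆
        Finset.bipartiteAbove (fun v β => β ∈ (I v).image
          fun i' => ⌊(2 : ℝ) ^ b * edst (p i') (q j)⌋) B v := by
      intro β hβ
      rw [Finset.mem_bipartiteAbove]
      refine ⟨?_, hβ⟩
      obtain ⟨i', hi', h⟩ := Finset.mem_image.mp hβ
      rw [hB]
      refine Finset.mem_image.mpr ⟨i', ?_, h⟩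
      simp only [hI, Finset.mem_filter] at hi' ⊢
      exact ⟨hi'.1, hi'.2.1⟩
    exact_mod_cast Finset.card_le_card this
  · intro β _
    have : (Finset.bipartiteBelow (fun v β => β ∈ (I v).image
          fun i' => ⌊(2 : ℝ) ^ b * edst (p i') (q j)⌋) A β).card ≤ 5 := by
      refine card_floor_le (β * 2 ^ a / 2 ^ b) _ ?_
      intro v hv
      rw [Finset.mem_bipartiteBelow] at hv
      obtain ⟨hv, hβ⟩ := hv
      obtain ⟨i', hi', h⟩ := Finset.mem_image.mp hβ
      simp only [hI, Finset.mem_filter] at hi'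
      refine ⟨(2 : ℝ) ^ a * edst (p (r v)) (q j), hr2 v hv, ?_⟩
      have h1 := (abs_edst_sub_edst_le _ _ (q j)).trans (edst_le_of_cell_eq hi'.2.2)
      have ha : (0 : ℝ) < 2 ^ a := by positivity
      have h2 : |(2 : ℝ) ^ a * edst (p (r v)) (q j) - 2 ^ a * edst (p i') (q j)| ≤ 3 / 2 := by
        rw [← mul_sub, abs_mul, abs_of_pos ha]
        calc _ ≤ (2 : ℝ) ^ a * (3 / 2 * (2 ^ a)⁻¹) := by gcongr
          _ = 3 / 2 := by field_simp
      have h3 := Int.floor_le ((2 : ℝ) ^ b * edst (p i') (q j))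
      have h4 := Int.lt_floor_add_one ((2 : ℝ) ^ b * edst (p i') (q j))
      rw [h] at h3 h4
      obtain ⟨n, rfl⟩ := Nat.exists_eq_add_of_le hab
      have hn : (1 : ℝ) ≤ 2 ^ n := one_le_pow₀ (by norm_num)
      have h5 : (β : ℝ) * 2 ^ a / 2 ^ (a + n) = β / 2 ^ n := by rw [pow_add]; field_simp
      rw [h5]
      rw [pow_add] at h3 h4
      have h6 : (β : ℝ) / 2 ^ n ≤ 2 ^ a * edst (p i') (q j) := by
        rw [div_le_iff₀ (by positivity)]; linarith
      have h7 : 2 ^ a * edst (p i') (q j) ≤ (β : ℝ) / 2 ^ n + 1 := by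
        have : (β : ℝ) / 2 ^ n + 1 = (β + 2 ^ n) / 2 ^ n := by field_simp
        rw [this, le_div_iff₀ (by positivity)]; linarith
      rw [abs_le] at h2
      constructor <;> linarith
    exact_mod_cast this

/-- Markov's inequality for the first marginal. -/
lemma pairMass_filter_lt_le (hμ : ∀ i, 0 ≤ μ i) (hν : ∀ i, 0 ≤ ν i) (hμ1 : ∑ i, μ i ≤ 1)
    {f : ι → κ → ℝ} (hf : ∀ i j, 0 ≤ f i j) {M : ι → ℝ} (hM : ∀ i, 0 < M i) {c : ℝ} (hc : 0 < c)
    (h : ∀ i j, (i, j) ∈ G → ∑ j, (if (i, j) ∈ G then ν j * f i j else 0) ≤ M i) :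
    pairMass μ ν (G.filter fun z => ¬ f z.1 z.2 ≤ 4 / c * M z.1) ≤ c / 4 := by
  refine pairMass_le_of_forall_left hμ hμ1 (by positivity) fun i => ?_
  by_cases hex : ∃ j, (i, j) ∈ G
  swap
  · rw [Finset.sum_eq_zero]
    · positivity
    · intro j _
      rw [if_neg]
      intro h
      exact hex ⟨j, (Finset.mem_filter.mp h).1⟩
  obtain ⟨j₀, hj₀⟩ := hex
  have h1 := h i j₀ hj₀
  have h2 : (∑ j, if (i, j) ∈ G.filter (fun z => ¬ f z.1 z.2 ≤ 4 / c * M z.1) then ν j else 0) *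
      (4 / c * M i) ≤ M i := by
    refine le_trans ?_ h1
    rw [Finset.sum_mul]
    refine Finset.sum_le_sum fun j _ => ?_
    by_cases h : (i, j) ∈ G.filter (fun z => ¬ f z.1 z.2 ≤ 4 / c * M z.1)
    · rw [if_pos h, if_pos (Finset.mem_filter.mp h).1]
      exact mul_le_mul_of_nonneg_left (not_le.mp (Finset.mem_filter.mp h).2).le (hν j)
    · rw [if_neg h, zero_mul]
      split_ifs
      · exact mul_nonneg (hν j) (hf i j)
      · exact le_rfl
  generalize (∑ j, if (i, j) ∈ G.filter (fun z => ¬ f z.1 z.2 ≤ 4 / c * M z.1) then ν j else 0) = S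
    at h2 ⊢
  have h3 : S * (4 / c) * M i ≤ 1 * M i := by linarith
  have h4 := le_of_mul_le_mul_right h3 (hM i)
  rw [mul_div_assoc', div_le_one hc] at h4
  linarith

/-- Discarding the pairs in sparse cells costs little mass. -/
lemma pairMass_sparse_le (hμ : ∀ i, 0 ≤ μ i) (hν : ∀ i, 0 ≤ ν i) (hμ1 : ∑ i, μ i ≤ 1)
    (hν1 : ∑ i, ν i ≤ 1) (a : ℕ) {c : ℝ} (hc : 0 < c) :
    pairMass μ ν (G.filter fun z => (∑ i' with (i', z.2) ∈ G ∧ cell a (p z.1) = cell a (p i'), μ i') <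
      c / 36 * nearMass μ p a (cell a (p z.1))) ≤ c / 4 := by
  refine pairMass_le_of_forall_right hν hν1 (by positivity) fun j => ?_
  have := sum_sparse_le (p := p) hμ hμ1 a (c := c / 36) (by positivity)
    (Finset.univ.filter (fun i => (i, j) ∈ G))
  simp only [Finset.filter_filter, Finset.sum_filter] at this
  simp only [Finset.mem_filter, Finset.sum_filter]
  refine this.trans (by linarith)

lemma exists_subset_le (hμ : ∀ i, 0 ≤ μ i) (hν : ∀ i, 0 ≤ ν i) (hμ1 : ∑ i, μ i ≤ 1)
    {f : ι → κ → ℝ} (hf : ∀ i j, 0 ≤ f i j) {M : ι → ℝ} (hM : ∀ i, 0 < M i) {c : ℝ} (hc : 0 < c)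
    (h : ∀ i j, (i, j) ∈ G → ∑ j, (if (i, j) ∈ G then ν j * f i j else 0) ≤ M i) :
    ∃ G' ⊆ G, pairMass μ ν G ≤ pairMass μ ν G' + c / 4 ∧
      ∀ i j, (i, j) ∈ G' → f i j ≤ 4 / c * M i := by
  refine ⟨G.filter fun z => f z.1 z.2 ≤ 4 / c * M z.1, Finset.filter_subset _ _, ?_, fun i j hij =>
    (Finset.mem_filter.mp hij).2⟩
  rw [← pairMass_filter_add (G := G) fun z => f z.1 z.2 ≤ 4 / c * M z.1]
  exact add_le_add le_rfl (pairMass_filter_lt_le hμ hν hμ1 hf hM hc h)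

lemma exists_subset_dense (hμ : ∀ i, 0 ≤ μ i) (hν : ∀ i, 0 ≤ ν i) (hμ1 : ∑ i, μ i ≤ 1)
    (hν1 : ∑ i, ν i ≤ 1) (a : ℕ) {c : ℝ} (hc : 0 < c) :
    ∃ G' ⊆ G, pairMass μ ν G ≤ pairMass μ ν G' + c / 4 ∧
      ∀ i j, (i, j) ∈ G' → c / 36 * nearMass μ p a (cell a (p i)) ≤
        ∑ i' with (i', j) ∈ G ∧ cell a (p i) = cell a (p i'), μ i' := by
  refine ⟨G.filter fun z => ¬ (∑ i' with (i', z.2) ∈ G ∧ cell a (p z.1) = cell a (p i'), μ i') <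
      c / 36 * nearMass μ p a (cell a (p z.1)), Finset.filter_subset _ _, ?_, fun i j hij =>
    not_lt.mp (Finset.mem_filter.mp hij).2⟩
  rw [← pairMass_filter_add (G := G) fun z =>
    (∑ i' with (i', z.2) ∈ G ∧ cell a (p z.1) = cell a (p i'), μ i') <
      c / 36 * nearMass μ p a (cell a (p z.1)), add_comm]
  exact add_le_add le_rfl (pairMass_sparse_le hμ hν hμ1 hν1 a hc)

/-- Counting distances in a dense cell with light arcs. -/
lemma dense_cell_le_mul_card (hμ : ∀ i, 0 ≤ μ i) {a b : ℕ} {i : ι} {j : κ}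
    {G1 : Finset (ι × κ)} (hG : G1 ⊆ G) {L : ℝ}
    (hL : ∀ i', (i', j) ∈ G1 → cell a (p i) = cell a (p i') → arcMass μ p q G a b i' j ≤ L) :
    (∑ i' with (i', j) ∈ G1 ∧ cell a (p i) = cell a (p i'), μ i') ≤
      ((Finset.univ.filter fun i' => (i', j) ∈ G1 ∧ cell a (p i) = cell a (p i')).image
        fun i' => ⌊(2 : ℝ) ^ b * edst (p i') (q j)⌋).card * L := by
  rw [← Finset.sum_fiberwise_of_maps_to (g := fun i' => ⌊(2 : ℝ) ^ b * edst (p i') (q j)⌋)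
    (fun i hi => Finset.mem_image_of_mem (fun i' => ⌊(2 : ℝ) ^ b * edst (p i') (q j)⌋) hi),
    ← nsmul_eq_mul]
  refine Finset.sum_le_card_nsmul _ _ _ fun β hβ => ?_
  obtain ⟨i₁, hi₁, h⟩ := Finset.mem_image.mp hβ
  rw [Finset.mem_filter] at hi₁
  refine le_trans ?_ (hL i₁ hi₁.2.1 hi₁.2.2)
  rw [arcMass, ← Finset.sum_filter]
  refine Finset.sum_le_sum_of_subset_of_nonneg ?_ (fun i _ _ => hμ i)
  intro i₂ hi₂
  rw [Finset.mem_filter, Finset.mem_filter] at hi₂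
  rw [Finset.mem_filter]
  refine ⟨Finset.mem_univ _, ?_, hG hi₂.1.2.1, ?_⟩
  · rw [← hi₁.2.2, hi₂.1.2.2]
  · exact abs_sub_le_of_floor_eq (h.trans hi₂.2.symm)

lemma arcMass_nonneg (hμ : ∀ i, 0 ≤ μ i) (a b : ℕ) (i : ι) (j : κ) :
    0 ≤ arcMass μ p q G a b i j :=
  Finset.sum_nonneg fun i _ => by split_ifs; exacts [hμ i, le_rfl]

lemma distCount_mono {G' : Finset (ι × κ)} (h : G' ⊆ G) (b : ℕ) (j : κ) :
    distCount p q b G' j ≤ distCount p q b G j := by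
  refine Finset.card_le_card (Finset.image_subset_image fun i hi => ?_)
  rw [Finset.mem_filter] at hi ⊢
  exact ⟨hi.1, h hi.2⟩

/-- One step of the multiscale argument: after discarding half of the mass, the number of
distances at scale `b` is controlled from below by the number of distances at scale `a`. -/
lemma exists_refinement (hμ : ∀ i, 0 < μ i) (hν : ∀ i, 0 ≤ ν i) (hμ1 : ∑ i, μ i ≤ 1)
    (hν1 : ∑ i, ν i ≤ 1) (hD : 1 ≤ D)
    (hgood : ∀ n ≤ T, ∀ z ∈ G, z ∉ badPairs p ν q D n) {ρ a b : ℕ}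
    (hsep : ∀ i j, ((2 : ℝ) ^ ρ)⁻¹ ≤ |(q j).2 - (p i).2|)
    (hslope : ∀ i j, |lineSlope (p i) (q j)| ≤ 2)
    (hle : a ≤ b) (hab : b ≤ 2 * a) (hbT : b ≤ T) {H : ℝ} (hH0 : 0 < H)
    (hH : ∀ z ∈ G, ∀ k, a ≤ k → k ≤ b → nearMass μ p k (cell k (p z.1)) * 2 ^ k ≤
      H * 2 ^ a * nearMass μ p a (cell a (p z.1)))
    {c : ℝ} (hc : 0 < c) (hG : c ≤ pairMass μ ν G) :
    ∃ G' ⊆ G, c / 2 ≤ pairMass μ ν G' ∧ ∀ j,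
      distCount p q a G' j * c ^ 2 * 2 ^ b ≤
        720 * 2 ^ (ρ + 8) * (T + 1) * D * H * 2 ^ a * distCount p q b G j := by
  have hμ' := fun i => (hμ i).le
  obtain ⟨E, hE⟩ : ∃ E, E = D * 2 ^ (ρ + 8) * (T + 1) * H * (2 ^ a / 2 ^ b) := ⟨_, rfl⟩
  have hEpos : 0 < E := by rw [hE]; positivity
  have hPpos : ∀ i, 0 < nearMass μ p a (cell a (p i)) := nearMass_pos hμ a
  obtain ⟨G1, hG1sub, m1, hQ1⟩ := exists_subset_le (μ := μ) (ν := ν) (G := G)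
    (f := arcMass μ p q G a b) (M := fun i => E * nearMass μ p a (cell a (p i))) hμ' hν hμ1
    (fun i j => arcMass_nonneg hμ' a b i j) (fun i => mul_pos hEpos (hPpos i)) hc
    (fun i j hij => by
      rw [hE]
      exact sum_arcMass_le hμ' hν hν1 hD hgood hsep hslope hle hab hbT i (hH (i, j) hij))
  obtain ⟨G2, hG2sub, m2, hQ2⟩ := exists_subset_dense (p := p) (G := G1) hμ' hν hμ1 hν1 a hc
  refine ⟨G2, hG2sub.trans hG1sub, by linarith, fun j => ?_⟩
  have hcount := distCount_mul_le (p := p) (q := q) (G := G1) (G' := G2) hle j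
    (m := c ^ 2 / (144 * E)) fun i hi => by
    have h3 := (hQ2 i j hi).trans (dense_cell_le_mul_card (q := q) (b := b) hμ' hG1sub
      fun i' h' hcell => by
        have := hQ1 i' j h'
        rwa [← hcell] at this)
    generalize (Finset.card _ : ℝ) = N at h3 ⊢
    have h4 : c / 36 * nearMass μ p a (cell a (p i)) ≤
      N * (4 / c * E) * nearMass μ p a (cell a (p i)) := by linarith
    have h5 := le_of_mul_le_mul_right h4 (hPpos i)
    rw [div_le_iff₀ (by positivity)]
    have h6 := mul_le_mul_of_nonneg_left h5 (show 0 ≤ 36 * c by positivity)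
    have h7 : 36 * c * (N * (4 / c * E)) = N * (144 * E) := by field_simp; ring
    rw [h7] at h6
    linarith
  have hmono : (distCount p q b G1 j : ℝ) ≤ distCount p q b G j :=
    Nat.cast_le.mpr (distCount_mono hG1sub b j)
  generalize (distCount p q a _ j : ℝ) = N1 at hcount ⊢
  rw [← mul_div_assoc, div_le_iff₀ (by positivity)] at hcount
  have h2b : (0 : ℝ) < 2 ^ b := by positivity
  calc N1 * c ^ 2 * 2 ^ b ≤ 5 * distCount p q b G1 j * (144 * E) * 2 ^ b :=
        mul_le_mul_of_nonneg_right hcount h2b.le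
    _ ≤ 5 * distCount p q b G j * (144 * E) * 2 ^ b := by gcongr
    _ = _ := by rw [hE]; field_simp; ring

end refinement
end

noncomputable section

section profile

/-- The running maximum of `k - (2 / 3) f k`. -/
def profileMax (f : ℕ → ℝ) (b : ℕ) : ℝ :=
  (Finset.range (b + 1)).sup' Finset.nonempty_range_add_one fun k => (k : ℝ) - 2 / 3 * f k

lemma le_profileMax (f : ℕ → ℝ) {k b : ℕ} (h : k ≤ b) : (k : ℝ) - 2 / 3 * f k ≤ profileMax f b :=
  Finset.le_sup' (fun k : ℕ => (k : ℝ) - 2 / 3 * f k) (Finset.mem_range.mpr (by omega))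

lemma exists_profileMax_eq (f : ℕ → ℝ) (b : ℕ) :
    ∃ k ≤ b, profileMax f b = (k : ℝ) - 2 / 3 * f k := by
  obtain ⟨k, hk, h⟩ := Finset.exists_mem_eq_sup' (Finset.nonempty_range_add_one (n := b))
    fun k : ℕ => (k : ℝ) - 2 / 3 * f k
  exact ⟨k, by rw [Finset.mem_range] at hk; omega, h⟩

lemma profileMax_mono (f : ℕ → ℝ) {a b : ℕ} (h : a ≤ b) : profileMax f a ≤ profileMax f b := by
  obtain ⟨k, hk, hk'⟩ := exists_profileMax_eq f a
  rw [hk']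
  exact le_profileMax f (hk.trans h)

/-- The choice of the next scale in the multiscale argument. -/
lemma exists_scale {f : ℕ → ℝ} {b g : ℕ} {l l' θ : ℝ} (hmono : Monotone f)
    (htyp : ∀ k k', k ≤ k' → k' ≤ b → f k' ≤ f k + 2 * (k' - k) + l') (hθ : 0 < θ) (hθ1 : θ ≤ 1)
    (hl : 0 ≤ l) (hl' : 0 ≤ l') (hg : l ≤ θ * g)
    (hb : 3 / 2 * g + 1 / 2 + l' + l ≤ θ * ((b - 1) / 2)) :
    ∃ a, b ≤ 2 * a ∧ a + g ≤ b ∧ ∃ e : ℝ, 0 ≤ e ∧ e ≤ b ∧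
      (∀ k, a ≤ k → k ≤ b → f a - a ≤ f k - k + e) ∧
      profileMax f a + θ * a + e + l ≤ profileMax f b + θ * b := by
  have hb0 : (0 : ℝ) ≤ ((b : ℝ) - 1) / 2 := by
    have : (0 : ℝ) ≤ g := Nat.cast_nonneg g
    by_contra! h
    nlinarith
  have hb1 : 3 * (g : ℝ) + 1 ≤ b - 1 := by nlinarith
  have hb2 : 3 * g + 2 ≤ b := by
    have : (3 * g + 2 : ℝ) ≤ b := by linarith
    exact_mod_cast this
  obtain ⟨s, hs1, hs2⟩ : ∃ s, b ≤ 2 * s ∧ 2 * s ≤ b + 1 := ⟨(b + 1) / 2, by omega, by omega⟩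
  have hs1r : (b : ℝ) ≤ 2 * s := by exact_mod_cast hs1
  have hs2r : (2 * s : ℝ) ≤ b + 1 := by exact_mod_cast hs2
  obtain ⟨m, hm, hmin⟩ := Finset.exists_min_image (Finset.Icc s b) (fun k => f k - k)
    ⟨s, Finset.mem_Icc.mpr ⟨le_rfl, by omega⟩⟩
  rw [Finset.mem_Icc] at hm
  have hmin' : ∀ k, s ≤ k → k ≤ b → f m - m ≤ f k - k := fun k h1 h2 =>
    hmin k (Finset.mem_Icc.mpr ⟨h1, h2⟩)
  have hstep : ∀ a, a + g ≤ b → θ * a + l ≤ θ * b := by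
    intro a ha
    have : (a : ℝ) + g ≤ b := by exact_mod_cast ha
    nlinarith
  have hebound : ∀ a, a ≤ m → f a - a - (f m - m) ≤ b := by
    intro a ha
    have h1 := hmono ha
    have h2 : (m : ℝ) ≤ b := by exact_mod_cast hm.2
    have h3 : (0 : ℝ) ≤ a := Nat.cast_nonneg a
    linarith
  by_cases hc1 : m + g ≤ b
  · refine ⟨m, by omega, hc1, 0, le_rfl, Nat.cast_nonneg b, fun k h1 h2 => ?_, ?_⟩
    · rw [add_zero]
      exact hmin' k (hm.1.trans h1) h2
    · have := profileMax_mono f hm.2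
      have := hstep m hc1
      linarith
  by_cases hc2 : ∃ a, s ≤ a ∧ a + g ≤ b ∧ profileMax f a = a - 2 / 3 * f a
  · obtain ⟨a, ha1, ha2, ha3⟩ := hc2
    refine ⟨a, by omega, ha2, f a - a - (f m - m), ?_, hebound a (by omega), fun k h1 h2 => ?_, ?_⟩
    · have := hmin' a ha1 (by omega)
      linarith
    · have := hmin' k (ha1.trans h1) h2
      linarith
    · have h1 := le_profileMax f hm.2
      have h2 := hstep a ha2
      have h3 : f a ≤ f m := hmono (by omega)
      rw [ha3]
      linarith
  push Not at hc2
  refine ⟨s, hs1, by omega, f s - s - (f m - m), ?_, hebound s hm.1, fun k h1 h2 => ?_, ?_⟩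
  · have := hmin' s le_rfl (by omega)
    linarith
  · have := hmin' k h1 h2
    linarith
  obtain ⟨x, hx, hx'⟩ := exists_profileMax_eq f (b - g)
  have hxmax : profileMax f x = x - 2 / 3 * f x :=
    le_antisymm ((profileMax_mono f hx).trans hx'.le) (le_profileMax f le_rfl)
  have hxs : x < s := by
    by_contra! h
    exact hc2 x h (by omega) hxmax
  have h1 := le_profileMax f (le_refl (b - g))
  rw [hx', Nat.cast_sub (by omega)] at h1
  have h2 : f (b - g) ≤ f m := hmono (by omega)
  have h3 := htyp x s hxs.le (by omega)
  have h4 := profileMax_mono f (show s ≤ b by omega)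
  have h5 : (m : ℝ) ≤ b := by exact_mod_cast hm.2
  have h6 : (0 : ℝ) ≤ x := Nat.cast_nonneg x
  nlinarith

end profile
end

noncomputable section

section multiscale

open Classical

variable {ι κ : Type*} [Fintype ι] [Fintype κ] {μ : ι → ℝ} {p : ι → ℝ × ℝ} {ν : κ → ℝ}
  {q : κ → ℝ × ℝ} {D : ℝ} {T : ℕ} {G : Finset (ι × κ)}

/-- The exponent of the mass around `p i` at scale `2 ^ (-k)`. -/
def massExponent (μ : ι → ℝ) (p : ι → ℝ × ℝ) (i : ι) (k : ℕ) : ℝ :=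
  -Real.logb 2 (nearMass μ p k (cell k (p i)))

lemma nearMass_eq_rpow (hμ : ∀ i, 0 < μ i) (i : ι) (k : ℕ) :
    nearMass μ p k (cell k (p i)) = (2 : ℝ) ^ (-massExponent μ p i k) := by
  rw [massExponent, neg_neg, Real.rpow_logb (by norm_num) (by norm_num) (nearMass_pos hμ k i)]

lemma near_of_near_succ {k : ℕ} {x y : ℝ × ℝ} (h : Near (cell (k + 1) x) (cell (k + 1) y)) :
    Near (cell k x) (cell k y) := by
  have key : ∀ x : ℝ, ⌊(2 : ℝ) ^ k * x⌋ = ⌊(2 : ℝ) ^ (k + 1) * x⌋ / 2 := by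
    intro x
    have h := Int.floor_div_natCast ((2 : ℝ) ^ (k + 1) * x) 2
    rw [Nat.cast_ofNat, Nat.cast_ofNat] at h
    rw [← h]
    congr 1
    rw [pow_succ]
    ring
  simp only [Near, cell, abs_le] at h ⊢
  rw [key, key, key, key]
  omega

lemma massExponent_monotone (hμ : ∀ i, 0 < μ i) (i : ι) : Monotone (massExponent μ p i) := by
  refine monotone_nat_of_le_succ fun k => ?_
  refine neg_le_neg (Real.logb_le_logb_of_le (by norm_num) (nearMass_pos hμ _ i) ?_)
  refine Finset.sum_le_sum fun i' _ => ?_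
  split_ifs with h1 h2 h2
  · exact le_rfl
  · exact absurd (near_of_near_succ h1) h2
  · exact (hμ i').le
  · exact le_rfl

/-- A set of pairs with several labels has a subset of a single label carrying a proportion of
its mass. -/
lemma exists_label {α : Type*} (S : Finset α) (hS : S.Nonempty) (lab : ι × κ → α)
    (hlab : ∀ z ∈ G, lab z ∈ S) :
    ∃ v, ∃ G' ⊆ G, (∀ z ∈ G', lab z = v) ∧ pairMass μ ν G ≤ S.card * pairMass μ ν G' := by
  obtain ⟨v, hv, hmax⟩ := Finset.exists_max_image S
    (fun v => pairMass μ ν (G.filter fun z => lab z = v)) hS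
  refine ⟨v, _, Finset.filter_subset _ _, fun z hz => (Finset.mem_filter.mp hz).2, ?_⟩
  have : pairMass μ ν G = ∑ v ∈ S, pairMass μ ν (G.filter fun z => lab z = v) :=
    (Finset.sum_fiberwise_of_maps_to hlab _).symm
  rw [this, ← nsmul_eq_mul]
  exact Finset.sum_le_card_nsmul _ _ _ hmax

lemma exists_le_distCount (hμ : ∀ i, 0 < μ i) (hν : ∀ i, 0 ≤ ν i) (hμ1 : ∑ i, μ i ≤ 1)
    (hν1 : ∑ i, ν i ≤ 1) (hD : 1 ≤ D) {ρ g T₀ : ℕ} {l l' θ f₀ c : ℝ}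
    (hsep : ∀ i j, ((2 : ℝ) ^ ρ)⁻¹ ≤ |(q j).2 - (p i).2|)
    (hslope : ∀ i j, |lineSlope (p i) (q j)| ≤ 2)
    (hθ : 0 < θ) (hθ1 : θ ≤ 1) (hl : 0 ≤ l) (hl' : 0 ≤ l') (hg : l ≤ θ * g)
    (hT₀ : 3 / 2 * g + 1 / 2 + l' + l ≤ θ * (((T₀ : ℝ) - 1) / 2)) (hc : 0 < c)
    (hK : 720 * 2 ^ (ρ + 8) * (T + 1) * D ≤ c ^ 2 * 2 ^ (l - 1)) (n : ℕ) :
    ∀ (b : ℕ) (G : Finset (ι × κ)) (Λ : ℝ), b ≤ T → b ≤ T₀ + n * g →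
      (∀ n ≤ T, ∀ z ∈ G, z ∉ badPairs p ν q D n) →
      (∀ z ∈ G, ∀ k k', k ≤ k' → k' ≤ T →
        massExponent μ p z.1 k' ≤ massExponent μ p z.1 k + 2 * (k' - k) + l') →
      (∀ z ∈ G, massExponent μ p z.1 0 ≤ f₀) →
      c * (2 * (T + 1) ^ 2) ^ n ≤ pairMass μ ν G →
      (∀ z ∈ G, profileMax (massExponent μ p z.1) b + θ * b ≤ Λ) →
      ∃ j, (2 : ℝ) ^ (b - Λ - T₀ - f₀) ≤ distCount p q b G j := by
  have base : ∀ (b : ℕ) (G : Finset (ι × κ)) (Λ : ℝ), b ≤ T₀ →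
      (∀ z ∈ G, massExponent μ p z.1 0 ≤ f₀) → 0 < pairMass μ ν G →
      (∀ z ∈ G, profileMax (massExponent μ p z.1) b + θ * b ≤ Λ) →
      ∃ j, (2 : ℝ) ^ (b - Λ - T₀ - f₀) ≤ distCount p q b G j := by
    intro b G Λ hb hf₀ hG hΛ
    have hne : G.Nonempty := by
      rw [Finset.nonempty_iff_ne_empty]
      rintro rfl
      simp [pairMass] at hG
    obtain ⟨⟨i, j⟩, hz⟩ := hne
    refine ⟨j, ?_⟩
    have h1 : (1 : ℝ) ≤ distCount p q b G j := by
      have : 0 < distCount p q b G j := by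
        refine Finset.card_pos.mpr ⟨_, Finset.mem_image_of_mem _ (a := i) ?_⟩
        simpa using hz
      exact_mod_cast this
    refine le_trans (Real.rpow_le_one_of_one_le_of_nonpos (by norm_num) ?_) h1
    have h2 := hΛ _ hz
    have h3 := le_profileMax (massExponent μ p i) (Nat.zero_le b)
    have h4 := hf₀ _ hz
    have h5 : (b : ℝ) ≤ T₀ := by exact_mod_cast hb
    have h6 : (0 : ℝ) ≤ θ * b := by positivity
    have h7 : 0 ≤ massExponent μ p i 0 := by
      rw [massExponent, neg_nonneg]
      refine Real.logb_nonpos (by norm_num) (nearMass_pos hμ 0 i).le ?_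
      refine le_trans (Finset.sum_le_sum fun i' _ => ?_) hμ1
      split_ifs
      exacts [le_rfl, (hμ i').le]
    simp only [Nat.cast_zero] at h3
    dsimp only at h2 h4
    linarith
  induction n with
  | zero =>
    intro b G Λ _ hb _ _ hf₀ hG hΛ
    refine base b G Λ (by omega) hf₀ (lt_of_lt_of_le ?_ hG) hΛ
    positivity
  | succ n ih =>
    intro b G Λ hbT hb hgood htyp hf₀ hG hΛ
    by_cases hbT₀ : b ≤ T₀
    · exact base b G Λ hbT₀ hf₀ (lt_of_lt_of_le (by positivity) hG) hΛ
    have hbr : 3 / 2 * g + 1 / 2 + l' + l ≤ θ * (((b : ℝ) - 1) / 2) := by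
      refine hT₀.trans ?_
      have : (T₀ : ℝ) ≤ b := by exact_mod_cast (by omega : T₀ ≤ b)
      gcongr
    have hsc : ∀ z : ι × κ, ∃ v : ℕ × ℕ, z ∈ G → v.1 ≤ T ∧ v.2 ≤ T ∧ b ≤ 2 * v.1 ∧ v.1 + g ≤ b ∧
        (∀ k, v.1 ≤ k → k ≤ b → massExponent μ p z.1 v.1 - v.1 ≤ massExponent μ p z.1 k - k + v.2) ∧
        profileMax (massExponent μ p z.1) v.1 + θ * v.1 ≤ Λ - v.2 - l + 1 := by
      intro z
      by_cases hz : z ∈ G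
      swap
      · exact ⟨(0, 0), fun h => absurd h hz⟩
      obtain ⟨a, ha1, ha2, e, he0, heb, hek, hM⟩ := exists_scale (massExponent_monotone hμ z.1)
        (fun k k' h1 h2 => htyp z hz k k' h1 (h2.trans hbT)) hθ hθ1 hl hl' hg hbr
      refine ⟨(a, ⌈e⌉₊), fun _ => ⟨by dsimp only; omega, ?_, ha1, ha2, fun k h1 h2 => ?_, ?_⟩⟩
      · exact (Nat.ceil_le.mpr heb).trans hbT
      · exact (hek k h1 h2).trans (by gcongr; exact Nat.le_ceil e)
      · have h1 := (Nat.ceil_lt_add_one he0).le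
        have h2 := hΛ z hz
        dsimp only
        linarith
    choose lab hlab using hsc
    have hcard : ((Finset.range (T + 1) ×ˢ Finset.range (T + 1)).card : ℝ) = (T + 1) ^ 2 := by
      rw [Finset.card_product, Finset.card_range]
      push_cast
      ring
    obtain ⟨⟨a, L⟩, G1, hG1sub, hG1lab, hmass⟩ := exists_label (μ := μ) (ν := ν) (G := G)
      (Finset.range (T + 1) ×ˢ Finset.range (T + 1)) ⟨(0, 0), by simp⟩ lab fun z hz => by
        have := hlab z hz
        rw [Finset.mem_product, Finset.mem_range, Finset.mem_range]
        omega
    rw [hcard] at hmass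
    have hTpos : (0 : ℝ) < (T + 1) ^ 2 := by positivity
    have hmass1 : 2 * (c * (2 * ((T : ℝ) + 1) ^ 2) ^ n) ≤ pairMass μ ν G1 := by
      refine le_of_mul_le_mul_left ?_ hTpos
      refine le_trans (le_of_eq ?_) (hG.trans hmass)
      ring
    have hcn : c ≤ c * (2 * ((T : ℝ) + 1) ^ 2) ^ n := by
      refine le_mul_of_one_le_right hc.le (one_le_pow₀ ?_)
      have : (0 : ℝ) ≤ T := Nat.cast_nonneg T
      nlinarith
    obtain ⟨z₀, hz₀⟩ : G1.Nonempty := by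
      rw [Finset.nonempty_iff_ne_empty]
      rintro h
      rw [h] at hmass1
      simp only [pairMass, Finset.sum_empty] at hmass1
      linarith
    have hz₀' := hlab z₀ (hG1sub hz₀)
    rw [hG1lab z₀ hz₀] at hz₀'
    obtain ⟨-, -, hba, hag, -, -⟩ := hz₀'
    dsimp only at hba hag
    obtain ⟨G', hG'sub, hG'mass, hcount⟩ := exists_refinement (p := p) (q := q) (G := G1) (ρ := ρ)
      (H := (2 : ℝ) ^ L) hμ hν hμ1 hν1 hD (fun n hn z hz => hgood n hn z (hG1sub hz)) hsep hslope
      (show a ≤ b by omega) hba hbT (by positivity) (fun z hz k h1 h2 => by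
        have := hlab z (hG1sub hz)
        rw [hG1lab z hz] at this
        have := this.2.2.2.2.1 k h1 h2
        dsimp only at this
        rw [nearMass_eq_rpow hμ, nearMass_eq_rpow hμ, ← Real.rpow_natCast, ← Real.rpow_natCast,
          ← Real.rpow_natCast, ← Real.rpow_add (by norm_num), ← Real.rpow_add (by norm_num),
          ← Real.rpow_add (by norm_num)]
        refine Real.rpow_le_rpow_of_exponent_le (by norm_num) ?_
        linarith)
      (c := 2 * (c * (2 * ((T : ℝ) + 1) ^ 2) ^ n)) (by positivity) hmass1
    obtain ⟨j, hj⟩ := ih a G' (Λ - L - l + 1) (by omega)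
      (by rw [Nat.succ_mul] at hb; omega)
      (fun n hn z hz => hgood n hn z (hG1sub (hG'sub hz)))
      (fun z hz => htyp z (hG1sub (hG'sub hz))) (fun z hz => hf₀ z (hG1sub (hG'sub hz)))
      (by linarith) (fun z hz => by
        have := hlab z (hG1sub (hG'sub hz))
        rw [hG1lab z (hG'sub hz)] at this
        exact this.2.2.2.2.2)
    refine ⟨j, ?_⟩
    have h1 := hcount j
    have hmono : (distCount p q b G1 j : ℝ) ≤ distCount p q b G j :=
      Nat.cast_le.mpr (distCount_mono hG1sub b j)
    refine le_trans ?_ hmono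
    generalize (distCount p q b G1 j : ℝ) = N at h1 ⊢
    generalize (distCount p q a G' j : ℝ) = N' at h1 hj
    have hc2 : c ^ 2 ≤ (2 * (c * (2 * ((T : ℝ) + 1) ^ 2) ^ n)) ^ 2 := by
      gcongr
      linarith
    have hN' : 0 < N' := lt_of_lt_of_le (by positivity) hj
    have hN : 0 ≤ N := by
      by_contra! h
      have : 0 ≤ 720 * 2 ^ (ρ + 8) * (T + 1) * D * 2 ^ L * 2 ^ a := by positivity
      have h2 : 0 < N' * (2 * (c * (2 * ((T : ℝ) + 1) ^ 2) ^ n)) ^ 2 * 2 ^ b := by positivity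
      nlinarith
    have h2 : N' * c ^ 2 * 2 ^ b ≤ c ^ 2 * 2 ^ (l - 1) * 2 ^ L * 2 ^ a * N := by
      calc N' * c ^ 2 * 2 ^ b ≤ N' * (2 * (c * (2 * ((T : ℝ) + 1) ^ 2) ^ n)) ^ 2 * 2 ^ b := by
            gcongr
        _ ≤ _ := h1
        _ ≤ _ := by gcongr
    have h3 : N' * 2 ^ b ≤ 2 ^ (l - 1) * 2 ^ L * 2 ^ a * N := by
      refine le_of_mul_le_mul_left ?_ (show 0 < c ^ 2 by positivity)
      linarith
    have h4 : (2 : ℝ) ^ ((a : ℝ) - (Λ - L - l + 1) - T₀ - f₀) * 2 ^ b ≤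
        2 ^ (l - 1) * 2 ^ L * 2 ^ a * N := le_trans (by gcongr) h3
    have h5 : (2 : ℝ) ^ ((a : ℝ) - (Λ - L - l + 1) - T₀ - f₀) * 2 ^ b =
        2 ^ (l - 1) * 2 ^ L * 2 ^ a * (2 : ℝ) ^ (b - Λ - T₀ - f₀) := by
      rw [← Real.rpow_natCast, ← Real.rpow_natCast, ← Real.rpow_natCast,
        ← Real.rpow_add (by norm_num), ← Real.rpow_add (by norm_num), ← Real.rpow_add (by norm_num),
        ← Real.rpow_add (by norm_num)]
      congr 1
      ring
    rw [h5] at h4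
    exact le_of_mul_le_mul_left h4 (by positivity)

end multiscale
end

noncomputable section

section typical

open Classical

variable {ι κ : Type*} [Fintype ι] [Fintype κ] {μ : ι → ℝ} {p : ι → ℝ × ℝ} {ν : κ → ℝ}
  {q : κ → ℝ × ℝ} {D : ℝ} {T : ℕ} {G : Finset (ι × κ)}

lemma floor_two_pow_mul_eq (k n : ℕ) (x : ℝ) :
    ⌊(2 : ℝ) ^ k * x⌋ = ⌊(2 : ℝ) ^ (k + n) * x⌋ / 2 ^ n := by
  have h := Int.floor_div_natCast ((2 : ℝ) ^ (k + n) * x) (2 ^ n)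
  push_cast at h
  rw [← h]
  congr 1
  rw [pow_add]
  field_simp

/-- The cell of generation `k` containing a cell of generation `k + n`. -/
def ancestor (n : ℕ) (c : ℤ × ℤ) : ℤ × ℤ := (c.1 / 2 ^ n, c.2 / 2 ^ n)

lemma ancestor_cell (k n : ℕ) (x : ℝ × ℝ) : ancestor n (cell (k + n) x) = cell k x := by
  simp only [ancestor, cell, floor_two_pow_mul_eq k n]

lemma card_ancestor_le (n : ℕ) (E : Finset (ℤ × ℤ)) (d : ℤ × ℤ) :
    (E.filter fun e => ancestor n e = d).card ≤ 4 ^ n := by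
  have hpos : (0 : ℤ) < 2 ^ n := by positivity
  have : E.filter (fun e => ancestor n e = d) ⊆
      Finset.Ico (d.1 * 2 ^ n) ((d.1 + 1) * 2 ^ n) ×ˢ Finset.Ico (d.2 * 2 ^ n) ((d.2 + 1) * 2 ^ n) := by
    intro e he
    rw [Finset.mem_filter] at he
    rw [← he.2, Finset.mem_product, Finset.mem_Ico, Finset.mem_Ico]
    simp only [ancestor]
    refine ⟨⟨?_, ?_⟩, ?_, ?_⟩
    · exact Int.ediv_mul_le _ hpos.ne'
    · exact Int.lt_ediv_add_one_mul_self _ hpos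
    · exact Int.ediv_mul_le _ hpos.ne'
    · exact Int.lt_ediv_add_one_mul_self _ hpos
  refine (Finset.card_le_card this).trans ?_
  rw [Finset.card_product, Int.card_Ico, Int.card_Ico]
  have h : ∀ m : ℤ, ((m + 1) * 2 ^ n - m * 2 ^ n).toNat = 2 ^ n := by
    intro m
    rw [show (m + 1) * 2 ^ n - m * 2 ^ n = ((2 ^ n : ℕ) : ℤ) by push_cast; ring, Int.toNat_natCast]
  rw [h, h, ← mul_pow]
  norm_num

lemma nearMass_nonneg (hμ : ∀ i, 0 ≤ μ i) (k : ℕ) (c : ℤ × ℤ) : 0 ≤ nearMass μ p k c :=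
  Finset.sum_nonneg fun i _ => by split_ifs; exacts [hμ i, le_rfl]

/-- The points around which the mass drops much faster than it could on average carry little
mass. -/
lemma sum_atypical_le (hμ : ∀ i, 0 < μ i) (hμ1 : ∑ i, μ i ≤ 1) (k n : ℕ) (l : ℝ) :
    ∑ i with massExponent μ p i k + 2 * n + l < massExponent μ p i (k + n), μ i ≤
      9 * (2 : ℝ) ^ (-l) := by
  have hμ' := fun i => (hμ i).le
  set R := Finset.univ.filter fun i => massExponent μ p i k + 2 * n + l <
    massExponent μ p i (k + n) with hR
  set E := R.image fun i => cell (k + n) (p i) with hE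
  have h4 : (4 : ℝ) ^ n = 2 ^ (2 * (n : ℝ)) := by
    rw [show (4 : ℝ) = 2 ^ (2 : ℝ) by norm_num, ← Real.rpow_natCast, ← Real.rpow_mul (by norm_num)]
  calc ∑ i ∈ R, μ i = ∑ e ∈ E, ∑ i ∈ R with cell (k + n) (p i) = e, μ i :=
        (Finset.sum_fiberwise_of_maps_to (fun i hi => Finset.mem_image_of_mem _ hi) _).symm
    _ ≤ ∑ e ∈ E, (2 : ℝ) ^ (-(2 * n + l)) * nearMass μ p k (ancestor n e) := by
        refine Finset.sum_le_sum fun e he => ?_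
        obtain ⟨i, hi, rfl⟩ := Finset.mem_image.mp he
        rw [hR, Finset.mem_filter] at hi
        have h1 : ∑ i' ∈ R with cell (k + n) (p i') = cell (k + n) (p i), μ i' ≤
            nearMass μ p (k + n) (cell (k + n) (p i)) := by
          rw [nearMass, ← Finset.sum_filter]
          refine Finset.sum_le_sum_of_subset_of_nonneg ?_ (fun i _ _ => hμ' i)
          intro i' h'
          rw [Finset.mem_filter] at h' ⊢
          refine ⟨Finset.mem_univ _, ?_⟩
          rw [h'.2]
          exact near_self _
        refine h1.trans ?_
        rw [ancestor_cell, nearMass_eq_rpow hμ, nearMass_eq_rpow hμ, ← Real.rpow_add (by norm_num)]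
        refine Real.rpow_le_rpow_of_exponent_le (by norm_num) ?_
        linarith [hi.2]
    _ = (2 : ℝ) ^ (-(2 * n + l)) * ∑ d ∈ E.image (ancestor n), ∑ e ∈ E with ancestor n e = d,
          nearMass μ p k (ancestor n e) := by
        rw [← Finset.mul_sum, Finset.sum_fiberwise_of_maps_to
          (fun i hi => Finset.mem_image_of_mem _ hi)]
    _ ≤ (2 : ℝ) ^ (-(2 * n + l)) * ∑ d ∈ E.image (ancestor n), 4 ^ n * nearMass μ p k d := by
        gcongr with d _
        calc _ = ∑ e ∈ E with ancestor n e = d, nearMass μ p k d :=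
              Finset.sum_congr rfl fun e he => by rw [(Finset.mem_filter.mp he).2]
          _ ≤ _ := by
            rw [Finset.sum_const, nsmul_eq_mul]
            refine mul_le_mul_of_nonneg_right ?_ (nearMass_nonneg hμ' k d)
            exact_mod_cast card_ancestor_le n E d
    _ ≤ (2 : ℝ) ^ (-(2 * n + l)) * (4 ^ n * 9) := by
        rw [← Finset.mul_sum]
        gcongr
        exact sum_nearMass_le hμ' hμ1 k _
    _ = 9 * (2 : ℝ) ^ (-l) := by
        rw [h4, ← mul_assoc, ← Real.rpow_add (by norm_num), mul_comm]
        congr 2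
        ring

lemma le_massExponent {C s : ℝ} (hμ : ∀ i, 0 < μ i) (hμ1 : ∑ i, μ i ≤ 1) (hC : 1 ≤ C)
    (hs : s ≤ 2) (hF : Frost μ p C s T) (i : ι) {k : ℕ} (hk : k ≤ T) :
    s * k - (Real.logb 2 C + 2) ≤ massExponent μ p i k := by
  have hC0 : 0 ≤ Real.logb 2 C := Real.logb_nonneg (by norm_num) hC
  rw [massExponent, le_neg]
  rcases Nat.eq_zero_or_pos k with rfl | hk0
  · refine (Real.logb_nonpos (by norm_num) (nearMass_pos hμ 0 i).le ?_).trans ?_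
    · refine le_trans (Finset.sum_le_sum fun i' _ => ?_) hμ1
      split_ifs
      exacts [le_rfl, (hμ i').le]
    · simp only [Nat.cast_zero]
      linarith
  obtain ⟨m, rfl⟩ : ∃ m, k = m + 1 := ⟨k - 1, by omega⟩
  have h1 : nearMass μ p (m + 1) (cell (m + 1) (p i)) ≤ C * (2 : ℝ) ^ (-(s * m)) := by
    refine le_trans (Finset.sum_le_sum fun i' _ => ?_) (hF m (by omega) i)
    by_cases h : Near (cell (m + 1) (p i)) (cell (m + 1) (p i'))
    swap
    · rw [if_neg h]
      split_ifs
      exacts [(hμ i').le, le_rfl]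
    rw [if_pos h, if_pos]
    have key : ∀ x y : ℝ, |⌊(2 : ℝ) ^ (m + 1) * x⌋ - ⌊(2 : ℝ) ^ (m + 1) * y⌋| ≤ 1 →
        |x - y| ≤ (2 : ℝ) ^ (-(m : ℝ)) := by
      intro x y h
      have h' : |(⌊(2 : ℝ) ^ (m + 1) * x⌋ : ℝ) - ⌊(2 : ℝ) ^ (m + 1) * y⌋| ≤ 1 := by exact_mod_cast h
      have h1 := Int.floor_le ((2 : ℝ) ^ (m + 1) * x)
      have h2 := Int.lt_floor_add_one ((2 : ℝ) ^ (m + 1) * x)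
      have h3 := Int.floor_le ((2 : ℝ) ^ (m + 1) * y)
      have h4 := Int.lt_floor_add_one ((2 : ℝ) ^ (m + 1) * y)
      have hp : (0 : ℝ) < 2 ^ m := by positivity
      rw [Real.rpow_neg (by norm_num), Real.rpow_natCast, ← one_div, le_div_iff₀ hp]
      have habs : |x - y| * 2 ^ m = |(x - y) * 2 ^ m| := by rw [abs_mul, abs_of_pos hp]
      rw [habs, abs_le]
      rw [abs_le] at h'
      rw [pow_succ] at h1 h2 h3 h4 h'
      constructor <;> linarith
    rw [Prod.norm_def, Prod.fst_sub, Prod.snd_sub, Real.norm_eq_abs, Real.norm_eq_abs, max_le_iff]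
    exact ⟨key _ _ h.1, key _ _ h.2⟩
  refine (Real.logb_le_logb_of_le (by norm_num) (nearMass_pos hμ _ i) h1).trans ?_
  rw [Real.logb_mul (by linarith) (by positivity), Real.logb_rpow (by norm_num) (by norm_num)]
  push_cast
  linarith

lemma massExponent_zero_le {f₀ : ℝ} (hμ0 : (2 : ℝ) ^ (-f₀) ≤ ∑ i, μ i)
    (hdp : ∀ i j, ‖p i - p j‖ ≤ 1) (i : ι) : massExponent μ p i 0 ≤ f₀ := by
  have h : nearMass μ p 0 (cell 0 (p i)) = ∑ i, μ i := by
    refine Finset.sum_congr rfl fun i' _ => if_pos ?_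
    have key : ∀ x y : ℝ, |x - y| ≤ 1 → |⌊(2 : ℝ) ^ 0 * x⌋ - ⌊(2 : ℝ) ^ 0 * y⌋| ≤ 1 := by
      intro x y h
      rw [pow_zero, one_mul, one_mul]
      rw [abs_le] at h ⊢
      have h1 := Int.floor_mono (show x ≤ y + 1 by linarith)
      have h2 := Int.floor_mono (show y ≤ x + 1 by linarith)
      rw [Int.floor_add_one] at h1 h2
      omega
    have := hdp i i'
    rw [Prod.norm_def, Prod.fst_sub, Prod.snd_sub, Real.norm_eq_abs, Real.norm_eq_abs,
      max_le_iff] at this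
    exact ⟨key _ _ this.1, key _ _ this.2⟩
  rw [massExponent, h, neg_le, Real.le_logb_iff_rpow_le (by norm_num)]
  · exact hμ0
  · exact lt_of_lt_of_le (by positivity) hμ0

lemma pairMass_le_of_subset_left (hμ : ∀ i, 0 ≤ μ i) (hν : ∀ i, 0 ≤ ν i) (hν1 : ∑ i, ν i ≤ 1)
    (R : Finset ι) (hG : ∀ z ∈ G, z.1 ∈ R) : pairMass μ ν G ≤ ∑ i ∈ R, μ i := by
  rw [pairMass_eq, ← Finset.sum_filter_add_sum_filter_not Finset.univ (· ∈ R)]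
  rw [Finset.sum_eq_zero (s := Finset.univ.filter fun i => i ∉ R), add_zero]
  · rw [Finset.filter_mem_eq_inter, Finset.univ_inter]
    refine Finset.sum_le_sum fun i _ => mul_le_of_le_one_right (hμ i) (le_trans ?_ hν1)
    refine Finset.sum_le_sum fun j _ => ?_
    split_ifs
    exacts [le_rfl, hν j]
  · intro i hi
    rw [Finset.sum_eq_zero, mul_zero]
    intro j _
    rw [if_neg]
    intro h
    exact (Finset.mem_filter.mp hi).2 (hG _ h)

lemma sum_biUnion_le {α β : Type*} [DecidableEq α] {f : α → ℝ} (S : Finset β) (t : β → Finset α)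
    (hf : ∀ i, 0 ≤ f i) : ∑ i ∈ S.biUnion t, f i ≤ ∑ v ∈ S, ∑ i ∈ t v, f i := by
  induction S using Finset.induction_on with
  | empty => simp
  | insert a S ha ih =>
    rw [Finset.biUnion_insert, Finset.sum_insert ha]
    have := Finset.sum_union_inter (s₁ := t a) (s₂ := S.biUnion t) (f := f)
    have h2 := Finset.sum_nonneg (s := t a ∩ S.biUnion t) (f := f) fun i _ => hf i
    linarith

/-- After discarding a small mass of pairs, all the points are typical. -/
lemma exists_typical (hμ : ∀ i, 0 < μ i) (hν : ∀ i, 0 ≤ ν i) (hμ1 : ∑ i, μ i ≤ 1)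
    (hν1 : ∑ i, ν i ≤ 1) (T : ℕ) (l : ℝ) (G : Finset (ι × κ)) :
    ∃ G' ⊆ G, pairMass μ ν G ≤ pairMass μ ν G' + 9 * (T + 1) ^ 2 * (2 : ℝ) ^ (-l) ∧
      ∀ z ∈ G', ∀ k k', k ≤ k' → k' ≤ T →
        massExponent μ p z.1 k' ≤ massExponent μ p z.1 k + 2 * (k' - k) + l := by
  obtain ⟨Q, hQ⟩ : ∃ Q : ι × κ → Prop, Q = fun z =>
      ∀ v ∈ Finset.range (T + 1) ×ˢ Finset.range (T + 1),
        ¬ massExponent μ p z.1 v.1 + 2 * v.2 + l < massExponent μ p z.1 (v.1 + v.2) := ⟨_, rfl⟩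
  refine ⟨G.filter Q, Finset.filter_subset _ _, ?_, ?_⟩
  · rw [← pairMass_filter_add (G := G) Q]
    refine add_le_add le_rfl ?_
    have h1 : ∀ z ∈ G.filter (fun z => ¬ Q z), z.1 ∈ (Finset.range (T + 1) ×ˢ Finset.range (T + 1)).biUnion
        fun v => Finset.univ.filter fun i => massExponent μ p i v.1 + 2 * v.2 + l <
          massExponent μ p i (v.1 + v.2) := by
      intro z hz
      have := (Finset.mem_filter.mp hz).2
      rw [hQ] at this
      push Not at this
      obtain ⟨v, hv, h⟩ := this
      exact Finset.mem_biUnion.mpr ⟨v, hv, Finset.mem_filter.mpr ⟨Finset.mem_univ _, h⟩⟩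
    refine (pairMass_le_of_subset_left (fun i => (hμ i).le) hν hν1 _ h1).trans ?_
    refine (sum_biUnion_le _ _ fun i => (hμ i).le).trans ?_
    refine (Finset.sum_le_card_nsmul _ _ _ fun v _ => sum_atypical_le hμ hμ1 v.1 v.2 l).trans ?_
    rw [Finset.card_product, Finset.card_range, nsmul_eq_mul]
    push_cast
    exact le_of_eq (by ring)
  · intro z hz k k' hk hk'
    have := (Finset.mem_filter.mp hz).2
    rw [hQ] at this
    replace this := this (k, k' - k) (by
      rw [Finset.mem_product, Finset.mem_range, Finset.mem_range]
      dsimp only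
      omega)
    dsimp only at this
    rw [not_lt, Nat.add_sub_cancel' hk, Nat.cast_sub hk] at this
    exact this

end typical
end

noncomputable section

section finite

open Classical Filter

variable {ι κ : Type*} [Fintype ι] [Fintype κ] {μ : ι → ℝ} {p : ι → ℝ × ℝ} {ν : κ → ℝ}
  {q : κ → ℝ × ℝ} {T : ℕ}

lemma Frost.mono {C s s' : ℝ} (h : Frost μ p C s T) (hC : 0 ≤ C) (hs : s' ≤ s) :
    Frost μ p C s' T := by
  intro k hk i
  refine (h k hk i).trans ?_
  gcongr
  norm_num

/-- After discarding a small mass of pairs, no pair is radially bad and all the points are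
typical. -/
lemma exists_good_typical {C s t : ℝ} (hμ : ∀ i, 0 < μ i) (hν : ∀ i, 0 ≤ ν i)
    (hμ1 : ∑ i, μ i ≤ 1) (hν1 : ∑ i, ν i ≤ 1) (hFμ : Frost μ p C s T) (hFν : Frost ν q C t T)
    (hC : 0 ≤ C) (hdp : ∀ i j, ‖p i - p j‖ ≤ 1) (hdq : ∀ i j, ‖q i - q j‖ ≤ 1) (hs : s ≤ 1)
    (ht : t ≤ 2) (hst : 2 ≤ s + t) (k₀ ρ : ℕ)
    (hsep : ∀ i j, ((2 : ℝ) ^ ρ)⁻¹ ≤ |(q j).2 - (p i).2|)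
    (hR : ∀ i j, |(q j).2 - (p i).2| ≤ 2 ^ ρ)
    (hslope : ∀ i j, |lineSlope (p i) (q j)| ≤ 2) (l : ℝ) (G : Finset (ι × κ)) :
    ∃ G' ⊆ G, pairMass μ ν G ≤ pairMass μ ν G' + 9 * (T + 1) ^ 2 * (2 : ℝ) ^ (-l) +
        53760 * 2 ^ ρ * C * (T + 1) ^ 3 * (2 : ℝ) ^ (-(((s + t) / 2 - 1) * k₀)) ∧
      (∀ n ≤ T, ∀ z ∈ G', z ∉ badPairs p ν q (2 ^ (k₀ + ρ + 4)) n) ∧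
      ∀ z ∈ G', ∀ k k', k ≤ k' → k' ≤ T →
        massExponent μ p z.1 k' ≤ massExponent μ p z.1 k + 2 * (k' - k) + l := by
  have hμ' := fun i => (hμ i).le
  set B := (Finset.range (T + 1)).biUnion fun n => badPairs p ν q (2 ^ (k₀ + ρ + 4)) n with hB
  have hBmass : pairMass μ ν B ≤
      53760 * 2 ^ ρ * C * (T + 1) ^ 3 * (2 : ℝ) ^ (-(((s + t) / 2 - 1) * k₀)) := by
    rw [pairMass, hB]
    refine (sum_biUnion_le _ _ fun z : ι × κ => mul_nonneg (hμ' z.1) (hν z.2)).trans ?_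
    refine (Finset.sum_le_card_nsmul _ _ _ fun n hn =>
      mass_badPairs_le hFμ hFν hμ' hν hμ1 hν1 hC hdp hdq hs ht hst k₀ ρ (fun i j h => ?_) hR hslope
        (by rw [Finset.mem_range] at hn; omega)).trans ?_
    · have := hsep i j
      rw [h, abs_zero] at this
      exact absurd this (not_le.mpr (by positivity))
    · rw [Finset.card_range, nsmul_eq_mul]
      push_cast
      have hT : (T : ℝ) ≤ T + 1 := by linarith
      have hpos : (0 : ℝ) ≤ (2 : ℝ) ^ (-(((s + t) / 2 - 1) * k₀)) := by positivity
      calc ((T : ℝ) + 1) * (32 * 2 ^ ρ *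
            (1680 * C * (T + 1) * T * (2 : ℝ) ^ (-(((s + t) / 2 - 1) * k₀)))) ≤
          ((T : ℝ) + 1) * (32 * 2 ^ ρ *
            (1680 * C * (T + 1) * (T + 1) * (2 : ℝ) ^ (-(((s + t) / 2 - 1) * k₀)))) := by gcongr
        _ = _ := by ring
  obtain ⟨G', hG', hmass, htyp⟩ := exists_typical (p := p) hμ hν hμ1 hν1 T l (G \ B)
  refine ⟨G', hG'.trans Finset.sdiff_subset, ?_, fun n hn z hz hzB => ?_, htyp⟩
  · have : pairMass μ ν G ≤ pairMass μ ν (G \ B) + pairMass μ ν B := by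
      have h1 := Finset.sum_inter_add_sum_sdiff G B fun z => μ z.1 * ν z.2
      have h2 : pairMass μ ν (G ∩ B) ≤ pairMass μ ν B :=
        Finset.sum_le_sum_of_subset_of_nonneg Finset.inter_subset_right
          fun z _ _ => mul_nonneg (hμ' z.1) (hν z.2)
      simp only [pairMass] at h2 ⊢
      linarith
    linarith
  · refine (Finset.mem_sdiff.mp (hG' hz)).2 (Finset.mem_biUnion.mpr ⟨n, ?_, hzB⟩)
    rw [Finset.mem_range]
    omega

lemma eventually_le_two_rpow (K : ℝ) (n : ℕ) {δ : ℝ} (hδ : 0 < δ) :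
    ∀ᶠ T : ℕ in atTop, K * ((T : ℝ) + 1) ^ n ≤ (2 : ℝ) ^ (δ * T) := by
  have hb : 0 < δ * Real.log 2 := mul_pos hδ (Real.log_pos (by norm_num))
  have h1 := (isLittleO_pow_exp_pos_mul_atTop (k := n) hb).def
    (c := (|K| + 1)⁻¹ * Real.exp (-(δ * Real.log 2))) (by positivity)
  have h2 : Tendsto (fun T : ℕ => (T : ℝ) + 1) atTop atTop :=
    tendsto_atTop_add_const_right _ _ tendsto_natCast_atTop_atTop
  filter_upwards [h2.eventually h1] with T hT
  rw [Real.norm_of_nonneg (by positivity), Real.norm_of_nonneg (by positivity)] at hT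
  have h3 : (2 : ℝ) ^ (δ * T) = Real.exp (-(δ * Real.log 2)) * Real.exp (δ * Real.log 2 * (T + 1)) := by
    rw [Real.rpow_def_of_pos (by norm_num), ← Real.exp_add]
    congr 1
    ring
  rw [h3]
  have hK : K ≤ |K| + 1 := by linarith [le_abs_self K]
  calc K * ((T : ℝ) + 1) ^ n ≤ (|K| + 1) * ((T : ℝ) + 1) ^ n := by gcongr
    _ ≤ (|K| + 1) * ((|K| + 1)⁻¹ * Real.exp (-(δ * Real.log 2)) *
        Real.exp (δ * Real.log 2 * (T + 1))) := by gcongr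
    _ = _ := by field_simp

end finite

section finite

open Classical Filter

set_option maxHeartbeats 1000000 in
lemma exists_lt_distCount {s s' t u : ℝ} (hs : s ≤ 3 / 2) (hs' : s' ≤ s) (hs1 : s' ≤ 1)
    (ht : t ≤ 2) (hst : 2 < s' + t) (hu : u < 2 / 3 * s) :
    ∃ η : ℝ, 0 < η ∧ ∀ (C C₁ κ₀ f₀ : ℝ) (ρ : ℕ), 1 ≤ C → 0 < κ₀ → ∀ᶠ T : ℕ in atTop,
      ∀ (ι κ : Type) [Fintype ι] [Fintype κ] (μ : ι → ℝ) (p : ι → ℝ × ℝ) (ν : κ → ℝ)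
        (q : κ → ℝ × ℝ) (G : Finset (ι × κ)),
        (∀ i, 0 < μ i) → (∀ j, 0 ≤ ν j) → ∑ i, μ i ≤ 1 → ∑ j, ν j ≤ 1 →
        (2 : ℝ) ^ (-f₀) ≤ ∑ i, μ i → Frost μ p C s T → Frost ν q C t T →
        (∀ i j, ‖p i - p j‖ ≤ 1) → (∀ i j, ‖q i - q j‖ ≤ 1) →
        (∀ i j, ((2 : ℝ) ^ ρ)⁻¹ ≤ |(q j).2 - (p i).2|) →
        (∀ i j, |(q j).2 - (p i).2| ≤ 2 ^ ρ) →
        (∀ i j, |lineSlope (p i) (q j)| ≤ 2) →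
        κ₀ * (2 : ℝ) ^ (-(η * T)) ≤ pairMass μ ν G →
        ∃ j, C₁ * (2 : ℝ) ^ (u * T) < distCount p q T G j := by
  set θ := min ((2 / 3 * s - u) / 4) 1 with hθ
  have hθ0 : 0 < θ := lt_min (by linarith) one_pos
  have hθ1 : θ ≤ 1 := min_le_right _ _
  have hθβ : 4 * θ ≤ 2 / 3 * s - u := by
    have := min_le_left ((2 / 3 * s - u) / 4) 1
    linarith
  clear_value θ
  set ε := θ ^ 3 / 10 with hε
  have hε0 : 0 < ε := by positivity
  set cc := (s' + t) / 2 - 1 with hcc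
  have hcc0 : 0 < cc := by linarith
  set η := min (ε / 16) (cc * ε / 8) with hη
  have hη0 : 0 < η := lt_min (by positivity) (by positivity)
  have hη1 : η ≤ ε / 16 := min_le_left _ _
  have hη2 : η ≤ cc * ε / 8 := min_le_right _ _
  clear_value η
  set n₀ := ⌈θ / ε⌉₊ with hn₀
  refine ⟨η, hη0, fun C C₁ κ₀ f₀ ρ hC hκ₀ => ?_⟩
  set C₂ := 2 / 3 * (Real.logb 2 C + 2) + 4 / θ + 2 + f₀ with hC₂
  filter_upwards [
    eventually_le_two_rpow (2 * (720 * 2 ^ (ρ + 8) * 2 ^ (ρ + 4))) 1 (half_pos hε0),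
    eventually_le_two_rpow (4 / κ₀ * (53760 * 2 ^ ρ * C * 2 ^ cc)) 3
      (show 0 < cc * ε / 8 by positivity),
    eventually_le_two_rpow (4 / κ₀ * 9) 2 (half_pos hε0),
    eventually_le_two_rpow (2 / κ₀ * 2 ^ n₀) (2 * n₀) (show 0 < ε / 16 by positivity),
    eventually_le_two_rpow (2 ^ C₂ * (|C₁| + 1)) 0 (show 0 < 2 * θ by positivity)]
    with T hA hB hBt hM hE
  intro ι κ _ _ μ p ν q G hμ hν hμ1 hν1 hμ0 hFμ hFν hdp hdq hsep hR hslope hG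
  have hrp : ∀ x y : ℝ, (2 : ℝ) ^ x * 2 ^ y = 2 ^ (x + y) := fun x y =>
    (Real.rpow_add (by norm_num) x y).symm
  have hrle : ∀ {x y : ℝ}, x ≤ y → (2 : ℝ) ^ x ≤ 2 ^ y := fun h =>
    Real.rpow_le_rpow_of_exponent_le (by norm_num) h
  have hT0 : (0 : ℝ) ≤ T := Nat.cast_nonneg T
  set l := ε * T with hl
  have hl0 : 0 ≤ l := by positivity
  set k₀ := ⌊l / 4⌋₊ with hk₀
  have hk₀1 : (k₀ : ℝ) ≤ l / 4 := Nat.floor_le (by positivity)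
  have hk₀2 : l / 4 - 1 ≤ k₀ := by linarith [Nat.lt_floor_add_one (l / 4)]
  set g := ⌈l / θ⌉₊ with hg
  have hg1 : l / θ ≤ g := Nat.le_ceil _
  have hg2 : (g : ℝ) ≤ l / θ + 1 := (Nat.ceil_lt_add_one (by positivity)).le
  set T₀ := ⌈2 / θ * (3 / 2 * g + 1 / 2 + l + l) + 1⌉₊ with hT₀
  have hT₀1 : 2 / θ * (3 / 2 * g + 1 / 2 + l + l) + 1 ≤ T₀ := Nat.le_ceil _
  have hT₀2 : (T₀ : ℝ) ≤ 2 / θ * (3 / 2 * g + 1 / 2 + l + l) + 1 + 1 :=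
    (Nat.ceil_lt_add_one (by positivity)).le
  clear_value k₀ g T₀ l n₀ C₂ cc ε
  obtain ⟨G', hG'sub, hG'mass, hgood, htyp⟩ := exists_good_typical hμ hν hμ1 hν1
    (hFμ.mono (by linarith) hs') hFν (by linarith) hdp hdq hs1 ht hst.le k₀ ρ hsep hR hslope l G
  rw [← hcc] at hG'mass
  set c := (2 : ℝ) ^ (-(l / 8)) with hc
  have hc0 : 0 < c := by positivity
  clear_value c
  have hηT : η * T ≤ l / 16 := by rw [hl]; nlinarith
  -- the multiscale hypotheses
  have hK : 720 * 2 ^ (ρ + 8) * ((T : ℝ) + 1) * 2 ^ (k₀ + ρ + 4) ≤ c ^ 2 * 2 ^ (l - 1) := by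
    have h1 : (2 : ℝ) ^ k₀ ≤ 2 ^ (l / 4) := by
      rw [← Real.rpow_natCast]
      exact hrle hk₀1
    have h2 : c ^ 2 * (2 : ℝ) ^ (l - 1) * 2 = 2 ^ (l / 4) * 2 ^ (ε / 2 * T) := by
      rw [hc, sq, hrp, hrp, hrp]
      nth_rw 2 [show (2 : ℝ) = 2 ^ (1 : ℝ) by norm_num]
      rw [hrp]
      congr 1
      rw [hl]
      ring
    rw [pow_one] at hA
    have h3 : 2 * (720 * 2 ^ (ρ + 8) * ((T : ℝ) + 1) * 2 ^ (k₀ + ρ + 4)) ≤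
        2 ^ (l / 4) * 2 ^ (ε / 2 * T) := by
      calc _ = 2 ^ k₀ * (2 * (720 * 2 ^ (ρ + 8) * 2 ^ (ρ + 4)) * ((T : ℝ) + 1)) := by ring
        _ ≤ _ := by gcongr
    linarith
  have hmass : c * (2 * ((T : ℝ) + 1) ^ 2) ^ n₀ ≤ pairMass μ ν G' := by
    have h1 : 9 * ((T : ℝ) + 1) ^ 2 * (2 : ℝ) ^ (-l) ≤ κ₀ / 4 * 2 ^ (-(η * T)) := by
      have h2 : (2 : ℝ) ^ (ε / 2 * T) * 2 ^ (-l) ≤ 2 ^ (-(η * T)) := by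
        rw [hrp]
        exact hrle (by rw [hl] at hηT ⊢; linarith)
      calc _ = κ₀ / 4 * (4 / κ₀ * 9 * ((T : ℝ) + 1) ^ 2 * (2 : ℝ) ^ (-l)) := by field_simp
        _ ≤ κ₀ / 4 * ((2 : ℝ) ^ (ε / 2 * T) * 2 ^ (-l)) := by gcongr
        _ ≤ _ := by gcongr
    have h2 : 53760 * 2 ^ ρ * C * ((T : ℝ) + 1) ^ 3 * (2 : ℝ) ^ (-(cc * k₀)) ≤
        κ₀ / 4 * 2 ^ (-(η * T)) := by
      have h3 : (2 : ℝ) ^ (-(cc * k₀)) ≤ 2 ^ cc * 2 ^ (-(cc * ε / 4 * T)) := by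
        rw [hrp]
        refine hrle ?_
        have := mul_le_mul_of_nonneg_left hk₀2 hcc0.le
        rw [hl] at this
        linarith
      have h4 : (2 : ℝ) ^ (cc * ε / 8 * T) * 2 ^ (-(cc * ε / 4 * T)) ≤ 2 ^ (-(η * T)) := by
        rw [hrp]
        refine hrle ?_
        nlinarith
      calc _ ≤ 53760 * 2 ^ ρ * C * ((T : ℝ) + 1) ^ 3 * (2 ^ cc * 2 ^ (-(cc * ε / 4 * T))) := by
            gcongr
        _ = κ₀ / 4 * (4 / κ₀ * (53760 * 2 ^ ρ * C * 2 ^ cc) * ((T : ℝ) + 1) ^ 3 *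
            2 ^ (-(cc * ε / 4 * T))) := by field_simp
        _ ≤ κ₀ / 4 * ((2 : ℝ) ^ (cc * ε / 8 * T) * 2 ^ (-(cc * ε / 4 * T))) := by gcongr
        _ ≤ _ := by gcongr
    have h3 : c * (2 * ((T : ℝ) + 1) ^ 2) ^ n₀ ≤ κ₀ / 2 * 2 ^ (-(η * T)) := by
      have h4 : (2 : ℝ) ^ (ε / 16 * T) * c ≤ 2 ^ (-(η * T)) := by
        rw [hc, hrp]
        exact hrle (by rw [hl] at hηT ⊢; linarith)
      calc _ = κ₀ / 2 * (2 / κ₀ * 2 ^ n₀ * ((T : ℝ) + 1) ^ (2 * n₀) * c) := by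
            rw [mul_pow, pow_mul]
            field_simp
        _ ≤ κ₀ / 2 * ((2 : ℝ) ^ (ε / 16 * T) * c) := by gcongr
        _ ≤ _ := by gcongr
    linarith
  have hTn : T ≤ T₀ + n₀ * g := by
    have h1 : (T : ℝ) ≤ n₀ * g := by
      calc (T : ℝ) = θ / ε * (l / θ) := by rw [hl]; field_simp
        _ ≤ n₀ * g := by
          gcongr
          rw [hn₀]
          exact Nat.le_ceil _
    have : T ≤ n₀ * g := by exact_mod_cast h1
    omega
  obtain ⟨j, hj⟩ := exists_le_distCount (p := p) (q := q) (D := 2 ^ (k₀ + ρ + 4)) (T := T)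
    (g := g) (T₀ := T₀) (l := l) (l' := l) (θ := θ) (f₀ := f₀) (c := c) hμ hν hμ1 hν1
    (one_le_pow₀ (by norm_num)) hsep hslope hθ0 hθ1 hl0 hl0
    (by rw [div_le_iff₀ hθ0] at hg1; linarith)
    (by
      have h1 : 2 / θ * (3 / 2 * g + 1 / 2 + l + l) ≤ T₀ - 1 := by linarith
      rw [div_mul_eq_mul_div, div_le_iff₀ hθ0] at h1
      linarith) hc0 hK n₀ T G'
    ((1 - 2 / 3 * s) * T + 2 / 3 * (Real.logb 2 C + 2) + θ * T) le_rfl hTn hgood htyp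
    (fun z _ => massExponent_zero_le hμ0 hdp z.1) hmass (fun z _ => by
      obtain ⟨k, hk, h⟩ := exists_profileMax_eq (massExponent μ p z.1) T
      have h1 := le_massExponent hμ hμ1 hC (by linarith) hFμ z.1 hk
      have hk' : (k : ℝ) ≤ T := by exact_mod_cast hk
      have h2 : (1 - 2 / 3 * s) * (k : ℝ) ≤ (1 - 2 / 3 * s) * T :=
        mul_le_mul_of_nonneg_left hk' (by linarith)
      linarith)
  refine ⟨j, lt_of_lt_of_le ?_ (hj.trans (Nat.cast_le.mpr (distCount_mono hG'sub T j)))⟩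
  have hT₀3 : (T₀ : ℝ) ≤ 7 / 10 * θ * T + 4 / θ + 2 := by
    refine hT₀2.trans ?_
    have h1 : 2 / θ * (3 / 2 * g + 1 / 2 + l + l) ≤ 2 / θ * (7 / 2 * (l / θ) + 2) := by
      have h2 : l ≤ l / θ := by
        rw [le_div_iff₀ hθ0]
        exact mul_le_of_le_one_right hl0 hθ1
      exact mul_le_mul_of_nonneg_left (by linarith) (by positivity)
    have h2 : 2 / θ * (7 / 2 * (l / θ) + 2) = 7 / 10 * θ * T + 4 / θ := by
      rw [hl, hε]
      field_simp
      ring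
    linarith
  have hexp : u * T + 2 * θ * T - C₂ ≤
      T - ((1 - 2 / 3 * s) * T + 2 / 3 * (Real.logb 2 C + 2) + θ * T) - T₀ - f₀ := by
    rw [hC₂]
    nlinarith
  refine lt_of_lt_of_le ?_ (hrle hexp)
  have h1 : (2 : ℝ) ^ (u * T + 2 * θ * T - C₂) = 2 ^ (u * T) * (2 ^ (2 * θ * T) * 2 ^ (-C₂)) := by
    rw [hrp, hrp]
    congr 1
    ring
  rw [h1, mul_comm C₁]
  have h2 : |C₁| + 1 ≤ 2 ^ (2 * θ * T) * 2 ^ (-C₂) := by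
    have := mul_le_mul_of_nonneg_right hE (show 0 ≤ (2 : ℝ) ^ (-C₂) by positivity)
    refine le_trans (le_of_eq ?_) this
    rw [pow_zero, mul_one, mul_comm, ← mul_assoc, hrp, neg_add_cancel, Real.rpow_zero, one_mul]
  have h3 : (0 : ℝ) < 2 ^ (u * T) := by positivity
  have h4 := le_abs_self C₁
  exact mul_lt_mul_of_pos_left (by linarith) h3

end finite
end

noncomputable section

section content

open scoped ENNReal

lemma cell_of_cell_succ {k : ℕ} (x : ℝ × ℝ) :
    cell k x = ((cell (k + 1) x).1 / 2, (cell (k + 1) x).2 / 2) := by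
  have h : ∀ u : ℝ, ⌊(2 : ℝ) ^ k * u⌋ = ⌊(2 : ℝ) ^ (k + 1) * u⌋ / 2 := by
    intro u
    rw [show (2 : ℝ) ^ k * u = (2 : ℝ) ^ (k + 1) * u / (2 : ℕ) by push_cast; ring,
      Int.floor_div_natCast]
    norm_num
  simp only [cell, h]

lemma cell_eq_of_le {j k : ℕ} (hjk : j ≤ k) {x y : ℝ × ℝ} (h : cell k x = cell k y) :
    cell j x = cell j y := by
  induction hjk with
  | refl => exact h
  | step _ ih => exact ih (by rw [cell_of_cell_succ, h, ← cell_of_cell_succ])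

/-- The half-open dyadic square with the given generation and index. -/
def box (Q : ℕ × ℤ × ℤ) : Set (ℝ × ℝ) := {x | cell Q.1 x = Q.2}

lemma box_subset_box {Q R : ℕ × ℤ × ℤ} (h : R.1 ≤ Q.1) {x : ℝ × ℝ} (hQ : x ∈ box Q)
    (hR : x ∈ box R) : box Q ⊆ box R := fun _ hy =>
  (cell_eq_of_le h (hy.trans hQ.symm)).trans hR

/-- The weight giving mass `2 ^ (-s k)` to every dyadic square of generation `k`. -/
def cost (s : ℝ) : Measure (ℕ × ℤ × ℤ) :=
  Measure.count.withDensity fun Q => ENNReal.ofReal (2 ^ (-(s * Q.1)))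

/-- The family of squares `𝒰` covers `E`. -/
def Covers (𝒰 : Set (ℕ × ℤ × ℤ)) (E : Set (ℝ × ℝ)) : Prop := ∀ x ∈ E, ∃ Q ∈ 𝒰, x ∈ box Q

/-- The dyadic Hausdorff content, with squares of generation at least `0`. -/
def content (s : ℝ) (E : Set (ℝ × ℝ)) : ℝ≥0∞ := ⨅ (𝒰) (_ : Covers 𝒰 E), cost s 𝒰

lemma content_le {s : ℝ} {E : Set (ℝ × ℝ)} {𝒰 : Set (ℕ × ℤ × ℤ)} (h : Covers 𝒰 E) :
    content s E ≤ cost s 𝒰 := iInf₂_le 𝒰 h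

lemma exists_cover {s : ℝ} {E : Set (ℝ × ℝ)} {κ : ℝ≥0∞} (h : content s E < κ) :
    ∃ 𝒰, Covers 𝒰 E ∧ cost s 𝒰 < κ := by
  simpa [content, iInf_lt_iff] using h

lemma cost_singleton (s : ℝ) (Q : ℕ × ℤ × ℤ) :
    cost s {Q} = ENNReal.ofReal (2 ^ (-(s * Q.1))) := by
  simp [cost, withDensity_apply _ (MeasurableSet.singleton Q)]

lemma cost_eq_tsum (s : ℝ) (𝒰 : Set (ℕ × ℤ × ℤ)) :
    cost s 𝒰 = ∑' Q, 𝒰.indicator (fun Q => ENNReal.ofReal (2 ^ (-(s * Q.1)))) Q := by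
  rw [cost, withDensity_apply _ (.of_discrete), ← lintegral_indicator (.of_discrete),
    lintegral_count]

lemma content_mono {s : ℝ} {E F : Set (ℝ × ℝ)} (h : E ⊆ F) : content s E ≤ content s F :=
  le_iInf₂ fun _ h𝒰 => content_le fun x hx => h𝒰 x (h hx)

lemma content_iUnion_le {ι : Type*} [Countable ι] (s : ℝ) (E : ι → Set (ℝ × ℝ)) :
    content s (⋃ i, E i) ≤ ∑' i, content s (E i) := by
  refine ENNReal.le_of_forall_pos_le_add fun ε hε htop => ?_
  obtain ⟨δ, hδ, hδε⟩ := ENNReal.exists_pos_sum_of_countable (ε := ε)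
    (by exact_mod_cast hε.ne') ι
  have h : ∀ i, ∃ 𝒰, Covers 𝒰 (E i) ∧ cost s 𝒰 < content s (E i) + δ i := fun i =>
    exists_cover (ENNReal.lt_add_right (ENNReal.ne_top_of_tsum_ne_top htop.ne i)
      (by exact_mod_cast (hδ i).ne'))
  choose 𝒰 h𝒰 hc using h
  calc content s (⋃ i, E i) ≤ cost s (⋃ i, 𝒰 i) := content_le fun x hx => by
        obtain ⟨i, hi⟩ := mem_iUnion.mp hx
        obtain ⟨Q, hQ, hxQ⟩ := h𝒰 i x hi
        exact ⟨Q, mem_iUnion.mpr ⟨i, hQ⟩, hxQ⟩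
    _ ≤ ∑' i, cost s (𝒰 i) := measure_iUnion_le _
    _ ≤ ∑' i, (content s (E i) + δ i) := ENNReal.tsum_le_tsum fun i => (hc i).le
    _ ≤ _ := by
        rw [ENNReal.tsum_add]
        gcongr

lemma content_inter_box_le (s : ℝ) (E : Set (ℝ × ℝ)) (Q : ℕ × ℤ × ℤ) :
    content s (E ∩ box Q) ≤ ENNReal.ofReal (2 ^ (-(s * Q.1))) :=
  (content_le (𝒰 := {Q}) fun _ hx => ⟨Q, rfl, hx.2⟩).trans_eq (cost_singleton s Q)

lemma content_empty (s : ℝ) : content s ∅ = 0 :=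
  le_antisymm ((content_le (𝒰 := ∅) fun _ h => h.elim).trans_eq measure_empty) bot_le

/-- `Q` is a strictly smaller dyadic square inside `R`. -/
def Inside (Q R : ℕ × ℤ × ℤ) : Prop := R.1 < Q.1 ∧ box Q ⊆ box R

/-- The maximal squares of a family. -/
def maxi (𝒮 : Set (ℕ × ℤ × ℤ)) : Set (ℕ × ℤ × ℤ) := {Q ∈ 𝒮 | ∀ R ∈ 𝒮, ¬ Inside Q R}

lemma Covers.maxi {𝒮 : Set (ℕ × ℤ × ℤ)} {E : Set (ℝ × ℝ)} (h : Covers 𝒮 E) :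
    Covers (maxi 𝒮) E := by
  classical
  intro x hx
  have hex : ∃ k, ∃ Q ∈ 𝒮, x ∈ box Q ∧ Q.1 = k := by
    obtain ⟨Q, hQ, hxQ⟩ := h x hx
    exact ⟨_, Q, hQ, hxQ, rfl⟩
  obtain ⟨Q, hQ, hxQ, hk⟩ := Nat.find_spec hex
  refine ⟨Q, ⟨hQ, fun R hR hin => ?_⟩, hxQ⟩
  exact Nat.find_min hex (hk ▸ hin.1) ⟨R, hR, hin.2 hxQ, rfl⟩

/-- The exchange step: merging a cover of a larger set into a family covering `E`. -/
lemma cost_maxi_union_add_content_le (s : ℝ) {𝒮 𝒰 : Set (ℕ × ℤ × ℤ)} {E : Set (ℝ × ℝ)}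
    (h𝒮 : Covers 𝒮 E) (h𝒰 : Covers 𝒰 E) :
    cost s (maxi (𝒮 ∪ 𝒰)) + content s E ≤ cost s (maxi 𝒮) + cost s 𝒰 := by
  set P : Set (ℕ × ℤ × ℤ) := {Q | Q ∉ 𝒰 ∧ ∀ R ∈ 𝒰, ¬ Inside Q R} with hP
  set N : Set (ℕ × ℤ × ℤ) := {Q | ∀ R ∈ maxi 𝒮, ¬ Inside Q R} with hN
  have h1 : maxi (𝒮 ∪ 𝒰) ⊆ maxi 𝒮 ∩ P ∪ 𝒰 ∩ N := by
    rintro Q ⟨hQ, hmax⟩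
    by_cases hU : Q ∈ 𝒰
    · exact Or.inr ⟨hU, fun R hR => hmax R (Or.inl hR.1)⟩
    · exact Or.inl ⟨⟨hQ.resolve_right hU, fun R hR => hmax R (Or.inl hR)⟩, hU,
        fun R hR => hmax R (Or.inr hR)⟩
  have h2 : Covers (maxi 𝒮 \ P ∪ 𝒰 \ N) E := by
    intro x hx
    obtain ⟨Q, hQ, hxQ⟩ := h𝒮.maxi x hx
    obtain ⟨R, hR, hxR⟩ := h𝒰 x hx
    rcases lt_trichotomy Q.1 R.1 with h | h | h
    · exact ⟨R, Or.inr ⟨hR, fun hN => hN Q hQ ⟨h, box_subset_box h.le hxR hxQ⟩⟩, hxR⟩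
    · have : Q = R := Prod.ext h (by rw [← show _ = Q.2 from hxQ, ← show _ = R.2 from hxR, h])
      exact ⟨Q, Or.inl ⟨hQ, fun hP => hP.1 (this ▸ hR)⟩, hxQ⟩
    · exact ⟨Q, Or.inl ⟨hQ, fun hP => hP.2 R hR ⟨h, box_subset_box h.le hxQ hxR⟩⟩, hxQ⟩
  calc cost s (maxi (𝒮 ∪ 𝒰)) + content s E
      ≤ (cost s (maxi 𝒮 ∩ P) + cost s (𝒰 ∩ N)) + (cost s (maxi 𝒮 \ P) + cost s (𝒰 \ N)) :=
        add_le_add ((measure_mono h1).trans (measure_union_le _ _))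
          ((content_le h2).trans (measure_union_le _ _))
    _ = (cost s (maxi 𝒮 ∩ P) + cost s (maxi 𝒮 \ P)) + (cost s (𝒰 ∩ N) + cost s (𝒰 \ N)) := by
        ring
    _ = _ := by
        rw [measure_inter_add_sdiff _ .of_discrete, measure_inter_add_sdiff _ .of_discrete]

lemma maxi_subset (𝒮 : Set (ℕ × ℤ × ℤ)) : maxi 𝒮 ⊆ 𝒮 := fun _ h => h.1

/-- Dyadic content is continuous along increasing sequences of arbitrary sets. -/
lemma content_iUnion_le_of_monotone {s : ℝ} {E : ℕ → Set (ℝ × ℝ)} (hE : Monotone E) {κ : ℝ≥0∞}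
    (hκ : ∀ n, content s (E n) ≤ κ) : content s (⋃ n, E n) ≤ κ := by
  rcases eq_or_ne κ ⊤ with rfl | htop
  · exact le_top
  have hfin : ∀ n, content s (E n) ≠ ⊤ := fun n => ne_top_of_le_ne_top htop (hκ n)
  refine ENNReal.le_of_forall_pos_le_add fun ε hε _ => ?_
  obtain ⟨δ, hδ, hδε⟩ := ENNReal.exists_pos_sum_of_countable (ε := ε)
    (by exact_mod_cast hε.ne') ℕ
  have h : ∀ i, ∃ 𝒰, Covers 𝒰 (E i) ∧ cost s 𝒰 < content s (E i) + δ i := fun i =>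
    exists_cover (ENNReal.lt_add_right (hfin i) (by exact_mod_cast (hδ i).ne'))
  choose 𝒰 h𝒰 hc using h
  set 𝒮 : ℕ → Set (ℕ × ℤ × ℤ) := fun n => ⋃ i ≤ n, 𝒰 i with h𝒮
  have hsucc : ∀ n, 𝒮 (n + 1) = 𝒮 n ∪ 𝒰 (n + 1) := by
    intro n
    ext Q
    simp only [h𝒮, mem_iUnion, mem_union, exists_prop]
    constructor
    · rintro ⟨i, hi, hQ⟩
      rcases Nat.lt_or_ge i (n + 1) with h | h
      · exact Or.inl ⟨i, by omega, hQ⟩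
      · exact Or.inr ((show i = n + 1 by omega) ▸ hQ)
    · rintro (⟨i, hi, hQ⟩ | hQ)
      · exact ⟨i, by omega, hQ⟩
      · exact ⟨n + 1, le_rfl, hQ⟩
  have hcov : ∀ n, Covers (𝒮 n) (E n) := fun n x hx => by
    obtain ⟨Q, hQ, h⟩ := h𝒰 n x hx
    exact ⟨Q, mem_iUnion₂.mpr ⟨n, le_rfl, hQ⟩, h⟩
  have hbound : ∀ n, cost s (maxi (𝒮 n)) ≤
      content s (E n) + ∑ i ∈ Finset.range (n + 1), (δ i : ℝ≥0∞) := by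
    intro n
    induction n with
    | zero =>
      have : 𝒮 0 = 𝒰 0 := by simp [h𝒮]
      rw [this]
      simpa using (measure_mono (maxi_subset _)).trans (hc 0).le
    | succ n ih =>
      have h1 := cost_maxi_union_add_content_le s (hcov n)
        (fun x hx => h𝒰 (n + 1) x (hE n.le_succ hx))
      rw [← hsucc] at h1
      refine (ENNReal.add_le_add_iff_right (hfin n)).mp (h1.trans ?_)
      rw [Finset.sum_range_succ _ (n + 1)]
      calc _ ≤ (content s (E n) + ∑ i ∈ Finset.range (n + 1), (δ i : ℝ≥0∞)) +
            (content s (E (n + 1)) + δ (n + 1)) := add_le_add ih (hc _).le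
        _ = _ := by ring
  have hmono : Monotone 𝒮 := monotone_nat_of_le_succ fun n => by
    rw [hsucc]; exact subset_union_left
  set 𝒟 : ℕ → Set (ℕ × ℤ × ℤ) := fun n => ⋂ m ≥ n, maxi (𝒮 m) with h𝒟
  have h𝒟mono : Monotone 𝒟 := fun a b hab =>
    biInter_subset_biInter_left fun m (hm : b ≤ m) => hab.trans hm
  have hcovU : Covers (⋃ n, 𝒮 n) (⋃ n, E n) := fun x hx => by
    obtain ⟨n, hn⟩ := mem_iUnion.mp hx
    obtain ⟨Q, hQ, h⟩ := hcov n x hn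
    exact ⟨Q, mem_iUnion.mpr ⟨n, hQ⟩, h⟩
  have hsub : maxi (⋃ n, 𝒮 n) ⊆ ⋃ n, 𝒟 n := by
    rintro Q ⟨hQ, hmax⟩
    obtain ⟨n, hn⟩ := mem_iUnion.mp hQ
    exact mem_iUnion.mpr ⟨n, mem_iInter₂.mpr fun m hm =>
      ⟨hmono hm hn, fun R hR => hmax R (mem_iUnion.mpr ⟨m, hR⟩)⟩⟩
  calc content s (⋃ n, E n) ≤ cost s (⋃ n, 𝒟 n) :=
        (content_le hcovU.maxi).trans (measure_mono hsub)
    _ = ⨆ n, cost s (𝒟 n) := h𝒟mono.measure_iUnion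
    _ ≤ κ + ε := by
        refine iSup_le fun n => ?_
        calc cost s (𝒟 n) ≤ cost s (maxi (𝒮 n)) :=
              measure_mono (biInter_subset_of_mem (show n ≥ n from le_rfl))
          _ ≤ _ := hbound n
          _ ≤ _ := add_le_add (hκ n) ((ENNReal.sum_le_tsum _).trans hδε.le)

end content
end

noncomputable section

section capacity

open scoped ENNReal NNReal Topology
open Filter

lemma ediam_box_le (Q : ℕ × ℤ × ℤ) : Metric.ediam (box Q) ≤ ENNReal.ofReal ((2 : ℝ) ^ (-(Q.1 : ℝ))) := by
  refine Metric.ediam_le fun x hx y hy => ?_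
  have h : cell Q.1 x = cell Q.1 y := Eq.trans hx (Eq.symm hy)
  rw [cell, cell, Prod.mk.injEq] at h
  rw [edist_dist]
  refine ENNReal.ofReal_le_ofReal ?_
  rw [Real.rpow_neg (by norm_num), Real.rpow_natCast, Prod.dist_eq, Real.dist_eq, Real.dist_eq]
  exact max_le (abs_sub_le_of_floor_eq h.1) (abs_sub_le_of_floor_eq h.2)

/-- A set of zero content has zero Hausdorff measure. -/
lemma hausdorffMeasure_eq_zero_of_content {s : ℝ} (hs : 0 < s) {E : Set (ℝ × ℝ)}
    (h : content s E = 0) : μH[s] E = 0 := by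
  classical
  have h1 : ∀ n : ℕ, ∃ 𝒰, Covers 𝒰 E ∧ cost s 𝒰 < ENNReal.ofReal ((1 / 2 : ℝ) ^ n) := fun n =>
    exists_cover (by rw [h]; positivity)
  choose 𝒰 hcov hcost using h1
  have hr : Tendsto (fun n : ℕ => ENNReal.ofReal ((1 / 2 : ℝ) ^ n)) atTop (𝓝 0) := by
    rw [← ENNReal.ofReal_zero]
    exact ENNReal.tendsto_ofReal (tendsto_pow_atTop_nhds_zero_of_lt_one (by norm_num) (by norm_num))
  have hr' : Tendsto (fun n : ℕ => (ENNReal.ofReal ((1 / 2 : ℝ) ^ n)) ^ s⁻¹) atTop (𝓝 0) := by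
    have := (ENNReal.continuous_rpow_const (y := s⁻¹)).tendsto 0 |>.comp hr
    rwa [ENNReal.zero_rpow_of_pos (by positivity)] at this
  have hbox : ∀ Q : ℕ × ℤ × ℤ, Metric.ediam (box Q) ^ s ≤ ENNReal.ofReal (2 ^ (-(s * Q.1))) := by
    intro Q
    refine (ENNReal.rpow_le_rpow (ediam_box_le Q) hs.le).trans_eq ?_
    rw [ENNReal.ofReal_rpow_of_pos (by positivity), ← Real.rpow_mul (by norm_num)]
    congr 2
    ring
  have key := Measure.hausdorffMeasure_le_liminf_tsum (ι := fun _ : ℕ => ℕ × ℤ × ℤ) s E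
    (fun n : ℕ => (ENNReal.ofReal ((1 / 2 : ℝ) ^ n)) ^ s⁻¹) hr'
    (fun n Q => if Q ∈ 𝒰 n then box Q else ∅)
    (Eventually.of_forall fun n Q => by
      split_ifs with hQ
      · rw [ENNReal.le_rpow_inv_iff hs]
        refine (hbox Q).trans ?_
        rw [← cost_singleton]
        exact (measure_mono (singleton_subset_iff.mpr hQ)).trans (hcost n).le
      · simp)
    (Eventually.of_forall fun n x hx => by
      obtain ⟨Q, hQ, hxQ⟩ := hcov n x hx
      exact mem_iUnion.mpr ⟨Q, by simpa [hQ] using hxQ⟩)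
  refine le_antisymm (key.trans ?_) bot_le
  rw [← hr.liminf_eq]
  refine liminf_le_liminf (Eventually.of_forall fun n => ?_)
  refine le_trans ?_ (hcost n).le
  rw [cost_eq_tsum]
  refine ENNReal.tsum_le_tsum fun Q => ?_
  by_cases hQ : Q ∈ 𝒰 n
  · simpa [hQ] using hbox Q
  · simp [hQ, hs]

lemma content_pos_of_lt_dimH {s : ℝ} (hs : 0 < s) {E : Set (ℝ × ℝ)}
    (h : ENNReal.ofReal s < dimH E) : 0 < content s E := by
  refine pos_iff_ne_zero.mpr fun h0 => ?_
  have h1 := hausdorffMeasure_of_lt_dimH (show ((s.toNNReal : ℝ≥0) : ℝ≥0∞) < dimH E from h)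
  rw [Real.coe_toNNReal _ hs.le, hausdorffMeasure_eq_zero_of_content hs h0] at h1
  exact ENNReal.zero_ne_top h1

/-- The sequences whose first `j` terms are dominated by `b`. -/
def below (b : ℕ → ℕ) (j : ℕ) : Set (ℕ → ℕ) := {α | ∀ i < j, α i ≤ b i}

/-- An open neighbourhood of `∏ [0, b i]` contains one of the sets `below b j`. -/
lemma exists_below_subset (b : ℕ → ℕ) {V : Set (ℕ → ℕ)} (hV : IsOpen V)
    (hKV : (univ.pi fun i => Iic (b i)) ⊆ V) : ∃ j, below b j ⊆ V := by
  have hK : IsCompact (univ.pi fun i => Iic (b i)) :=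
    isCompact_univ_pi fun i => (finite_Iic (b i)).isCompact
  obtain ⟨J, hJ⟩ : ∃ J, ∀ β ∈ univ.pi fun i => Iic (b i), PiNat.cylinder β J ⊆ V := by
    refine hK.induction_on (p := fun S => ∃ J, ∀ β ∈ S, PiNat.cylinder β J ⊆ V) ⟨0, by simp⟩ ?_ ?_ ?_
    · rintro S S' hSS ⟨J, hJ⟩
      exact ⟨J, fun β hβ => hJ β (hSS hβ)⟩
    · rintro S S' ⟨J, hJ⟩ ⟨J', hJ'⟩
      refine ⟨max J J', ?_⟩
      rintro β (hβ | hβ)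
      · exact (PiNat.cylinder_anti β (le_max_left _ _)).trans (hJ β hβ)
      · exact (PiNat.cylinder_anti β (le_max_right _ _)).trans (hJ' β hβ)
    · intro β hβ
      obtain ⟨_, ⟨γ, J, rfl⟩, hβJ, hJV⟩ :=
        (PiNat.isTopologicalBasis_cylinders (fun _ : ℕ => ℕ)).exists_subset_of_mem_open (hKV hβ) hV
      refine ⟨PiNat.cylinder γ J, mem_nhdsWithin_of_mem_nhds
        ((PiNat.isOpen_cylinder _ γ J).mem_nhds hβJ), J, fun β' hβ' => ?_⟩
      rwa [PiNat.mem_cylinder_iff_eq.mp hβ']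
  refine ⟨J, fun α hα => ?_⟩
  refine hJ (fun i => min (α i) (b i)) (fun i _ => mem_Iic.mpr (min_le_right _ _)) ?_
  exact fun i hi => (min_eq_left (hα i hi)).symm

/-- A capacitability statement: a Borel set of positive content contains a decreasing sequence of
sets of content bounded below which behaves like a compact set with respect to open covers. -/
lemma exists_antitone_of_content_pos {s : ℝ} {A : Set (ℝ × ℝ)} (hA : MeasurableSet A)
    (h : 0 < content s A) : ∃ (κ : ℝ≥0∞) (E : ℕ → Set (ℝ × ℝ)), 0 < κ ∧ Antitone E ∧
      (∀ j, E j ⊆ A) ∧ (∀ j, κ ≤ content s (E j)) ∧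
      ∀ U : ℕ → Set (ℝ × ℝ), (∀ i, IsOpen (U i)) → A ⊆ ⋃ i, U i →
        ∃ N j, E j ⊆ ⋃ i < N, U i := by
  have hAn := hA.analyticSet
  rw [AnalyticSet] at hAn
  rcases hAn with rfl | ⟨f, hf, hfA⟩
  · simp [content_empty] at h
  obtain ⟨κ, hκ0, hκ⟩ := exists_between h
  have hbase : ∀ (b : ℕ → ℕ) (j : ℕ), κ < content s (f '' below b j) →
      ∃ n, κ < content s (f '' below (Function.update b j n) (j + 1)) := by
    intro b j hb
    by_contra! hcon
    refine absurd hb (not_lt.mpr ?_)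
    refine le_trans (content_mono ?_) (content_iUnion_le_of_monotone
      (E := fun n => f '' below (Function.update b j n) (j + 1)) ?_ hcon)
    · rintro _ ⟨α, hα, rfl⟩
      refine mem_iUnion.mpr ⟨α j, α, fun i hi => ?_, rfl⟩
      rcases eq_or_ne i j with rfl | hij
      · simp
      · rw [Function.update_of_ne hij]
        exact hα i (by omega)
    · intro n m hnm
      refine image_mono fun α hα i hi => (hα i hi).trans ?_
      exact update_le_update_iff.mpr ⟨hnm, fun _ _ => le_rfl⟩ i
  -- choose the bounds one after the other
  have hex : ∃ b : ℕ → ℕ, ∀ j, κ < content s (f '' below b j) := by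
    choose! n hn using hbase
    let B : ℕ → ℕ → ℕ := fun j => Nat.rec (fun _ => 0) (fun j b => Function.update b j (n b j)) j
    have hB : ∀ j, B (j + 1) = Function.update (B j) j (n (B j) j) := fun j => rfl
    have hBκ : ∀ j, κ < content s (f '' below (B j) j) := by
      intro j
      induction j with
      | zero =>
        have : below (B 0) 0 = univ := by ext; simp [below]
        rwa [this, image_univ, hfA]
      | succ j ih => rw [hB]; exact hn _ _ ih
    have hstab : ∀ i j, i < j → B j i = B (i + 1) i := by
      intro i j hij
      induction hij with
      | refl => rfl
      | @step m hm ih =>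
        rw [hB, Function.update_of_ne (by have : i < m := hm; omega), ih]
    refine ⟨fun i => B (i + 1) i, fun j => ?_⟩
    have : below (fun i => B (i + 1) i) j = below (B j) j := by
      ext α
      exact forall₂_congr fun i hi => by rw [hstab i j hi]
    rw [this]
    exact hBκ j
  obtain ⟨b, hb⟩ := hex
  refine ⟨κ, fun j => f '' below b j, hκ0, fun i j hij => image_mono fun α hα k hk =>
    hα k (hk.trans_le hij), fun j => hfA ▸ image_subset_range _ _, fun j => (hb j).le, ?_⟩
  intro U hU hAU
  have hK : IsCompact (univ.pi fun i => Iic (b i)) :=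
    isCompact_univ_pi fun i => (finite_Iic (b i)).isCompact
  obtain ⟨N, hN⟩ := hK.elim_directed_cover (fun N => f ⁻¹' ⋃ i < N, U i)
    (fun N => (isOpen_biUnion fun i _ => hU i).preimage hf)
    (fun α _ => by
      obtain ⟨i, hi⟩ := mem_iUnion.mp (hAU (hfA ▸ mem_range_self α))
      exact mem_iUnion.mpr ⟨i + 1, mem_iUnion₂.mpr ⟨i, by omega, hi⟩⟩)
    (Monotone.directed_le fun N M hNM => preimage_mono
      (biUnion_subset_biUnion_left fun i (hi : i < N) => hi.trans_le hNM))
  obtain ⟨j, hj⟩ := exists_below_subset b ((isOpen_biUnion fun i _ => hU i).preimage hf) hN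
  exact ⟨N, j, image_subset_iff.mpr hj⟩

end capacity
end

noncomputable section

section flow

open scoped ENNReal NNReal Topology
open Filter

/-- The index of the dyadic square of the previous generation. -/
def parent (a : ℤ × ℤ) : ℤ × ℤ := (a.1 / 2, a.2 / 2)

/-- The indices of the four dyadic squares of the next generation. -/
def children (a : ℤ × ℤ) : Finset (ℤ × ℤ) :=
  {2 * a.1, 2 * a.1 + 1} ×ˢ {2 * a.2, 2 * a.2 + 1}

lemma mem_children {a b : ℤ × ℤ} : b ∈ children a ↔ parent b = a := by
  simp only [children, parent, Finset.mem_product, Finset.mem_insert, Finset.mem_singleton,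
    Prod.ext_iff]
  omega

lemma parent_cell (k : ℕ) (x : ℝ × ℝ) : parent (cell (k + 1) x) = cell k x :=
  (cell_of_cell_succ x).symm

/-- The indices of the descendants after `n` generations. -/
def gen : ℕ → ℤ × ℤ → Finset (ℤ × ℤ)
  | 0, a => {a}
  | n + 1, a => (gen n a).biUnion children

lemma mem_gen {n : ℕ} {a b : ℤ × ℤ} : b ∈ gen n a ↔ parent^[n] b = a := by
  induction n generalizing b with
  | zero => simp [gen]
  | succ n ih => simp [gen, mem_children, ih]

lemma cell_mem_gen (n k : ℕ) (x : ℝ × ℝ) : cell (k + n) x ∈ gen n (cell k x) := by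
  rw [mem_gen]
  induction n with
  | zero => rfl
  | succ n ih => rw [Function.iterate_succ_apply, ← add_assoc, parent_cell, ih]

lemma sum_gen {m : ℕ → ℤ × ℤ → ℝ} (hm : ∀ k a, ∑ b ∈ children a, m (k + 1) b = m k a) (n k : ℕ)
    (a : ℤ × ℤ) : ∑ b ∈ gen n a, m (k + n) b = m k a := by
  induction n with
  | zero => simp [gen]
  | succ n ih =>
    rw [gen, Finset.sum_biUnion, ← ih]
    · exact Finset.sum_congr rfl fun b _ => hm (k + n) b
    · intro b _ c _ hbc
      refine Finset.disjoint_left.mpr fun d hd hd' => hbc ?_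
      rw [mem_children] at hd hd'
      exact hd'.symm.trans hd |>.symm

/-- The normalised mass flow down the dyadic tree associated with capacities `c`. -/
def treeFlow (c : ℕ → ℤ × ℤ → ℝ) : ℕ → ℤ × ℤ → ℝ
  | 0, a => c 0 a
  | k + 1, b => treeFlow c k (parent b) * c (k + 1) b / ∑ b' ∈ children (parent b), c (k + 1) b'

lemma treeFlow_bounds {c : ℕ → ℤ × ℤ → ℝ} (hc : ∀ k a, 0 ≤ c k a)
    (hsub : ∀ k a, c k a ≤ ∑ b ∈ children a, c (k + 1) b) (k : ℕ) (a : ℤ × ℤ) :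
    0 ≤ treeFlow c k a ∧ treeFlow c k a ≤ c k a := by
  induction k generalizing a with
  | zero => exact ⟨hc 0 a, le_rfl⟩
  | succ k ih =>
    obtain ⟨h1, h2⟩ := ih (parent a)
    have h3 := h2.trans (hsub k (parent a))
    have h4 := Finset.sum_nonneg fun b (_ : b ∈ children (parent a)) => hc (k + 1) b
    refine ⟨div_nonneg (mul_nonneg h1 (hc _ _)) h4, ?_⟩
    rw [treeFlow, mul_div_assoc, mul_comm, div_mul_eq_mul_div]
    exact div_le_of_le_mul₀ h4 (hc _ _) (mul_le_mul_of_nonneg_left h3 (hc _ _))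

lemma sum_treeFlow {c : ℕ → ℤ × ℤ → ℝ} (hc : ∀ k a, 0 ≤ c k a)
    (hsub : ∀ k a, c k a ≤ ∑ b ∈ children a, c (k + 1) b) (k : ℕ) (a : ℤ × ℤ) :
    ∑ b ∈ children a, treeFlow c (k + 1) b = treeFlow c k a := by
  have h1 : ∀ b ∈ children a, treeFlow c (k + 1) b =
      treeFlow c k a / (∑ b' ∈ children a, c (k + 1) b') * c (k + 1) b := by
    intro b hb
    rw [treeFlow, mem_children.mp hb]
    ring
  rw [Finset.sum_congr rfl h1, ← Finset.mul_sum]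
  rcases eq_or_ne (∑ b' ∈ children a, c (k + 1) b') 0 with h | h
  · have := treeFlow_bounds hc hsub k a
    have h2 := hsub k a
    rw [h] at h2
    rw [h, mul_zero]
    linarith
  · rw [div_mul_cancel₀ _ h]

lemma content_inter_box_le_sum (s : ℝ) (E : Set (ℝ × ℝ)) (k : ℕ) (a : ℤ × ℤ) :
    content s (E ∩ box (k, a)) ≤ ∑ b ∈ children a, content s (E ∩ box (k + 1, b)) := by
  rw [← Finset.sum_coe_sort, ← tsum_fintype (L := .unconditional _)]
  refine (content_mono ?_).trans (content_iUnion_le s _)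
  rintro x ⟨hx, hxa⟩
  refine mem_iUnion.mpr ⟨⟨cell (k + 1) x, ?_⟩, hx, rfl⟩
  rw [mem_children, parent_cell]
  exact hxa

/-- Frostman's lemma for a decreasing sequence of sets, in terms of masses of dyadic squares. -/
lemma exists_flow {s : ℝ} {E : ℕ → Set (ℝ × ℝ)} (hE : Antitone E) {r : ℤ × ℤ}
    (hr : E 0 ⊆ box (0, r)) {κ : ℝ≥0∞} (hκ : ∀ j, κ ≤ content s (E j)) :
    ∃ m : ℕ → ℤ × ℤ → ℝ, (∀ k a, 0 ≤ m k a) ∧ (∀ k a, m k a ≤ 2 ^ (-(s * k))) ∧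
      (∀ k a, ∑ b ∈ children a, m (k + 1) b = m k a) ∧ κ.toReal ≤ m 0 r ∧
      ∀ k a, 0 < m k a → ∀ j, (E j ∩ box (k, a)).Nonempty := by
  set ℓ : ℕ → ℤ × ℤ → ℝ≥0∞ := fun k a => ⨅ j, content s (E j ∩ box (k, a)) with hℓ
  have hle : ∀ k a, ℓ k a ≤ ENNReal.ofReal (2 ^ (-(s * k))) := fun k a =>
    (iInf_le _ 0).trans (content_inter_box_le s (E 0) (k, a))
  have hfin : ∀ k a, ℓ k a ≠ ⊤ := fun k a => ne_top_of_le_ne_top ENNReal.ofReal_ne_top (hle k a)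
  have hlim : ∀ k a, Tendsto (fun j => content s (E j ∩ box (k, a))) atTop (𝓝 (ℓ k a)) :=
    fun k a => tendsto_atTop_iInf fun i j hij => content_mono (inter_subset_inter_left _ (hE hij))
  have hsub : ∀ k a, ℓ k a ≤ ∑ b ∈ children a, ℓ (k + 1) b := fun k a =>
    le_of_tendsto_of_tendsto' (hlim k a) (tendsto_finsetSum _ fun b _ => hlim (k + 1) b)
      fun j => content_inter_box_le_sum s (E j) k a
  have hc : ∀ k a, 0 ≤ (ℓ k a).toReal := fun _ _ => ENNReal.toReal_nonneg
  have hsub' : ∀ k a, (ℓ k a).toReal ≤ ∑ b ∈ children a, (ℓ (k + 1) b).toReal := by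
    intro k a
    rw [← ENNReal.toReal_sum fun b _ => hfin _ b]
    exact ENNReal.toReal_mono (ENNReal.sum_ne_top.mpr fun b _ => hfin _ b) (hsub k a)
  refine ⟨treeFlow fun k a => (ℓ k a).toReal, fun k a => (treeFlow_bounds hc hsub' k a).1,
    fun k a => (treeFlow_bounds hc hsub' k a).2.trans
      (ENNReal.toReal_le_of_le_ofReal (by positivity) (hle k a)),
    sum_treeFlow hc hsub', ?_, fun k a hk j => ?_⟩
  · refine ENNReal.toReal_mono (hfin 0 r) (le_iInf fun j => ?_)
    rw [inter_eq_left.mpr ((hE (Nat.zero_le j)).trans hr)]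
    exact hκ j
  · by_contra hne
    rw [not_nonempty_iff_eq_empty] at hne
    have h1 : ℓ k a = 0 := le_antisymm ((iInf_le _ j).trans (by rw [hne, content_empty])) bot_le
    have h2 := (treeFlow_bounds hc hsub' k a).2
    simp only [h1, ENNReal.toReal_zero] at h2
    linarith

lemma frost_of_flow {m : ℕ → ℤ × ℤ → ℝ} {t : ℝ} (h0 : ∀ k a, 0 ≤ m k a)
    (hle : ∀ k a, m k a ≤ 2 ^ (-(t * k)))
    (hm : ∀ k a, ∑ b ∈ children a, m (k + 1) b = m k a) (T : ℕ) (S : Finset (ℤ × ℤ))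
    {p : S → ℝ × ℝ} (hp : ∀ i, cell T (p i) = i) : Frost (fun i : S => m T i) p 9 t T := by
  intro k hk i
  set c := cell k (p i) with hc
  set N := Finset.Icc (c.1 - 1) (c.1 + 1) ×ˢ Finset.Icc (c.2 - 1) (c.2 + 1) with hN
  have hcard : N.card = 9 := by
    rw [hN, Finset.card_product, Int.card_Icc, Int.card_Icc]
    have h1 : ∀ z : ℤ, (z + 1 + 1 - (z - 1)).toNat = 3 := fun z => by omega
    rw [h1, h1]
  have hcell : ∀ a, ∑ j : S, (if cell k (p j) = a then m T j else 0) ≤ m k a := by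
    intro a
    obtain ⟨n, rfl⟩ := Nat.exists_eq_add_of_le hk
    calc ∑ j : S, (if cell k (p j) = a then m (k + n) j else 0)
        ≤ ∑ j : S, (if (j : ℤ × ℤ) ∈ gen n a then m (k + n) j else 0) := by
          refine Finset.sum_le_sum fun j _ => ?_
          by_cases hj : cell k (p j) = a
          · rw [if_pos hj, if_pos (by rw [← hj, ← hp j]; exact cell_mem_gen n k (p j))]
          · rw [if_neg hj]
            split_ifs
            exacts [h0 _ _, le_rfl]
      _ = ∑ b ∈ S, (if b ∈ gen n a then m (k + n) b else 0) :=
          Finset.sum_coe_sort S fun b => if b ∈ gen n a then m (k + n) b else 0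
      _ ≤ ∑ b ∈ gen n a, m (k + n) b := by
          rw [← Finset.sum_filter]
          exact Finset.sum_le_sum_of_subset_of_nonneg (fun b hb => (Finset.mem_filter.mp hb).2)
            fun b _ _ => h0 _ b
      _ = m k a := sum_gen hm n k a
  calc ∑ j : S, (if ‖p i - p j‖ ≤ (2 : ℝ) ^ (-(k : ℝ)) then m T j else 0)
      ≤ ∑ j : S, ∑ a ∈ N, if cell k (p j) = a then m T j else 0 := by
        refine Finset.sum_le_sum fun j _ => ?_
        rw [Finset.sum_ite_eq]
        by_cases hd : ‖p i - p j‖ ≤ (2 : ℝ) ^ (-(k : ℝ))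
        · rw [if_pos hd, if_pos]
          have hnear : Near (cell k (p i)) (cell k (p j)) := by
            by_contra hn
            have := lt_norm_of_not_near hn
            rw [Real.rpow_neg (by norm_num), Real.rpow_natCast] at hd
            linarith
          obtain ⟨h1, h2⟩ := hnear
          rw [← hc, abs_le] at h1 h2
          simp only [hN, Finset.mem_product, Finset.mem_Icc]
          omega
        · rw [if_neg hd]
          split_ifs
          · exact h0 _ _
          · exact le_rfl
    _ = ∑ a ∈ N, ∑ j : S, if cell k (p j) = a then m T j else 0 := Finset.sum_comm
    _ ≤ ∑ a ∈ N, (2 : ℝ) ^ (-(t * k)) :=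
        Finset.sum_le_sum fun a _ => (hcell a).trans (hle k a)
    _ = _ := by rw [Finset.sum_const, hcard, nsmul_eq_mul]; norm_num

end flow
end

noncomputable section

section pinned

open scoped ENNReal NNReal Topology
open Filter

lemma exists_dyadic_interval {u : ℝ} (hu : 0 < u) (k₀ : ℕ) {t : Set ℝ}
    (ht : Metric.ediam t ≤ ENNReal.ofReal ((1 / 2) ^ k₀)) {δ : ℝ} (hδ : 0 < δ) :
    ∃ k : ℕ, k₀ ≤ k ∧ ∃ z : ℝ, (∀ x ∈ t, |x - z| ≤ (1 / 2) ^ k) ∧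
      ENNReal.ofReal (2 ^ (-(u * k))) ≤
        ENNReal.ofReal (2 ^ u) * (⨆ _ : t.Nonempty, Metric.ediam t ^ u) + ENNReal.ofReal δ := by
  have hfin : Metric.ediam t ≠ ⊤ := ne_top_of_le_ne_top ENNReal.ofReal_ne_top ht
  set d := (Metric.ediam t).toReal with hd
  have hdk : d ≤ (1 / 2) ^ k₀ := ENNReal.toReal_le_of_le_ofReal (by positivity) ht
  have hdist : ∀ x ∈ t, ∀ y ∈ t, |x - y| ≤ d := by
    intro x hx y hy
    rw [← Real.dist_eq, dist_edist]
    exact ENNReal.toReal_mono hfin (Metric.edist_le_ediam_of_mem hx hy)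
  by_cases hd0 : 0 < d
  · obtain ⟨k, hk1, hk2⟩ := exists_nat_pow_near_of_lt_one hd0
      (hdk.trans (pow_le_one₀ (by norm_num) (by norm_num))) (show (0 : ℝ) < 1 / 2 by norm_num)
      (by norm_num)
    have hne : t.Nonempty := by
      by_contra hne
      rw [not_nonempty_iff_eq_empty] at hne
      simp [hd, hne] at hd0
    refine ⟨k, ?_, hne.some, fun x hx => (hdist x hx _ hne.some_mem).trans hk2, ?_⟩
    · by_contra! hlt
      have := pow_le_pow_of_le_one (show (0 : ℝ) ≤ 1 / 2 by norm_num) (by norm_num)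
        (show k + 1 ≤ k₀ by omega)
      linarith
    · refine le_add_right ?_
      rw [iSup_pos hne, ← ENNReal.ofReal_toReal hfin, ← hd, ENNReal.ofReal_rpow_of_pos hd0,
        ← ENNReal.ofReal_mul (by positivity)]
      refine ENNReal.ofReal_le_ofReal ?_
      calc (2 : ℝ) ^ (-(u * k)) = 2 ^ u * ((1 / 2) ^ (k + 1)) ^ u := by
            rw [one_div, inv_pow, ← Real.rpow_natCast, ← Real.rpow_neg (by norm_num),
              ← Real.rpow_mul (by norm_num), ← Real.rpow_add (by norm_num)]
            congr 1
            push_cast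
            ring
        _ ≤ 2 ^ u * d ^ u := by gcongr
  · have h1 : Tendsto (fun k : ℕ => (2 : ℝ) ^ (-(u * k))) atTop (𝓝 0) := by
      refine (tendsto_rpow_atBot_of_base_gt_one 2 (by norm_num)).comp ?_
      exact tendsto_neg_atTop_atBot.comp (tendsto_natCast_atTop_atTop.const_mul_atTop hu)
    obtain ⟨k, hk, hkk⟩ := ((h1.eventually (gt_mem_nhds hδ)).and (eventually_ge_atTop k₀)).exists
    have hz : ∃ z : ℝ, ∀ x ∈ t, |x - z| ≤ (1 / 2) ^ k := by
      by_cases hne : t.Nonempty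
      · exact ⟨hne.some, fun x hx => (hdist x hx _ hne.some_mem).trans
          ((not_lt.mp hd0).trans (by positivity))⟩
      · exact ⟨0, fun x hx => (hne ⟨x, hx⟩).elim⟩
    exact ⟨k, hkk, hz.choose, hz.choose_spec,
      le_add_left (ENNReal.ofReal_le_ofReal hk.le)⟩

/-- A set of dimension less than `u` has efficient covers by small dyadic intervals. -/
lemma exists_cover_of_dimH_lt {u : ℝ} (hu : 0 < u) {D : Set ℝ} (hD : dimH D < ENNReal.ofReal u)
    (k₀ : ℕ) : ∃ (k : ℕ → ℕ) (z : ℕ → ℝ), (∀ i, k₀ ≤ k i) ∧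
      (∀ x ∈ D, ∃ i, |x - z i| ≤ (1 / 2) ^ k i) ∧
      ∀ F : Finset ℕ, ∑ i ∈ F, (2 : ℝ) ^ (-(u * k i)) ≤ 1 := by
  have h1 := hausdorffMeasure_of_dimH_lt (show dimH D < ((u.toNNReal : ℝ≥0) : ℝ≥0∞) from hD)
  rw [Real.coe_toNNReal _ hu.le, Measure.hausdorffMeasure_apply] at h1
  have hc0 : (0 : ℝ) < 2 ^ (-u) / 2 := by positivity
  have h2 := (iSup₂_le_iff.mp h1.le) (ENNReal.ofReal ((1 / 2) ^ k₀)) (by positivity)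
  have h3 := h2.trans_lt (ENNReal.ofReal_pos.mpr hc0)
  simp only [iInf_lt_iff] at h3
  obtain ⟨t, htD, htd, hts⟩ := h3
  obtain ⟨δ, hδ, hδs⟩ : ∃ δ : ℕ → ℝ, (∀ i, 0 < δ i) ∧
      ∑' i, ENNReal.ofReal (δ i) ≤ ENNReal.ofReal (1 / 2) := by
    obtain ⟨δ, hδ, c, hc, hcle⟩ := posSumOfEncodable (show (0 : ℝ) < 1 / 2 by norm_num) ℕ
    refine ⟨δ, hδ, ?_⟩
    rw [← ENNReal.ofReal_tsum_of_nonneg (fun i => (hδ i).le) hc.summable, hc.tsum_eq]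
    exact ENNReal.ofReal_le_ofReal hcle
  have h4 := fun i => exists_dyadic_interval hu k₀ (htd i) (hδ i)
  choose k hk z hz hle using h4
  refine ⟨k, z, hk, fun x hx => ?_, fun F => ?_⟩
  · obtain ⟨i, hi⟩ := mem_iUnion.mp (htD hx)
    exact ⟨i, hz i x hi⟩
  · rw [← ENNReal.ofReal_le_ofReal_iff zero_le_one,
      ENNReal.ofReal_sum_of_nonneg fun i _ => by positivity]
    calc _ ≤ ∑' i, ENNReal.ofReal (2 ^ (-(u * k i))) := ENNReal.sum_le_tsum F
      _ ≤ ∑' i, (ENNReal.ofReal (2 ^ u) * (⨆ _ : (t i).Nonempty, Metric.ediam (t i) ^ u) +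
          ENNReal.ofReal (δ i)) := ENNReal.tsum_le_tsum hle
      _ ≤ ENNReal.ofReal (2 ^ u) * ENNReal.ofReal (2 ^ (-u) / 2) + ENNReal.ofReal (1 / 2) := by
          rw [ENNReal.tsum_add, ENNReal.tsum_mul_left]
          gcongr
      _ = ENNReal.ofReal 1 := by
          rw [← ENNReal.ofReal_mul (by positivity), ← ENNReal.ofReal_add (by positivity)
            (by norm_num), ← mul_div_assoc, ← Real.rpow_add (by norm_num)]
          norm_num

lemma continuous_edst (y : ℝ × ℝ) : Continuous fun x => edst x y := by
  have : (fun x => edst x y) = fun x : ℝ × ℝ => √((x.1 - y.1) ^ 2 + (x.2 - y.2) ^ 2) := by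
    ext x
    rw [← edst_sq, Real.sqrt_sq (edst_nonneg x y)]
  rw [this]
  fun_prop

/-- The square of generation `k` with index `a` contains a point of `A` whose distance to `y` is
close to a point of `Z`. -/
def Hits (A : Set (ℝ × ℝ)) (y : ℝ × ℝ) (k : ℕ) (Z : Finset ℝ) (a : ℤ × ℤ) : Prop :=
  ∃ x ∈ A, cell k x = a ∧ ∃ z ∈ Z, |edst x y - z| < 2 * (1 / 2) ^ k

open Classical in
/-- If the pinned distance set at `y` is small, then at some fine scale a substantial part of the
mass on `A` is seen at few distances from `y`. -/
lemma exists_scale_hits {u : ℝ} (hu : 0 < u) {A : Set (ℝ × ℝ)} {r : ℤ × ℤ} (hr : A ⊆ box (0, r))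
    {E : ℕ → Set (ℝ × ℝ)} (hEA : ∀ j, E j ⊆ A)
    (hcpt : ∀ U : ℕ → Set (ℝ × ℝ), (∀ i, IsOpen (U i)) → A ⊆ ⋃ i, U i →
        ∃ N j, E j ⊆ ⋃ i < N, U i)
    {m : ℕ → ℤ × ℤ → ℝ} (h0 : ∀ k a, 0 ≤ m k a)
    (hm : ∀ k a, ∑ b ∈ children a, m (k + 1) b = m k a) (hm0 : 0 < m 0 r)
    (hne : ∀ k a, 0 < m k a → ∀ j, (E j ∩ box (k, a)).Nonempty) {y : ℝ × ℝ}
    (hy : dimH ((fun x => edst x y) '' A) < ENNReal.ofReal u) {R : ℝ} (hR0 : 0 < R) (hR1 : R < 1)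
    (k₀ : ℕ) : ∃ k, k₀ ≤ k ∧ ∃ Z : Finset ℝ, (Z.card : ℝ) ≤ 2 ^ (u * k) ∧
      m 0 r * (1 - R) / 2 * R ^ k ≤ ∑ a ∈ (gen k r).filter (Hits A y k Z), m k a := by
  obtain ⟨k, z, hk, hcov, hsum⟩ := exists_cover_of_dimH_lt hu hy k₀
  obtain ⟨N, j, hNj⟩ := hcpt (fun i => {x | |edst x y - z i| < 2 * (1 / 2) ^ k i})
    (fun i => isOpen_lt (by have := continuous_edst y; fun_prop) continuous_const) (fun x hx => by
      obtain ⟨i, hi⟩ := hcov _ (mem_image_of_mem _ hx)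
      have : (0 : ℝ) < (1 / 2) ^ k i := by positivity
      exact mem_iUnion.mpr ⟨i, lt_of_le_of_lt hi (by linarith)⟩)
  set Z : ℕ → Finset ℝ := fun n => ((Finset.range N).filter (k · = n)).image z with hZ
  have hcard : ∀ n, ((Z n).card : ℝ) ≤ 2 ^ (u * n) := by
    intro n
    have h1 := hsum ((Finset.range N).filter (k · = n))
    rw [Finset.sum_congr rfl (g := fun _ => (2 : ℝ) ^ (-(u * n)))
      fun i hi => by rw [(Finset.mem_filter.mp hi).2], Finset.sum_const, nsmul_eq_mul,
      Real.rpow_neg (by norm_num), ← div_eq_mul_inv, div_le_one (by positivity)] at h1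
    exact le_trans (Nat.cast_le.mpr Finset.card_image_le) h1
  by_contra! hcon
  set c := m 0 r * (1 - R) / 2 with hc
  have hc0 : 0 < c := by
    have : 0 < 1 - R := by linarith
    positivity
  have hsmall : ∀ n, ∑ a ∈ (gen n r).filter (Hits A y n (Z n)), m n a ≤ c * R ^ n := by
    intro n
    rcases le_or_gt k₀ n with h | h
    · exact (hcon n h (Z n) (hcard n)).le
    · have hempty : Z n = ∅ := by
        rw [hZ]
        simp only [Finset.image_eq_empty, Finset.filter_eq_empty_iff]
        intro i _ hi
        have := hk i
        omega
      rw [Finset.sum_eq_zero]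
      · positivity
      · intro a ha
        obtain ⟨_, _, _, z, hz, _⟩ := (Finset.mem_filter.mp ha).2
        simp [hempty] at hz
  set K := (Finset.range N).sup k with hK
  have hmain : m 0 r ≤ ∑ n ∈ Finset.range (K + 1), c * R ^ n := by
    calc m 0 r = ∑ b ∈ gen K r, m K b := by
          rw [← sum_gen hm K 0 r, zero_add]
      _ = ∑ b ∈ (gen K r).filter (0 < m K ·), m K b := by
          refine (Finset.sum_filter_of_ne fun b _ hb => ?_).symm
          exact lt_of_le_of_ne (h0 K b) (Ne.symm hb)
      _ ≤ ∑ b ∈ (Finset.range (K + 1)).biUnion fun n =>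
            ((gen n r).filter (Hits A y n (Z n))).biUnion (gen (K - n)), m K b := by
          refine Finset.sum_le_sum_of_subset_of_nonneg (fun b hb => ?_) fun b _ _ => h0 K b
          obtain ⟨x, hxE, hxb⟩ := hne K b (Finset.mem_filter.mp hb).2 j
          obtain ⟨i, hi, hxi⟩ := mem_iUnion₂.mp (hNj hxE)
          have hiK : k i ≤ K := Finset.le_sup (Finset.mem_range.mpr hi)
          have hxA := hEA j hxE
          refine Finset.mem_biUnion.mpr ⟨k i, Finset.mem_range.mpr (by omega),
            Finset.mem_biUnion.mpr ⟨cell (k i) x, Finset.mem_filter.mpr ⟨?_, x, hxA, rfl, z i,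
              ?_, hxi⟩, ?_⟩⟩
          · have := cell_mem_gen (k i) 0 x
            rwa [zero_add, show cell 0 x = r from hr hxA] at this
          · exact Finset.mem_image_of_mem _ (Finset.mem_filter.mpr ⟨Finset.mem_range.mpr hi, rfl⟩)
          · have := cell_mem_gen (K - k i) (k i) x
            rwa [Nat.add_sub_cancel' hiK, show cell K x = b from hxb] at this
      _ ≤ ∑ n ∈ Finset.range (K + 1), ∑ a ∈ (gen n r).filter (Hits A y n (Z n)),
            ∑ b ∈ gen (K - n) a, m K b := by
          refine (sum_biUnion_le _ _ (h0 K)).trans (Finset.sum_le_sum fun n _ => ?_)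
          exact sum_biUnion_le _ _ (h0 K)
      _ ≤ _ := by
          refine Finset.sum_le_sum fun n hn => le_trans (le_of_eq ?_) (hsmall n)
          refine Finset.sum_congr rfl fun a _ => ?_
          have := sum_gen hm (K - n) n a
          rwa [Nat.add_sub_cancel' (by have := Finset.mem_range.mp hn; omega)] at this
  have hgeom : ∑ n ∈ Finset.range (K + 1), c * R ^ n ≤ m 0 r / 2 := by
    have h1 : ∑ n ∈ Finset.range (K + 1), R ^ n ≤ (1 - R)⁻¹ := by
      rw [← tsum_geometric_of_lt_one hR0.le hR1]
      exact (summable_geometric_of_lt_one hR0.le hR1).sum_le_tsum _ fun n _ => by positivity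
    rw [← Finset.mul_sum]
    calc _ ≤ c * (1 - R)⁻¹ := by gcongr
      _ = _ := by
        have : 1 - R ≠ 0 := by linarith
        rw [hc]
        field_simp
  linarith

end pinned
end

noncomputable section

section separated

open scoped ENNReal NNReal Topology
open Filter

lemma norm_sub_le_one_of_box {r : ℤ × ℤ} {x y : ℝ × ℝ} (hx : x ∈ box (0, r)) (hy : y ∈ box (0, r)) :
    ‖x - y‖ ≤ 1 := by
  have h : cell 0 x = cell 0 y := Eq.trans hx (Eq.symm hy)
  rw [cell, cell, Prod.mk.injEq] at h
  have h1 := abs_sub_le_of_floor_eq h.1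
  have h2 := abs_sub_le_of_floor_eq h.2
  rw [pow_zero, inv_one] at h1 h2
  exact max_le h1 h2

lemma card_le_of_hits {A : Set (ℝ × ℝ)} {y : ℝ × ℝ} {k : ℕ} {Z : Finset ℝ}
    {S : Finset (ℤ × ℤ)} {p : S → ℝ × ℝ} (hp : ∀ i, cell k (p i) = i) (F : Finset S)
    (hF : ∀ i ∈ F, Hits A y k Z i) :
    (F.image fun i => ⌊(2 : ℝ) ^ k * edst (p i) y⌋).card ≤ Z.card * 9 := by
  classical
  have hsub : (F.image fun i => ⌊(2 : ℝ) ^ k * edst (p i) y⌋) ⊆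
      Z.biUnion fun z => Finset.Icc (⌊(2 : ℝ) ^ k * z⌋ - 4) (⌊(2 : ℝ) ^ k * z⌋ + 4) := by
    intro n hn
    obtain ⟨i, hi, rfl⟩ := Finset.mem_image.mp hn
    obtain ⟨x, _, hx, z, hz, hxz⟩ := hF i hi
    refine Finset.mem_biUnion.mpr ⟨z, hz, ?_⟩
    have h1 := (abs_edst_sub_edst_le (p i) x y).trans
      (edst_le_of_cell_eq ((hp i).trans hx.symm))
    rw [one_div, inv_pow] at hxz
    have h2 : (0 : ℝ) < 2 ^ k := by positivity
    have h3 : |edst (p i) y - z| < 4 * ((2 : ℝ) ^ k)⁻¹ := by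
      have := abs_sub_le (edst (p i) y) (edst x y) z
      have : 0 < ((2 : ℝ) ^ k)⁻¹ := by positivity
      linarith
    have h4 : |(2 : ℝ) ^ k * edst (p i) y - 2 ^ k * z| < 4 := by
      rw [← mul_sub, abs_mul, abs_of_pos h2]
      calc _ < (2 : ℝ) ^ k * (4 * ((2 : ℝ) ^ k)⁻¹) := by gcongr
        _ = 4 := by field_simp
    rw [abs_lt] at h4
    have h5 := Int.floor_le ((2 : ℝ) ^ k * z)
    have h6 := Int.lt_floor_add_one ((2 : ℝ) ^ k * z)
    rw [Finset.mem_Icc]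
    constructor
    · refine Int.le_floor.mpr ?_
      push_cast
      linarith
    · refine Int.lt_add_one_iff.mp (Int.floor_lt.mpr ?_)
      push_cast
      linarith
  refine (Finset.card_le_card hsub).trans (Finset.card_biUnion_le_card_mul _ _ _ fun z _ => ?_)
  rw [Int.card_Icc]
  omega

open Classical in
/-- The main estimate for separated pieces. -/
lemma content_eq_zero_of_dimH_pinned_lt {s s' t u : ℝ} (hs : s ≤ 3 / 2)
    (hs' : s' ≤ s) (hs1 : s' ≤ 1) (ht : t ≤ 2) (hst : 2 < s' + t) (hu0 : 0 < u)
    (hu : u < 2 / 3 * s) {A E : Set (ℝ × ℝ)} (hA : MeasurableSet A) {r r' : ℤ × ℤ}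
    (hr : A ⊆ box (0, r)) (hr' : E ⊆ box (0, r')) (hApos : 0 < content s A)
    (hE : ∀ y ∈ E, dimH ((fun x => edst x y) '' A) < ENNReal.ofReal u) (ρ : ℕ)
    (hsep : ∀ x ∈ A, ∀ y ∈ E, ((2 : ℝ) ^ ρ)⁻¹ ≤ |y.2 - x.2|)
    (hfar : ∀ x ∈ A, ∀ y ∈ E, |y.2 - x.2| ≤ 2 ^ ρ)
    (hslope : ∀ x ∈ A, ∀ y ∈ E, |lineSlope x y| ≤ 2) : content t E = 0 := by
  by_contra hEpos
  obtain ⟨η, hη, hfinite⟩ := exists_lt_distCount hs hs' hs1 ht hst hu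
  obtain ⟨κ, D, hκ0, hDanti, hDA, hκ, hcpt⟩ := exists_antitone_of_content_pos hA hApos
  obtain ⟨m, hm0, hmle, hmsum, hmκ, hmne⟩ := exists_flow hDanti ((hDA 0).trans hr) hκ
  have hbox1 : ∀ (σ : ℝ) (F : Set (ℝ × ℝ)) (a : ℤ × ℤ), F ⊆ box (0, a) → content σ F ≤ 1 := by
    intro σ F a hF
    have := content_inter_box_le σ F (0, a)
    rw [inter_eq_left.mpr hF] at this
    simpa using this
  have hκfin : κ ≠ ⊤ := ne_top_of_le_ne_top ENNReal.one_ne_top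
    ((hκ 0).trans (hbox1 _ _ r ((hDA 0).trans hr)))
  have hmpos : 0 < m 0 r := (ENNReal.toReal_pos hκ0.ne' hκfin).trans_le hmκ
  set R : ℝ := 2 ^ (-(η / 2)) with hR
  have hR0 : 0 < R := by positivity
  have hR1 : R < 1 := Real.rpow_lt_one_of_one_lt_of_neg (by norm_num) (by linarith)
  have hEfin : content t E ≠ ⊤ := ne_top_of_le_ne_top ENNReal.one_ne_top (hbox1 _ _ r' hr')
  set e := (content t E).toReal with he
  have he0 : 0 < e := ENNReal.toReal_pos hEpos hEfin
  set c := m 0 r * (1 - R) / 2 with hc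
  set c' := e * (1 - R) / 2 with hc'
  have hR2 : 0 < 1 - R := by linarith
  have hc0 : 0 < c := by positivity
  have hc'0 : 0 < c' := by positivity
  have hev := hfinite 9 9 (c * c') (-Real.logb 2 (m 0 r)) ρ (by norm_num) (by positivity)
  obtain ⟨k₀, hk₀⟩ := eventually_atTop.mp hev
  set P : ℝ × ℝ → ℕ → Prop := fun y k => k₀ ≤ k ∧ ∃ Z : Finset ℝ, (Z.card : ℝ) ≤ 2 ^ (u * k) ∧
      c * R ^ k ≤ ∑ a ∈ (gen k r).filter (Hits A y k Z), m k a with hP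
  have hPex : ∀ y ∈ E, ∃ k, P y k := fun y hy =>
    exists_scale_hits hu0 hr hDA hcpt hm0 hmsum hmpos hmne (hE y hy) hR0 hR1 k₀
  -- choose the scale
  obtain ⟨T, hT⟩ : ∃ T, ENNReal.ofReal (c' * R ^ T) ≤ content t {y ∈ E | P y T} := by
    by_contra! hcon
    have h1 : content t E ≤ ENNReal.ofReal (e / 2) := by
      calc content t E ≤ content t (⋃ k, {y ∈ E | P y k}) := content_mono fun y hy => by
            obtain ⟨k, hk⟩ := hPex y hy
            exact mem_iUnion.mpr ⟨k, hy, hk⟩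
        _ ≤ ∑' k, content t {y ∈ E | P y k} := content_iUnion_le t _
        _ ≤ ∑' k : ℕ, ENNReal.ofReal (c' * R ^ k) := ENNReal.tsum_le_tsum fun k => (hcon k).le
        _ = ENNReal.ofReal (e / 2) := by
            rw [← ENNReal.ofReal_tsum_of_nonneg (fun k => by positivity)
              ((summable_geometric_of_lt_one hR0.le hR1).mul_left c'), tsum_mul_left,
              tsum_geometric_of_lt_one hR0.le hR1, hc']
            congr 1
            field_simp
    have h2 := ENNReal.toReal_le_of_le_ofReal (by positivity) h1
    linarith
  set Y := {y ∈ E | P y T} with hY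
  have hYE : Y ⊆ E := fun y hy => hy.1
  have hYpos : 0 < content t Y := lt_of_lt_of_le (by positivity) hT
  have hTk : k₀ ≤ T := by
    have hne : Y.Nonempty := by
      by_contra hne
      rw [not_nonempty_iff_eq_empty.mp hne, content_empty] at hYpos
      exact lt_irrefl _ hYpos
    exact hne.some_mem.2.1
  obtain ⟨n, hn0, hnle, hnsum, hnκ, hnne⟩ := exists_flow (s := t) (E := fun _ => Y)
    antitone_const (hYE.trans hr') (κ := content t Y) (fun _ => le_rfl)
  have hnY : c' * R ^ T ≤ n 0 r' := by
    refine le_trans ?_ hnκ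
    rwa [← ENNReal.ofReal_le_iff_le_toReal
      (ne_top_of_le_ne_top ENNReal.one_ne_top (hbox1 _ _ r' (hYE.trans hr')))]
  set S := (gen T r).filter (0 < m T ·) with hS
  set S' := (gen T r').filter (0 < n T ·) with hS'
  have hp : ∀ i : S, ∃ x, x ∈ A ∧ cell T x = i := fun i => by
    obtain ⟨x, hx, hxi⟩ := hmne T i (Finset.mem_filter.mp i.2).2 0
    exact ⟨x, hDA 0 hx, hxi⟩
  have hq : ∀ j : S', ∃ y, y ∈ Y ∧ cell T y = j := fun j =>
    hnne T j (Finset.mem_filter.mp j.2).2 0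
  choose p hpA hpc using hp
  choose q hqY hqc using hq
  have hZ : ∀ j, ∃ Z : Finset ℝ, (Z.card : ℝ) ≤ 2 ^ (u * T) ∧
      c * R ^ T ≤ ∑ a ∈ (gen T r).filter (Hits A (q j) T Z), m T a := fun j => (hqY j).2.2
  choose Z hZcard hZmass using hZ
  set G : Finset (S × S') := Finset.univ.filter fun z => Hits A (q z.2) T (Z z.2) z.1 with hG
  have hsumm : ∑ i : S, m T i = m 0 r := by
    rw [Finset.sum_coe_sort S (m T), ← sum_gen hmsum T 0 r, zero_add, hS]
    exact Finset.sum_filter_of_ne fun b _ hb => lt_of_le_of_ne (hm0 T b) (Ne.symm hb)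
  have hsumn : ∑ j : S', n T j = n 0 r' := by
    rw [Finset.sum_coe_sort S' (n T), ← sum_gen hnsum T 0 r', zero_add, hS']
    exact Finset.sum_filter_of_ne fun b _ hb => lt_of_le_of_ne (hn0 T b) (Ne.symm hb)
  have hone : ∀ (f : ℕ → ℤ × ℤ → ℝ) (σ : ℝ) (a : ℤ × ℤ), (∀ k a, f k a ≤ 2 ^ (-(σ * k))) →
      f 0 a ≤ 1 := fun f σ a h => (h 0 a).trans_eq (by simp)
  have hG1 : ∀ j : S', c * R ^ T ≤ ∑ i : S, if (i, j) ∈ G then m T i else 0 := by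
    intro j
    refine (hZmass j).trans (le_of_eq ?_)
    simp only [hG, Finset.mem_filter, Finset.mem_univ, true_and]
    rw [Finset.sum_coe_sort S fun i => if Hits A (q j) T (Z j) i then m T i else 0, hS,
      Finset.sum_filter, Finset.sum_filter]
    refine Finset.sum_congr rfl fun b _ => ?_
    by_cases hb : 0 < m T b
    · rw [if_pos hb]
    · rw [if_neg hb, le_antisymm (not_lt.mp hb) (hm0 T b), ite_self]
  have hmass : c * c' * (2 : ℝ) ^ (-(η * T)) ≤
      pairMass (fun i : S => m T i) (fun j : S' => n T j) G := by
    have hRT : (2 : ℝ) ^ (-(η * T)) = R ^ T * R ^ T := by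
      rw [hR, ← Real.rpow_natCast, ← Real.rpow_mul (by norm_num), ← Real.rpow_add (by norm_num)]
      congr 1
      ring
    rw [pairMass_eq', hRT]
    calc c * c' * (R ^ T * R ^ T) = c' * R ^ T * (c * R ^ T) := by ring
      _ ≤ n 0 r' * (c * R ^ T) := by gcongr
      _ = ∑ j : S', n T j * (c * R ^ T) := by rw [← Finset.sum_mul, hsumn]
      _ ≤ _ := by
        refine (Finset.sum_le_sum fun j _ =>
          mul_le_mul_of_nonneg_left (hG1 j) (hn0 T j)).trans (le_of_eq ?_)
        congr!
  obtain ⟨j, hj⟩ := hk₀ T hTk S S' (fun i => m T i) p (fun j => n T j) q G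
    (fun i => (Finset.mem_filter.mp i.2).2) (fun j => hn0 T j)
    (hsumm.trans_le (hone m s r hmle)) (hsumn.trans_le (hone n t r' hnle))
    (by rw [hsumm, neg_neg, Real.rpow_logb (by norm_num) (by norm_num) hmpos])
    (frost_of_flow hm0 hmle hmsum T S hpc) (frost_of_flow hn0 hnle hnsum T S' hqc)
    (fun i j => norm_sub_le_one_of_box (hr (hpA i)) (hr (hpA j)))
    (fun i j => norm_sub_le_one_of_box (hr' (hYE (hqY i))) (hr' (hYE (hqY j))))
    (fun i j => hsep _ (hpA i) _ (hYE (hqY j))) (fun i j => hfar _ (hpA i) _ (hYE (hqY j)))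
    (fun i j => hslope _ (hpA i) _ (hYE (hqY j))) hmass
  have h1 : distCount p q T G j ≤ (Z j).card * 9 := by
    have := card_le_of_hits (A := A) (y := q j) hpc
      (Finset.univ.filter fun i => Hits A (q j) T (Z j) i) fun i hi => (Finset.mem_filter.mp hi).2
    unfold distCount
    convert this using 4
    simp [hG]
  have h2 : (distCount p q T G j : ℝ) ≤ (Z j).card * 9 := by exact_mod_cast h1
  have h3 := hZcard j
  linarith

end separated
end

noncomputable section

section pinned

open scoped ENNReal NNReal Topology
open Filter

lemma exists_lt_dimH_inter_box {a : ℝ≥0∞} {E : Set (ℝ × ℝ)} (h : a < dimH E) :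
    ∃ r, a < dimH (E ∩ box (0, r)) := by
  have hE : E = ⋃ r, E ∩ box (0, r) := by
    ext x
    simp [box]
  rw [hE, dimH_iUnion, lt_iSup_iff] at h
  exact h

lemma measurableSet_box (Q : ℕ × ℤ × ℤ) : MeasurableSet (box Q) := by
  have : Measurable fun x : ℝ × ℝ => cell Q.1 x := by
    unfold cell
    fun_prop
  exact this (measurableSet_singleton Q.2)

lemma false_of_separated {s s' t u : ℝ} (hs : s ≤ 3 / 2) (hs0 : 0 < s)
    (hs' : s' ≤ s) (hs1 : s' ≤ 1) (ht0 : 0 < t) (ht : t ≤ 2) (hst : 2 < s' + t) (hu0 : 0 < u)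
    (hu : u < 2 / 3 * s) {A E : Set (ℝ × ℝ)} (hA : MeasurableSet A)
    (hAs : ENNReal.ofReal s < dimH A) (hEt : ENNReal.ofReal t < dimH E)
    (hE : ∀ y ∈ E, dimH ((fun x => edst x y) '' A) < ENNReal.ofReal u) (ρ : ℕ)
    (hsep : ∀ x ∈ A, ∀ y ∈ E, ((2 : ℝ) ^ ρ)⁻¹ ≤ |y.2 - x.2|)
    (hfar : ∀ x ∈ A, ∀ y ∈ E, |y.2 - x.2| ≤ 2 ^ ρ)
    (hslope : ∀ x ∈ A, ∀ y ∈ E, |lineSlope x y| ≤ 2) : False := by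
  obtain ⟨r, hr⟩ := exists_lt_dimH_inter_box hAs
  obtain ⟨r', hr'⟩ := exists_lt_dimH_inter_box hEt
  have h := content_eq_zero_of_dimH_pinned_lt hs hs' hs1 ht hst hu0 hu
    (hA.inter (measurableSet_box (0, r))) inter_subset_right
    (E := E ∩ box (0, r')) inter_subset_right (content_pos_of_lt_dimH hs0 hr)
    (fun y hy => (dimH_mono (image_mono inter_subset_left)).trans_lt (hE y hy.1)) ρ
    (fun x hx y hy => hsep x hx.1 y hy.1) (fun x hx y hy => hfar x hx.1 y hy.1)
    (fun x hx y hy => hslope x hx.1 y hy.1)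
  exact (content_pos_of_lt_dimH ht0 hr').ne' h

lemma continuousAt_lineSlope {x y : ℝ × ℝ} (h : y.2 - x.2 ≠ 0) :
    ContinuousAt (fun z : (ℝ × ℝ) × (ℝ × ℝ) => |lineSlope z.1 z.2|) (x, y) := by
  unfold lineSlope
  refine ContinuousAt.abs (ContinuousAt.div₀ ?_ ?_ h) <;> fun_prop

lemma false_of_vertical {s s' t u : ℝ} (hs : s ≤ 3 / 2) (hs0 : 0 < s)
    (hs' : s' ≤ s) (hs1 : s' ≤ 1) (ht0 : 0 < t) (ht : t ≤ 2) (hst : 2 < s' + t) (hu0 : 0 < u)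
    (hu : u < 2 / 3 * s) {A E : Set (ℝ × ℝ)} (hA : MeasurableSet A) {x₀ y₀ : ℝ × ℝ}
    (hx₀ : ∀ U ∈ 𝓝[A] x₀, ENNReal.ofReal s < dimH U)
    (hy₀ : ∀ V ∈ 𝓝[E] y₀, ENNReal.ofReal t < dimH V)
    (hE : ∀ y ∈ E, dimH ((fun x => edst x y) '' A) < ENNReal.ofReal u)
    (hxy : 0 < |y₀.2 - x₀.2|) (hxy' : |y₀.1 - x₀.1| ≤ |y₀.2 - x₀.2|) : False := by
  obtain ⟨a, ha⟩ := pow_unbounded_of_one_lt |y₀.2 - x₀.2| (one_lt_two)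
  obtain ⟨b, hb⟩ := pow_unbounded_of_one_lt |y₀.2 - x₀.2|⁻¹ (one_lt_two)
  set ρ := max a b
  have h1 : |y₀.2 - x₀.2| < 2 ^ ρ :=
    ha.trans_le (pow_le_pow_right₀ one_le_two (le_max_left _ _))
  have h2 : ((2 : ℝ) ^ ρ)⁻¹ < |y₀.2 - x₀.2| :=
    inv_lt_of_inv_lt₀ hxy (hb.trans_le (pow_le_pow_right₀ one_le_two (le_max_right _ _)))
  have h3 : |lineSlope x₀ y₀| < 2 := by
    rw [lineSlope, abs_div, abs_neg, div_lt_iff₀ hxy]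
    linarith
  have hc : Continuous fun z : (ℝ × ℝ) × (ℝ × ℝ) => |z.2.2 - z.1.2| := by fun_prop
  have hev : ∀ᶠ z in 𝓝 (x₀, y₀), (|z.2.2 - z.1.2| < 2 ^ ρ ∧ ((2 : ℝ) ^ ρ)⁻¹ < |z.2.2 - z.1.2|) ∧
      |lineSlope z.1 z.2| < 2 :=
    ((hc.continuousAt.eventually_lt continuousAt_const h1).and
      (continuousAt_const.eventually_lt hc.continuousAt h2)).and
      ((continuousAt_lineSlope (abs_pos.mp hxy)).eventually_lt continuousAt_const h3)
  obtain ⟨U, V, hU, hxU, hV, hyV, hUV⟩ := mem_nhds_prod_iff'.mp hev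
  have hall : ∀ x ∈ A ∩ U, ∀ y ∈ E ∩ V, (|y.2 - x.2| < 2 ^ ρ ∧ ((2 : ℝ) ^ ρ)⁻¹ < |y.2 - x.2|) ∧
      |lineSlope x y| < 2 := fun x hx y hy => hUV (mk_mem_prod hx.2 hy.2)
  exact false_of_separated hs hs0 hs' hs1 ht0 ht hst hu0 hu (hA.inter hU.measurableSet)
    (hx₀ _ (inter_mem_nhdsWithin _ (hU.mem_nhds hxU)))
    (hy₀ _ (inter_mem_nhdsWithin _ (hV.mem_nhds hyV)))
    (fun y hy => (dimH_mono (image_mono inter_subset_left)).trans_lt (hE y hy.1)) ρ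
    (fun x hx y hy => (hall x hx y hy).1.2.le) (fun x hx y hy => (hall x hx y hy).1.1.le)
    (fun x hx y hy => (hall x hx y hy).2.le)

lemma dimH_swap_preimage (A : Set (ℝ × ℝ)) : dimH (Prod.swap ⁻¹' A) = dimH A := by
  rw [← image_swap_eq_preimage_swap]
  exact (Isometry.of_dist_eq fun x y => by
    rw [Prod.dist_eq, Prod.dist_eq, max_comm]; rfl).dimH_image A

lemma swap_preimage_mem_nhdsWithin {A : Set (ℝ × ℝ)} {x : ℝ × ℝ} {U : Set (ℝ × ℝ)}
    (h : U ∈ 𝓝[Prod.swap ⁻¹' A] x.swap) : Prod.swap ⁻¹' U ∈ 𝓝[A] x :=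
  (continuous_swap.continuousWithinAt (s := A) (x := x)).tendsto_nhdsWithin (fun _ h => h) h

lemma edst_swap (x y : ℝ × ℝ) : edst x.swap y.swap = edst x y := by
  rw [← sq_eq_sq₀ (edst_nonneg _ _) (edst_nonneg _ _), edst_sq, edst_sq, add_comm]
  rfl

lemma false_of_lt_dimH {s s' t u : ℝ} (hs : s ≤ 3 / 2) (hs0 : 0 < s)
    (hs' : s' ≤ s) (hs1 : s' ≤ 1) (ht0 : 0 < t) (ht : t ≤ 2) (hst : 2 < s' + t) (hu0 : 0 < u)
    (hu : u < 2 / 3 * s) {A E : Set (ℝ × ℝ)} (hA : MeasurableSet A)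
    (hAs : ENNReal.ofReal s < dimH A) (hEt : ENNReal.ofReal t < dimH E)
    (hE : ∀ y ∈ E, dimH ((fun x => edst x y) '' A) < ENNReal.ofReal u) : False := by
  obtain ⟨x₀, -, hx₀⟩ := exists_mem_nhdsWithin_lt_dimH_of_lt_dimH hAs
  have hE' : ENNReal.ofReal t < dimH (E \ {x₀}) := by
    have h := dimH_mono (subset_sdiff_union E {x₀})
    rw [dimH_union, dimH_singleton, max_eq_left zero_le] at h
    exact hEt.trans_le h
  obtain ⟨y₀, hy, hy₀⟩ := exists_mem_nhdsWithin_lt_dimH_of_lt_dimH hE'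
  have hE1 : ∀ y ∈ E \ {x₀}, dimH ((fun x => edst x y) '' A) < ENNReal.ofReal u :=
    fun y hy => hE y hy.1
  have hne : ¬(y₀.1 - x₀.1 = 0 ∧ y₀.2 - x₀.2 = 0) := fun h =>
    hy.2 (Prod.ext (sub_eq_zero.mp h.1) (sub_eq_zero.mp h.2))
  rcases le_total |y₀.1 - x₀.1| |y₀.2 - x₀.2| with h | h
  · refine false_of_vertical hs hs0 hs' hs1 ht0 ht hst hu0 hu hA hx₀ hy₀ hE1 ?_ h
    refine abs_pos.mpr fun h0 => hne ⟨?_, h0⟩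
    rw [h0, abs_zero] at h
    exact abs_nonpos_iff.mp h
  · refine false_of_vertical (x₀ := x₀.swap) (y₀ := y₀.swap) hs hs0 hs' hs1 ht0 ht hst hu0 hu
      (A := Prod.swap ⁻¹' A) (E := Prod.swap ⁻¹' (E \ {x₀})) (measurable_swap hA)
      (fun U hU => (hx₀ _ (swap_preimage_mem_nhdsWithin hU)).trans_eq (dimH_swap_preimage U))
      (fun U hU => (hy₀ _ (swap_preimage_mem_nhdsWithin hU)).trans_eq (dimH_swap_preimage U))
      (fun y hy => ?_) ?_ h
    · refine lt_of_eq_of_lt (congrArg dimH ?_) (hE1 _ hy)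
      rw [← image_swap_eq_preimage_swap, image_image]
      refine image_congr fun x _ => ?_
      rw [← edst_swap, Prod.swap_swap]
    · refine abs_pos.mpr fun h0 => hne ⟨h0, ?_⟩
      change y₀.1 - x₀.1 = 0 at h0
      rw [h0, abs_zero] at h
      exact abs_nonpos_iff.mp h

/-- The theorem in coordinates. -/
lemma dimH_pinned_le {A : Set (ℝ × ℝ)} (hA : MeasurableSet A) {s : ℝ}
    (hs : dimH A = ENNReal.ofReal s) :
    dimH {y | dimH ((fun x => edst x y) '' A) < ENNReal.ofReal (min (2 / 3 * s) 1)} ≤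
      ENNReal.ofReal (max 1 (2 - s)) := by
  by_contra! hlt
  have hE : {y | dimH ((fun x => edst x y) '' A) < ENNReal.ofReal (min (2 / 3 * s) 1)} ⊆
      ⋃ n : ℕ, {y | dimH ((fun x => edst x y) '' A) <
        ENNReal.ofReal (min (2 / 3 * s) 1 - 1 / (n + 1))} := by
    intro y hy
    have hlim : Tendsto (fun n : ℕ => ENNReal.ofReal (min (2 / 3 * s) 1 - 1 / ((n : ℝ) + 1))) atTop
        (𝓝 (ENNReal.ofReal (min (2 / 3 * s) 1))) := by
      refine (ENNReal.continuous_ofReal.tendsto _).comp ?_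
      simpa using tendsto_const_nhds.sub (tendsto_one_div_add_atTop_nhds_zero_nat (𝕜 := ℝ))
    obtain ⟨n, hn⟩ := (hlim.eventually_const_lt hy).exists
    exact mem_iUnion.mpr ⟨n, hn⟩
  have h1 := hlt.trans_le (dimH_mono hE)
  rw [dimH_iUnion, lt_iSup_iff] at h1
  obtain ⟨n, hn⟩ := h1
  set u := min (2 / 3 * s) 1 - 1 / ((n : ℝ) + 1)
  set E := {y | dimH ((fun x => edst x y) '' A) < ENNReal.ofReal u} with hEdef
  have hpos : (0 : ℝ) < 1 / ((n : ℝ) + 1) := by positivity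
  have hus : u < 2 / 3 * s := (sub_lt_self _ hpos).trans_le (min_le_left _ _)
  have hu1 : u < 1 := (sub_lt_self _ hpos).trans_le (min_le_right _ _)
  have hE2 : dimH E ≤ 2 := by
    refine (dimH_mono (subset_univ E)).trans ?_
    rw [Real.dimH_univ_eq_finrank]
    simp
  have hu0 : 0 < u := by
    by_contra! h0
    rw [show E = ∅ by simp [hEdef, ENNReal.ofReal_of_nonpos h0], dimH_empty] at hn
    exact not_lt_zero hn
  obtain ⟨d, hd1, hd2⟩ := exists_between hn
  have hdt : d ≠ ⊤ := (hd2.trans_le le_top).ne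
  set t := d.toReal with ht
  have hdt' : ENNReal.ofReal t = d := ENNReal.ofReal_toReal hdt
  have ht1 : max 1 (2 - s) < t := (ENNReal.ofReal_lt_iff_lt_toReal (by positivity) hdt).mp hd1
  have ht2 : t ≤ 2 := ENNReal.toReal_le_of_le_ofReal (by norm_num)
    (by simpa using (hd2.le.trans hE2))
  have ht3 := (le_max_left _ _).trans_lt ht1
  have ht4 := (le_max_right _ _).trans_lt ht1
  obtain ⟨s₁, h5, h6⟩ : ∃ s₁, max (3 / 2 * u) (2 - t) < s₁ ∧ s₁ < min s (3 / 2) := by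
    refine exists_between ?_
    simp only [max_lt_iff, lt_min_iff]
    refine ⟨⟨?_, ?_⟩, ?_, ?_⟩ <;> linarith
  rw [max_lt_iff] at h5
  rw [lt_min_iff] at h6
  refine false_of_lt_dimH (s' := min s₁ 1) h6.2.le (by linarith) (min_le_left _ _)
    (min_le_right _ _) (by linarith) ht2 ?_ hu0 (by linarith) hA ?_ (hdt'.trans_lt hd2)
    (fun y hy => hy)
  · rcases min_choice s₁ 1 with h | h <;> rw [h] <;> linarith
  · rw [hs, ENNReal.ofReal_lt_ofReal_iff (by linarith)]
    exact h6.1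

end pinned

end

/-- **Theorem (pinned distance sets).**
If `A ⊆ ℝ²` is Borel with Hausdorff dimension `s`, then the set of pins `y` whose pinned
distance set `Δ_y(A) = {|x - y| : x ∈ A}` has Hausdorff dimension `< min((2/3)s, 1)`
has Hausdorff dimension at most `max(1, 2 - s)`. -/
theorem statement0 (A : Set (EuclideanSpace ℝ (Fin 2))) (hA : MeasurableSet A) (s : ℝ)
    (hs : dimH A = ENNReal.ofReal s) :
    dimH {y : EuclideanSpace ℝ (Fin 2) |
        dimH ((fun x => dist x y) '' A) < ENNReal.ofReal (min (2 / 3 * s) 1)} ≤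
      ENNReal.ofReal (max 1 (2 - s)) := by
  let φ : EuclideanSpace ℝ (Fin 2) ≃L[ℝ] ℝ × ℝ :=
    (EuclideanSpace.equiv (Fin 2) ℝ).trans (ContinuousLinearEquiv.piFinTwo ℝ fun _ => ℝ)
  have hφ : ∀ x y, dist x y = edst (φ x) (φ y) := fun x y => by
    rw [← sq_eq_sq₀ dist_nonneg (edst_nonneg _ _), edst_sq, EuclideanSpace.dist_eq,
      Real.sq_sqrt (by positivity), Fin.sum_univ_two, Real.dist_eq, Real.dist_eq, sq_abs, sq_abs]
    rfl
  have hA' : MeasurableSet (φ '' A) :=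
    φ.toHomeomorph.toMeasurableEquiv.measurableEmbedding.measurableSet_image.mpr hA
  have h := dimH_pinned_le hA' ((φ.dimH_image A).trans hs)
  rw [← φ.dimH_preimage] at h
  refine le_of_eq_of_le (congrArg dimH (Set.ext fun y => ?_)) h
  change dimH ((fun x => dist x y) '' A) < ENNReal.ofReal (min (2 / 3 * s) 1) ↔
    dimH ((fun x => edst x (φ y)) '' (φ '' A)) < ENNReal.ofReal (min (2 / 3 * s) 1)
  rw [image_image]
  simp only [hφ]
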